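/- Let w1 and w2 be non-trivial words. Then there exists an integer N (depending only on w1 and w2) such that for every n divisible by 2^N and every prime power q, w1(Sp_{2n}(q))·w2(Sp_{2n}(q)) = Sp_{2n}(q). -/

import Mathlib

/-- The set of values of the word `w` in the group `G`: the image of the word map
`G^d → G` induced by substitution. -/
def wordImage {d : ℕ} (w : FreeGroup (Fin d)) (G : Type*) [Group G] : Set G :=
  Set.range fun f : Fin d → G => FreeGroup.lift f w

namespace SymplecticWord

open Polynomial Module

section

variable {F U : Type} [Field F] [AddCommGroup U] [Module F U]

/-- `g` is an isometry, with inverse `gi`, of the nondegenerate alternating form `ω`. -/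
structure IsSympl (ω : LinearMap.BilinForm F U) (g gi : Module.End F U) : Prop where
  alt : ∀ x, ω x x = 0
  nd : ∀ x, (∀ y, ω x y = 0) → x = 0
  iso : ∀ x y, ω (g x) (g y) = ω x y
  right : ∀ x, g (gi x) = x
  left : ∀ x, gi (g x) = x

namespace IsSympl

variable {ω : LinearMap.BilinForm F U} {g gi : Module.End F U} (h : IsSympl ω g gi)
include h

theorem skew (x y : U) : ω x y = -ω y x := by
  have := h.alt (x + y)
  simp [h.alt] at this
  linear_combination this

theorem neg : IsSympl ω (-g) (-gi) where
  alt := h.alt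
  nd := h.nd
  iso x y := by simp [h.iso]
  right x := by simp [h.right]
  left x := by simp [h.left]

theorem adj (x y : U) : ω (g x) y = ω x (gi y) := by
  conv_lhs => rw [← h.right y, h.iso]

theorem adj' (x y : U) : ω (gi x) y = ω x (g y) := by
  conv_rhs => rw [← h.right x, h.iso]

theorem tau_adj (x y : U) : ω ((g + gi) x) y = ω x ((g + gi) y) := by
  simp [h.adj, h.adj', add_comm]

theorem pow_adj (k : ℕ) (x y : U) : ω (((g + gi) ^ k) x) y = ω x (((g + gi) ^ k) y) := by
  induction k generalizing x y with
  | zero => simp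
  | succ k ih => rw [pow_succ, Module.End.mul_apply, ih, h.tau_adj, ← Module.End.mul_apply,
      ← pow_succ', pow_succ]

theorem aeval_adj (p : F[X]) (x y : U) :
    ω (aeval (g + gi) p x) y = ω x (aeval (g + gi) p y) := by
  induction p using Polynomial.induction_on' with
  | add p q hp hq => simp [hp, hq]
  | monomial n a => simp [aeval_monomial, h.pow_adj]

theorem tau_alt (x : U) : ω ((g + gi) x) x = 0 := by
  rw [LinearMap.add_apply, map_add, LinearMap.add_apply, h.adj' x x, h.skew x (g x)]
  simp

theorem aeval_alt (p : F[X]) (x : U) : ω (aeval (g + gi) p x) x = 0 := by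
  induction p using Polynomial.induction_on' with
  | add p q hp hq => simp [hp, hq]
  | monomial n a =>
    simp only [aeval_monomial, Module.End.mul_apply, Module.algebraMap_end_apply, map_smul,
      LinearMap.smul_apply]
    suffices ω (((g + gi) ^ n) x) x = 0 by simp [this]
    obtain ⟨k, rfl | rfl⟩ := Nat.even_or_odd' n
    · rw [two_mul, pow_add, Module.End.mul_apply, h.pow_adj, h.alt]
    · rw [two_mul, add_assoc, pow_add, Module.End.mul_apply, h.pow_adj, pow_succ',
        Module.End.mul_apply, h.tau_alt]

/-- Cyclic `F[τ]`-submodules are isotropic. -/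
theorem aeval_aeval (p q : F[X]) (x : U) :
    ω (aeval (g + gi) p x) (aeval (g + gi) q x) = 0 := by
  rw [h.skew, ← h.aeval_adj, ← Module.End.mul_apply, ← map_mul, h.aeval_alt, neg_zero]

theorem comm : Commute g (g + gi) := by
  ext x
  simp [h.right, h.left]

theorem comm_aeval (p : F[X]) (x : U) :
    g (aeval (g + gi) p x) = aeval (g + gi) p (g x) := by
  have : g ∈ Subalgebra.centralizer F {g + gi} := by
    rw [Subalgebra.mem_centralizer_iff]
    rintro _ rfl
    exact h.comm.symm
  have h2 : aeval (g + gi) p ∈ Algebra.adjoin F {g + gi} := aeval_mem_adjoin_singleton F _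
  have h3 := Algebra.adjoin_le_centralizer_centralizer F {g + gi} h2
  rw [Subalgebra.mem_centralizer_iff] at h3
  have := h3 g this
  exact LinearMap.congr_fun this x

theorem sq (x : U) : g (g x) = g ((g + gi) x) - x := by
  simp [h.right]

theorem symm_of {x y : U} (hxy : ω ((g + gi) x) y = 0) : ω (g x) y = ω (g y) x := by
  rw [LinearMap.add_apply, map_add, LinearMap.add_apply, h.adj' x y, h.skew x] at hxy
  linear_combination hxy

end IsSympl

/-- The eigenvalue attached to a type: `-1` for the type `-1` and `1` for all other types. -/
def sgn (F : Type) [Field F] (t : ℤ) : F := if t = -1 then -1 else 1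

/-- The families `e`, `e'` form a hyperbolic system for `ω`, on which `g` has the prescribed
eigenvalues as a bilinear pairing. -/
structure Fam (ω : LinearMap.BilinForm F U) (g : Module.End F U) {ι : Type} [DecidableEq ι]
    (t : ι → ℤ) (e e' : ι → U) : Prop where
  iso : ∀ i j, ω (e i) (e j) = 0
  iso' : ∀ i j, ω (e' i) (e' j) = 0
  pair : ∀ i j, ω (e i) (e' j) = if i = j then 1 else 0
  gpair : ∀ i j, ω (g (e i)) (e' j) = if i = j then sgn F (t i) else 0
  fix : ∀ i, t i ≠ 0 → g (e i) = sgn F (t i) • e i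
  gpair' : ∀ i j, i ≠ j → t i ≠ 0 → t j ≠ 0 → ω (g (e' i)) (e' j) = 0

/-- Both `g` and `-g` have a hyperbolic system of maximal size, with opposite types. -/
def Dec (ω : LinearMap.BilinForm F U) (g : Module.End F U) : Prop :=
  ∃ (ι : Type) (_ : Fintype ι) (_ : DecidableEq ι) (t : ι → ℤ) (e e' f f' : ι → U),
    Fam ω g t e e' ∧ Fam ω (-g) (-t) f f' ∧ finrank F U = 2 * Fintype.card ι

section Hyperbolic

variable {ω : LinearMap.BilinForm F U} {g gi : Module.End F U} {ι : Type} [DecidableEq ι]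
  {e e' : ι → U} [Fintype ι]

theorem pair_sum (h : IsSympl ω g gi) (iso : ∀ i j, ω (e i) (e j) = 0)
    (iso' : ∀ i j, ω (e' i) (e' j) = 0) (pair : ∀ i j, ω (e i) (e' j) = if i = j then 1 else 0)
    (a b : ι → F) (j : ι) :
    ω (∑ i, a i • e i + ∑ i, b i • e' i) (e' j) = a j ∧
    ω (∑ i, a i • e i + ∑ i, b i • e' i) (e j) = - b j := by
  have pair' : ∀ i j, ω (e' i) (e j) = if j = i then -1 else 0 := fun i j => by
    rw [h.skew, pair]; split_ifs <;> simp
  constructor <;> simp [map_sum, LinearMap.sum_apply, iso, iso', pair, pair']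

theorem linearIndependent_hyperbolic (h : IsSympl ω g gi) (iso : ∀ i j, ω (e i) (e j) = 0)
    (iso' : ∀ i j, ω (e' i) (e' j) = 0) (pair : ∀ i j, ω (e i) (e' j) = if i = j then 1 else 0) :
    LinearIndependent F (Sum.elim e e') := by
  rw [Fintype.linearIndependent_iff]
  intro c hc
  simp only [Fintype.sum_sum_type, Sum.elim_inl, Sum.elim_inr] at hc
  rintro (j | j)
  · have := (pair_sum h iso iso' pair (fun i => c (.inl i)) (fun i => c (.inr i)) j).1
    rw [hc] at this
    simpa using this.symm
  · have := (pair_sum h iso iso' pair (fun i => c (.inl i)) (fun i => c (.inr i)) j).2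
    rw [hc] at this
    simpa using this.symm

theorem span_hyperbolic (h : IsSympl ω g gi) (iso : ∀ i j, ω (e i) (e j) = 0)
    (iso' : ∀ i j, ω (e' i) (e' j) = 0) (pair : ∀ i j, ω (e i) (e' j) = if i = j then 1 else 0)
    (D : Submodule F U) (hD : D = Submodule.span F (Set.range (Sum.elim e e'))) :
    finrank F D = 2 * Fintype.card ι ∧ ∀ x ∈ D, (∀ y ∈ D, ω x y = 0) → x = 0 := by
  subst hD
  constructor
  · rw [finrank_span_eq_card (linearIndependent_hyperbolic h iso iso' pair)]
    simp [two_mul]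
  · intro x hx hy
    obtain ⟨c, rfl⟩ := (Submodule.mem_span_range_iff_exists_fun F).1 hx
    simp only [Fintype.sum_sum_type, Sum.elim_inl, Sum.elim_inr] at hy ⊢
    have h1 : ∀ j, c (.inl j) = 0 := fun j => by
      rw [← (pair_sum h iso iso' pair (fun i => c (.inl i)) (fun i => c (.inr i)) j).1]
      exact hy _ (Submodule.subset_span ⟨.inr j, rfl⟩)
    have h2 : ∀ j, c (.inr j) = 0 := fun j => by
      rw [← neg_eq_zero,
        ← (pair_sum h iso iso' pair (fun i => c (.inl i)) (fun i => c (.inr i)) j).2]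
      exact hy _ (Submodule.subset_span ⟨.inl j, rfl⟩)
    simp [h1, h2]

end Hyperbolic

end

section

variable {F U : Type} [Field F] [AddCommGroup U] [Module F U]
  {ω : LinearMap.BilinForm F U} {g gi : Module.End F U}

theorem Fam.elim {ι κ : Type} [DecidableEq ι] [DecidableEq κ] {t : ι → ℤ} {t' : κ → ℤ}
    {e e' : ι → U} {f f' : κ → U} (h : IsSympl ω g gi) (D E : Submodule F U)
    (hDE : ∀ x ∈ D, ∀ y ∈ E, ω x y = 0) (gD : ∀ x ∈ D, g x ∈ D) (gE : ∀ x ∈ E, g x ∈ E)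
    (he : ∀ i, e i ∈ D) (he' : ∀ i, e' i ∈ D) (hf : ∀ i, f i ∈ E) (hf' : ∀ i, f' i ∈ E)
    (h1 : Fam ω g t e e') (h2 : Fam ω g t' f f') :
    Fam ω g (Sum.elim t t') (Sum.elim e f) (Sum.elim e' f') := by
  have hED : ∀ x ∈ E, ∀ y ∈ D, ω x y = 0 := fun x hx y hy => by
    rw [h.skew, hDE y hy x hx, neg_zero]
  refine ⟨?_, ?_, ?_, ?_, ?_, ?_⟩
  · rintro (i | i) (j | j)
    · exact h1.iso i j
    · exact hDE _ (he i) _ (hf j)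
    · exact hED _ (hf i) _ (he j)
    · exact h2.iso i j
  · rintro (i | i) (j | j)
    · exact h1.iso' i j
    · exact hDE _ (he' i) _ (hf' j)
    · exact hED _ (hf' i) _ (he' j)
    · exact h2.iso' i j
  · rintro (i | i) (j | j)
    · simpa using h1.pair i j
    · simpa using hDE _ (he i) _ (hf' j)
    · simpa using hED _ (hf i) _ (he' j)
    · simpa using h2.pair i j
  · rintro (i | i) (j | j)
    · simpa using h1.gpair i j
    · simpa using hDE _ (gD _ (he i)) _ (hf' j)
    · simpa using hED _ (gE _ (hf i)) _ (he' j)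
    · simpa using h2.gpair i j
  · rintro (i | i)
    · simpa using h1.fix i
    · simpa using h2.fix i
  · rintro (i | i) (j | j) hij
    · simpa using h1.gpair' i j (by simpa using hij)
    · intros; simpa using hDE _ (gD _ (he' i)) _ (hf' j)
    · intros; simpa using hED _ (gE _ (hf' i)) _ (he' j)
    · simpa using h2.gpair' i j (by simpa using hij)

/-- Splitting off an orthogonal summand. -/
theorem dec_of_piece [FiniteDimensional F U] (h : IsSympl ω g gi) (D : Submodule F U)
    (hD : D ≠ ⊥) (nd : ∀ x ∈ D, (∀ y ∈ D, ω x y = 0) → x = 0)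
    (gD : ∀ x ∈ D, g x ∈ D) (giD : ∀ x ∈ D, gi x ∈ D)
    {ι : Type} [Fintype ι] [DecidableEq ι] (t : ι → ℤ) (e e' f f' : ι → U)
    (he : ∀ i, e i ∈ D) (he' : ∀ i, e' i ∈ D) (hf : ∀ i, f i ∈ D) (hf' : ∀ i, f' i ∈ D)
    (h1 : Fam ω g t e e') (h2 : Fam ω (-g) (-t) f f') (hcard : finrank F D = 2 * Fintype.card ι)
    (IH : ∀ (V : Type) [AddCommGroup V] [Module F V] [FiniteDimensional F V]
      (ω : LinearMap.BilinForm F V) (g gi : Module.End F V), IsSympl ω g gi →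
      finrank F V < finrank F U → Dec ω g) : Dec ω g := by
  have hrefl : ω.IsRefl := fun x y hxy => by rw [h.skew, hxy, neg_zero]
  have hr' : (ω.restrict D).IsRefl := fun x y hxy => hrefl x y hxy
  have hr : (ω.restrict D).Nondegenerate := by
    refine (LinearMap.IsRefl.nondegenerate_iff_separatingLeft hr').2 ?_
    intro x hx
    exact Subtype.ext (nd x x.2 fun y hy => hx ⟨y, hy⟩)
  have hc := LinearMap.BilinForm.isCompl_orthogonal_of_restrict_nondegenerate hrefl hr
  set E := ω.orthogonal D with hE
  have hDE : ∀ x ∈ D, ∀ y ∈ E, ω x y = 0 := fun x hx y hy =>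
    (LinearMap.BilinForm.mem_orthogonal_iff.1 hy) x hx
  have gE : ∀ x ∈ E, g x ∈ E := fun y hy => LinearMap.BilinForm.mem_orthogonal_iff.2
    fun x hx => by
      show ω x (g y) = 0
      rw [← h.adj' x y]; exact hDE _ (giD x hx) y hy
  have giE : ∀ x ∈ E, gi x ∈ E := fun y hy => LinearMap.BilinForm.mem_orthogonal_iff.2
    fun x hx => by
      show ω x (gi y) = 0
      rw [← h.adj x y]; exact hDE _ (gD x hx) y hy
  have hdim := Submodule.finrank_add_eq_of_isCompl hc
  have hpos : 0 < finrank F D := Nat.pos_of_ne_zero fun h0 => hD (Submodule.finrank_eq_zero.1 h0)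
  have hS : IsSympl (ω.restrict E) (g.restrict gE) (gi.restrict giE) := by
    refine ⟨fun x => h.alt x, fun x hx => ?_, fun x y => h.iso x y,
      fun x => Subtype.ext (h.right x), fun x => Subtype.ext (h.left x)⟩
    refine Subtype.ext (h.nd x fun y => ?_)
    obtain ⟨d, z, rfl⟩ : ∃ (d : D) (z : E), (d : U) + z = y := by
      have : y ∈ D ⊔ E := by rw [hc.sup_eq_top]; trivial
      obtain ⟨d, hd, z, hz, rfl⟩ := Submodule.mem_sup.1 this
      exact ⟨⟨d, hd⟩, ⟨z, hz⟩, rfl⟩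
    rw [map_add, h.skew, hDE d d.2 x x.2]
    simpa using hx z
  obtain ⟨κ, _, _, s, a, a', b, b', h3, h4, h5⟩ := IH E _ _ _ hS (by omega)
  refine ⟨ι ⊕ κ, inferInstance, inferInstance, Sum.elim t s, Sum.elim e fun i => a i,
    Sum.elim e' fun i => a' i, Sum.elim f fun i => b i, Sum.elim f' fun i => b' i, ?_, ?_, ?_⟩
  · exact h1.elim h D E hDE gD gE he he' (fun i => (a i).2) (fun i => (a' i).2)
      ⟨h3.iso, h3.iso', h3.pair, h3.gpair, fun i hi => congrArg Subtype.val (h3.fix i hi),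
        h3.gpair'⟩
  · have : -(Sum.elim t s) = Sum.elim (-t) (-s) := by ext (i | i) <;> rfl
    rw [this]
    exact h2.elim h.neg D E hDE (fun x hx => D.neg_mem (gD x hx)) (fun x hx => E.neg_mem (gE x hx))
      hf hf' (fun i => (b i).2) (fun i => (b' i).2)
      ⟨h4.iso, h4.iso', h4.pair, h4.gpair, fun i hi => congrArg Subtype.val (h4.fix i hi),
        h4.gpair'⟩
  · rw [← hdim, hcard, h5, Fintype.card_sum]; ring

/-- Dual bases of a submodule on which `(x, y) ↦ ω (g x) y` is nondegenerate. -/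
theorem exists_dual_families [FiniteDimensional F U] (R : Submodule F U)
    (sym : ∀ x ∈ R, ∀ y ∈ R, ω (g x) y = ω (g y) x)
    (nd : ∀ x ∈ R, (∀ y ∈ R, ω (g x) y = 0) → x = 0) :
    ∃ e d : Fin (finrank F R) → U, (∀ i, e i ∈ R) ∧ (∀ i, d i ∈ R) ∧
      Submodule.span F (Set.range e) = R ∧ Submodule.span F (Set.range d) = R ∧
      ∀ i j, ω (g (d j)) (e i) = if i = j then -1 else 0 := by
  let B : LinearMap.BilinForm F R := (ω.comp g LinearMap.id).restrict R
  have hB : B.IsRefl := fun x y hxy => by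
    show ω (g y) x = 0
    rw [sym y y.2 x x.2]; exact hxy
  have hBn : B.Nondegenerate := by
    refine (LinearMap.IsRefl.nondegenerate_iff_separatingLeft hB).2 ?_
    intro x hx
    exact Subtype.ext (nd x x.2 fun y hy => hx ⟨y, hy⟩)
  let b := finBasis F R
  let c := B.dualBasis hBn b
  refine ⟨fun i => b i, fun j => -(c j : U), fun i => (b i).2, fun j => R.neg_mem (c j).2, ?_, ?_,
    ?_⟩
  · have := congrArg (Submodule.map R.subtype) b.span_eq
    rw [Submodule.map_span, ← Set.range_comp, Submodule.map_top, Submodule.range_subtype] at this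
    exact this
  · have := congrArg (Submodule.map R.subtype) c.span_eq
    rw [Submodule.map_span, ← Set.range_comp, Submodule.map_top, Submodule.range_subtype] at this
    conv_rhs => rw [← this]
    apply le_antisymm <;> rw [Submodule.span_le] <;> rintro _ ⟨i, rfl⟩
    · exact Submodule.neg_mem _ (Submodule.subset_span ⟨i, rfl⟩)
    · rw [← neg_neg ((R.subtype ∘ c) i)]
      exact Submodule.neg_mem _ (Submodule.subset_span ⟨i, rfl⟩)
  · intro i j
    have := LinearMap.BilinForm.apply_dualBasis_left hBn b j i
    have h2 : ω (g (c j)) (b i) = if i = j then 1 else 0 := this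
    simp [h2]
    split_ifs <;> simp

/-- The hyperbolic system built from dual families. -/
theorem fam_of_dual (h : IsSympl ω g gi) (R : Submodule F U)
    (iso : ∀ x ∈ R, ∀ y ∈ R, ω x y = 0)
    (sym : ∀ x ∈ R, ∀ y ∈ R, ω (g x) y = ω (g y) x)
    {ι : Type} [DecidableEq ι] (e d : ι → U) (he : ∀ i, e i ∈ R) (hd : ∀ i, d i ∈ R)
    (hed : ∀ i j, ω (g (d j)) (e i) = if i = j then -1 else 0) :
    Fam ω g (fun _ => 0) e (fun j => g (d j) - d j) := by
  refine ⟨fun i j => iso _ (he i) _ (he j), fun i j => ?_, fun i j => ?_, fun i j => ?_,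
    fun i hi => absurd rfl hi, fun i j _ hi => absurd rfl hi⟩
  · rw [map_sub, map_sub, LinearMap.sub_apply, LinearMap.sub_apply, h.iso, iso _ (hd i) _ (hd j),
      h.skew (d i), sym _ (hd j) _ (hd i)]
    ring
  · rw [map_sub, iso _ (he i) _ (hd j), h.skew, hed]
    split_ifs <;> simp
  · rw [map_sub, h.iso, iso _ (he i) _ (hd j), sym _ (he i) _ (hd j), hed]
    split_ifs <;> simp [sgn]

end

section

variable {F U : Type} [Field F] [AddCommGroup U] [Module F U]
  {ω : LinearMap.BilinForm F U} {g gi : Module.End F U}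

/-- An isotropic subspace, stable under `g + g⁻¹`, on which `(x, y) ↦ ω (g x) y` is
nondegenerate. -/
structure Flex (ω : LinearMap.BilinForm F U) (g gi : Module.End F U) (Z : Submodule F U) :
    Prop where
  stable : ∀ x ∈ Z, (g + gi) x ∈ Z
  iso : ∀ x ∈ Z, ∀ y ∈ Z, ω x y = 0
  nd : ∀ x ∈ Z, (∀ y ∈ Z, ω (g x) y = 0) → x = 0

theorem Flex.neg {Z : Submodule F U} (hZ : Flex ω g gi Z) : Flex ω (-g) (-gi) Z where
  stable x hx := by
    have := Z.neg_mem (hZ.stable x hx)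
    simpa [add_comm] using this
  iso := hZ.iso
  nd x hx h := hZ.nd x hx fun y hy => by simpa using h y hy

theorem dec_of_flex [FiniteDimensional F U] (h : IsSympl ω g gi) (Z : Submodule F U)
    (hZ : Flex ω g gi Z) (hne : Z ≠ ⊥)
    (IH : ∀ (V : Type) [AddCommGroup V] [Module F V] [FiniteDimensional F V]
      (ω : LinearMap.BilinForm F V) (g gi : Module.End F V), IsSympl ω g gi →
      finrank F V < finrank F U → Dec ω g) : Dec ω g := by
  have sym : ∀ x ∈ Z, ∀ y ∈ Z, ω (g x) y = ω (g y) x := fun x hx y hy =>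
    h.symm_of (hZ.iso _ (hZ.stable x hx) _ hy)
  obtain ⟨e, d, he, hd, hse, hsd, hed⟩ := exists_dual_families Z sym hZ.nd
  have hF := fam_of_dual h Z hZ.iso sym e d he hd hed
  have hF' := fam_of_dual h.neg Z hZ.iso (fun x hx y hy => by simp [sym x hx y hy]) e (fun j => -d j)
    he (fun j => Z.neg_mem (hd j)) (fun i j => by simpa using hed i j)
  let D : Submodule F U := Z ⊔ Z.map g
  have hZD : ∀ x ∈ Z, x ∈ D := fun x hx => Submodule.mem_sup_left hx
  have hgD : ∀ x ∈ Z, g x ∈ D := fun x hx => Submodule.mem_sup_right ⟨x, hx, rfl⟩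
  have hD : D = Submodule.span F (Set.range (Sum.elim e fun j => g (d j) - d j)) := by
    have h1 : Z ≤ Submodule.span F (Set.range (Sum.elim e fun j => g (d j) - d j)) := by
      conv_lhs => rw [← hse]
      refine Submodule.span_mono ?_
      rintro _ ⟨i, rfl⟩
      exact ⟨.inl i, rfl⟩
    apply le_antisymm
    · refine sup_le h1 ?_
      conv_lhs => rw [← hsd]
      rw [Submodule.map_span, Submodule.span_le]
      rintro _ ⟨_, ⟨i, rfl⟩, rfl⟩
      rw [← sub_add_cancel (g (d i)) (d i)]
      exact Submodule.add_mem _ (Submodule.subset_span ⟨.inr i, rfl⟩) (h1 (hd i))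
    · rw [Submodule.span_le]
      rintro _ ⟨i | i, rfl⟩
      · exact hZD _ (he i)
      · exact D.sub_mem (hgD _ (hd i)) (hZD _ (hd i))
  obtain ⟨hc, hnd⟩ := span_hyperbolic h hF.iso hF.iso' hF.pair D hD
  have hgg : ∀ x ∈ D, g x ∈ D := by
    intro x hx
    obtain ⟨z, hz, _, ⟨y, hy, rfl⟩, rfl⟩ := Submodule.mem_sup.1 hx
    rw [map_add, h.sq]
    exact D.add_mem (hgD _ hz) (D.sub_mem (hgD _ (hZ.stable _ hy)) (hZD _ hy))
  have hgig : ∀ x ∈ D, gi x ∈ D := by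
    intro x hx
    obtain ⟨z, hz, _, ⟨y, hy, rfl⟩, rfl⟩ := Submodule.mem_sup.1 hx
    rw [map_add, h.left]
    refine D.add_mem ?_ (hZD _ hy)
    have : gi z = (g + gi) z - g z := by simp
    rw [this]
    exact D.sub_mem (hZD _ (hZ.stable _ hz)) (hgD _ hz)
  refine dec_of_piece h D (fun h0 => hne ?_) hnd hgg hgig _ e _ e _ (fun i => hZD _ (he i))
    (fun i => D.sub_mem (hgD _ (hd i)) (hZD _ (hd i))) (fun i => hZD _ (he i))
    (fun i => ?_) hF (by simpa [show (-fun _ => 0 : Fin (finrank F Z) → ℤ) = fun _ => 0 from funext fun _ => neg_zero] using hF') hc IH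
  · rw [eq_bot_iff, ← h0]; exact le_sup_left
  · have := D.add_mem (hgD _ (hd i)) (hZD _ (hd i))
    simpa using this

/-- The nilpotent part `g + g⁻¹ - 2` at the eigenvalue `1`. -/
def nu (g gi : Module.End F U) : Module.End F U := g + gi - 1 - 1

theorem nu_apply (x : U) : nu g gi x = g x + gi x - x - x := by simp [nu]

/-- Evaluation of polynomials at the nilpotent part. -/
noncomputable def ev (g gi : Module.End F U) : F[X] →ₐ[F] Module.End F U := aeval (nu g gi)

theorem ev_X (x : U) : ev g gi X x = nu g gi x := by simp [ev]

theorem ev_C (a : F) (x : U) : ev g gi (C a) x = a • x := by simp [ev]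

theorem aeval_nu (p : F[X]) : ev g gi p = aeval (g + gi) (p.comp (X - C 1 - C 1)) := by
  rw [aeval_comp]
  simp [ev, nu]

/-- The generalised eigenspace of `g + g⁻¹` at `2`. -/
noncomputable def nuKer (g gi : Module.End F U) (k : ℕ) : Submodule F U :=
  LinearMap.ker (ev g gi ((X : F[X]) ^ (k + 1)))

namespace IsSympl

variable (h : IsSympl ω g gi)

include h in
theorem nu_adj (p : F[X]) (x y : U) :
    ω (ev g gi p x) y = ω x (ev g gi p y) := by
  rw [aeval_nu, h.aeval_adj]

include h in
theorem nu_nu (p q : F[X]) (x : U) :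
    ω (ev g gi p x) (ev g gi q x) = 0 := by
  rw [aeval_nu, aeval_nu, h.aeval_aeval]

include h in
theorem comm_nu (p : F[X]) (x : U) :
    g (ev g gi p x) = ev g gi p (g x) := by
  rw [aeval_nu, h.comm_aeval]

include h in
theorem comm_nu' (p : F[X]) (x : U) :
    gi (ev g gi p x) = ev g gi p (gi x) := by
  rw [← h.left (ev g gi p (gi x)), h.comm_nu, h.right]

include h in
theorem map_nuKer {k : ℕ} {x : U} (hx : x ∈ nuKer g gi k) : g x ∈ nuKer g gi k := by
  rw [nuKer, LinearMap.mem_ker] at *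
  rw [← h.comm_nu, hx, map_zero]

include h in
theorem map_nuKer' {k : ℕ} {x : U} (hx : x ∈ nuKer g gi k) : gi x ∈ nuKer g gi k := by
  rw [nuKer, LinearMap.mem_ker] at *
  rw [← h.comm_nu', hx, map_zero]

end IsSympl

theorem aeval_mul_apply (p q : F[X]) (x : U) :
    ev g gi (p * q) x = ev g gi p (ev g gi q x) := by
  rw [map_mul, Module.End.mul_apply]

theorem tau_ev (p : F[X]) (x : U) :
    (g + gi) (ev g gi p x) = ev g gi (X * p + (1 + 1) * p) x := by
  rw [LinearMap.add_apply, map_add, LinearMap.add_apply, aeval_mul_apply, aeval_mul_apply, ev_X,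
    nu_apply]
  simp

theorem aeval_mem_nuKer (p : F[X]) {k : ℕ} {x : U} (hx : x ∈ nuKer g gi k) :
    ev g gi p x ∈ nuKer g gi k := by
  rw [nuKer, LinearMap.mem_ker] at *
  rw [← aeval_mul_apply, mul_comm, aeval_mul_apply, hx, map_zero]

theorem aeval_dvd {k : ℕ} {x : U} (hx : x ∈ nuKer g gi k) {p : F[X]} (hp : X ^ (k + 1) ∣ p) :
    ev g gi p x = 0 := by
  obtain ⟨q, rfl⟩ := hp
  rw [mul_comm, aeval_mul_apply, LinearMap.mem_ker.1 hx, map_zero]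

theorem aeval_top {k : ℕ} {x : U} (hx : x ∈ nuKer g gi k) (p : F[X]) :
    ev g gi (X ^ k * p) x = p.coeff 0 • ev g gi ((X : F[X]) ^ k) x := by
  conv_lhs => rw [← divX_mul_X_add p]
  have : (X : F[X]) ^ k * (divX p * X + C (p.coeff 0)) =
      X ^ (k + 1) * divX p + C (p.coeff 0) * X ^ k := by ring
  rw [this, map_add, LinearMap.add_apply, aeval_dvd hx (dvd_mul_right _ _), zero_add,
    aeval_mul_apply, ev_C]

theorem dvd_of_aeval {k : ℕ} {x : U} (hx : x ∈ nuKer g gi k)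
    (hs : ev g gi ((X : F[X]) ^ k) x ≠ 0) {p : F[X]} (hp : ev g gi p x = 0) :
    X ^ (k + 1) ∣ p := by
  suffices ∀ j ≤ k + 1, X ^ j ∣ p from this _ le_rfl
  intro j
  induction j with
  | zero => simp
  | succ j ih =>
    intro hj
    obtain ⟨q, rfl⟩ := ih (by omega)
    have h1 : ev g gi (X ^ k * q) x = 0 := by
      have : (X : F[X]) ^ k * q = X ^ (k - j) * (X ^ j * q) := by
        rw [← mul_assoc, ← pow_add]; congr 2; omega
      rw [this, aeval_mul_apply, hp, map_zero]
    rw [aeval_top hx] at h1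
    have h2 : q.coeff 0 = 0 := (smul_eq_zero.1 h1).resolve_right hs
    rw [pow_succ]
    exact mul_dvd_mul_left _ (X_dvd_iff.2 h2)

theorem aeval_of_X_mul {k : ℕ} {x : U} (hx : x ∈ nuKer g gi k)
    (hs : ev g gi ((X : F[X]) ^ k) x ≠ 0) {p : F[X]}
    (hp : ev g gi (X * p) x = 0) :
    ∃ c : F, ev g gi p x = c • ev g gi ((X : F[X]) ^ k) x := by
  have := dvd_of_aeval hx hs hp
  rw [pow_succ', mul_dvd_mul_iff_left X_ne_zero] at this
  obtain ⟨q, rfl⟩ := this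
  exact ⟨_, aeval_top hx q⟩

end

section

variable {F U : Type} [Field F] [AddCommGroup U] [Module F U]
  {ω : LinearMap.BilinForm F U} {g gi : Module.End F U}

/-- The linear functional `ω · v'` separating a vector from a subspace. -/
theorem exists_sep [FiniteDimensional F U] (h : IsSympl ω g gi) {k : ℕ}
    (hproj : ∀ u, ∃ u' ∈ nuKer g gi k, ∀ x ∈ nuKer g gi k, ω x u = ω x u')
    (W : Submodule F U) (hW : W ≤ nuKer g gi k) {x : U} (hx : x ∈ nuKer g gi k) (hxW : x ∉ W) :
    ∃ v ∈ nuKer g gi k, (∀ y ∈ W, ω y v = 0) ∧ ω x v = 1 := by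
  obtain ⟨f, hf, hfW⟩ := Submodule.exists_le_ker_of_notMem hxW
  have hr : ω.Nondegenerate := by
    refine (LinearMap.IsRefl.nondegenerate_iff_separatingLeft
      (fun x y hxy => by rw [h.skew, hxy, neg_zero])).2 h.nd
  obtain ⟨u, hu⟩ := (LinearMap.BilinForm.toDual ω hr).surjective f
  have hu' : ∀ y, f y = ω u y := fun y => by
    rw [← hu]; exact LinearMap.BilinForm.toDual_def hr
  obtain ⟨u', hu1, hu2⟩ := hproj u
  have key : ∀ y ∈ nuKer g gi k, ω y u' = -f y := fun y hy => by
    rw [hu', ← hu2 y hy, h.skew]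
  refine ⟨(-(f x)⁻¹) • u', Submodule.smul_mem _ _ hu1, fun y hy => ?_, ?_⟩
  · rw [map_smul, key y (hW hy), LinearMap.mem_ker.1 (hfW hy)]; simp
  · rw [map_smul, key x hx]; simp [hf]

/-- The cyclic submodule generated by `v` under `g + g⁻¹ - 2`. -/
noncomputable def cyc (g gi : Module.End F U) (v : U) : Submodule F U :=
  LinearMap.range (LinearMap.applyₗ v ∘ₗ (ev g gi).toLinearMap)

theorem mem_cyc {v x : U} : x ∈ cyc g gi v ↔ ∃ p : F[X], ev g gi p v = x := by
  simp [cyc]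

theorem fixed_of_bad [FiniteDimensional F U] (h : IsSympl ω g gi)
    (bad : ∀ Z, Flex ω g gi Z → Z = ⊥) {k : ℕ}
    (hq : ∀ u ∈ nuKer g gi k, ω (g (ev g gi ((X : F[X]) ^ k) u)) u = 0)
    (hproj : ∀ u, ∃ u' ∈ nuKer g gi k, ∀ x ∈ nuKer g gi k, ω x u = ω x u')
    (v : U) (hv : v ∈ nuKer g gi k) :
    g (ev g gi ((X : F[X]) ^ k) v) = ev g gi ((X : F[X]) ^ k) v := by
  set s := ev g gi ((X : F[X]) ^ k) v with hs
  by_contra hne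
  have hs0 : s ≠ 0 := fun h0 => hne (by rw [h0, map_zero])
  have hnus : nu g gi s = 0 := by
    have : nu g gi s = ev g gi (X ^ (k + 1)) v := by
      rw [pow_succ', aeval_mul_apply, ev_X]
    rw [this, LinearMap.mem_ker.1 hv]
  have hggs : g (g s) = g s + g s - s := by
    rw [nu_apply] at hnus
    have : gi s = s + s - g s := by linear_combination (norm := module) hnus
    have h2 := h.right s
    rw [this] at h2
    simp only [map_add, map_sub] at h2
    linear_combination (norm := module) -h2
  have hgs : g s ∉ cyc g gi v := by
    rintro hm
    obtain ⟨p, hp⟩ := mem_cyc.1 hm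
    have h1 : ev g gi (X * p) v = 0 := by
      rw [aeval_mul_apply, hp, ← h.comm_nu, ev_X, hnus, map_zero]
    obtain ⟨c, hc⟩ := aeval_of_X_mul hv hs0 h1
    rw [hp] at hc
    rw [← hs] at hc
    rw [hc, map_smul, hc] at hggs
    have h2 : ((c - 1) * (c - 1)) • s = 0 := by
      linear_combination (norm := module) hggs
    have h3 := (smul_eq_zero.1 h2).resolve_right hs0
    have h4 : c = 1 := by
      rcases mul_eq_zero.1 h3 with h4 | h4 <;> linear_combination h4
    exact hne (by rw [hc, h4, one_smul])
  obtain ⟨v', hv', hvv', hsv'⟩ := exists_sep h hproj (cyc g gi v)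
    (by rintro _ hx; obtain ⟨p, rfl⟩ := mem_cyc.1 hx; exact aeval_mem_nuKer p hv)
    (h.map_nuKer (aeval_mem_nuKer (X ^ k) hv)) hgs
  have hvv : ∀ p, ω (ev g gi p v) v' = 0 := fun p => hvv' _ (mem_cyc.2 ⟨p, rfl⟩)
  have hflex : Flex ω g gi (cyc g gi v ⊔ cyc g gi v') := by
    refine ⟨fun x hx => ?_, fun x hx y hy => ?_, fun x hx hxy => ?_⟩
    · obtain ⟨_, h1, _, h2, rfl⟩ := Submodule.mem_sup.1 hx
      obtain ⟨p, rfl⟩ := mem_cyc.1 h1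
      obtain ⟨p', rfl⟩ := mem_cyc.1 h2
      rw [map_add, tau_ev, tau_ev]
      exact Submodule.mem_sup.2 ⟨_, mem_cyc.2 ⟨_, rfl⟩, _, mem_cyc.2 ⟨_, rfl⟩, rfl⟩
    · obtain ⟨_, h1, _, h2, rfl⟩ := Submodule.mem_sup.1 hx
      obtain ⟨p, rfl⟩ := mem_cyc.1 h1
      obtain ⟨p', rfl⟩ := mem_cyc.1 h2
      obtain ⟨_, h1, _, h2, rfl⟩ := Submodule.mem_sup.1 hy
      obtain ⟨q, rfl⟩ := mem_cyc.1 h1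
      obtain ⟨q', rfl⟩ := mem_cyc.1 h2
      have h3 : ω (ev g gi p v) (ev g gi q' v') = 0 := by
        rw [← h.nu_adj, ← aeval_mul_apply, hvv]
      have h4 : ω (ev g gi p' v') (ev g gi q v) = 0 := by
        rw [h.skew, ← h.nu_adj, ← aeval_mul_apply, hvv, neg_zero]
      simp only [map_add, LinearMap.add_apply, h3, h4]
      rw [h.nu_nu, h.nu_nu]; simp
    · suffices ∀ j ≤ k + 1, ∃ f f' : F[X], x = ev g gi (X ^ j * f) v + ev g gi (X ^ j * f') v' by
        obtain ⟨f, f', rfl⟩ := this _ le_rfl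
        rw [aeval_dvd hv (dvd_mul_right _ _), aeval_dvd hv' (dvd_mul_right _ _), add_zero]
      intro j
      induction j with
      | zero =>
        intro _
        obtain ⟨_, h1, _, h2, rfl⟩ := Submodule.mem_sup.1 hx
        obtain ⟨p, rfl⟩ := mem_cyc.1 h1
        obtain ⟨p', rfl⟩ := mem_cyc.1 h2
        exact ⟨p, p', by simp⟩
      | succ j ih =>
        intro hj
        obtain ⟨f, f', hff⟩ := ih (by omega)
        have hx2 : ev g gi (X ^ (k - j)) x = f.coeff 0 • s + f'.coeff 0 • ev g gi (X ^ k) v' := by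
          rw [hff, map_add, ← aeval_mul_apply, ← aeval_mul_apply, ← mul_assoc, ← mul_assoc,
            ← pow_add, Nat.sub_add_cancel (by omega), aeval_top hv, aeval_top hv']
        have test : ∀ y ∈ cyc g gi v ⊔ cyc g gi v', ev g gi (X ^ (k - j)) y ∈ cyc g gi v ⊔ cyc g gi v' →
            f.coeff 0 • ω (g s) y + f'.coeff 0 • ω (g (ev g gi (X ^ k) v')) y = 0 := fun y hy hy' => by
          have := hxy _ hy'
          rw [← h.nu_adj, ← h.comm_nu, hx2] at this
          simpa using this
        have hpol : ω (g s) v' + ω (g (ev g gi (X ^ k) v')) v = 0 := by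
          have h1 := hq _ hv
          have h2 := hq _ hv'
          have h3 := hq _ (Submodule.add_mem _ hv hv')
          simp only [map_add, LinearMap.add_apply] at h1 h2 h3
          linear_combination h3 - h1 - h2
        have t1 := test v' (Submodule.mem_sup_right (mem_cyc.2 ⟨1, by simp⟩))
          (Submodule.mem_sup_right (mem_cyc.2 ⟨_, rfl⟩))
        rw [hq _ hv', hsv'] at t1
        have t1' : f.coeff 0 = 0 := by simpa using t1
        have t2 := test v (Submodule.mem_sup_left (mem_cyc.2 ⟨1, by simp⟩))
          (Submodule.mem_sup_left (mem_cyc.2 ⟨_, rfl⟩))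
        rw [hsv'] at hpol
        have hpol' : ω (g (ev g gi (X ^ k) v')) v = -1 := by linear_combination hpol
        rw [hpol', t1'] at t2
        have t2' : f'.coeff 0 = 0 := by simpa using t2
        obtain ⟨a, rfl⟩ := X_dvd_iff.2 t1'
        obtain ⟨a', rfl⟩ := X_dvd_iff.2 t2'
        exact ⟨a, a', by rw [hff, pow_succ, mul_assoc, mul_assoc]⟩
  have h0 := bad _ hflex
  have hv0 : v ∈ cyc g gi v ⊔ cyc g gi v' := Submodule.mem_sup_left (mem_cyc.2 ⟨1, by simp⟩)
  rw [h0, Submodule.mem_bot] at hv0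
  exact hs0 (by rw [hs, hv0, map_zero])

/-- The hyperbolic system containing a vector `s` with `g s = ± s`. -/
theorem fam_add_unit (h : IsSympl ω g gi) (R : Submodule F U) {r : ℕ} (e d : Fin r → U)
    (he : ∀ i, e i ∈ R) (hd : ∀ i, d i ∈ R) (hsd : Submodule.span F (Set.range d) = R)
    (hF : Fam ω g (fun _ => 0) e (fun j => g (d j) - d j)) (s w : U) (t : ℤ)
    (hs : g s = sgn F t • s) (hsR : ∀ x ∈ R, ω s x = 0) (hsw : ω s w = 1)
    (hRw : ∀ x ∈ R, ω x w = 0) :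
    Fam ω g (Sum.elim (fun _ => 0) fun _ : Unit => t) (Sum.elim e fun _ => s)
      (Sum.elim (fun j => g (d j) - d j)
        fun _ => w + ∑ i, ω (g (d i) - d i) w • e i) := by
  have hRs : ∀ x ∈ R, ω x s = 0 := fun x hx => by rw [h.skew, hsR x hx, neg_zero]
  have hsgn : sgn F t * sgn F t = 1 := by unfold sgn; split_ifs <;> simp
  have hse' : ∀ j, ω s (g (d j) - d j) = 0 := fun j => by
    have h2 := h.iso s (d j)
    rw [hs, map_smul, LinearMap.smul_apply, hsR _ (hd j), smul_eq_mul] at h2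
    rw [map_sub, hsR _ (hd j), sub_zero, ← one_mul (ω s (g (d j))), ← hsgn, mul_assoc, h2,
      mul_zero]
  have he's : ∀ j, ω (g (d j) - d j) s = 0 := fun j => by rw [h.skew, hse', neg_zero]
  set z := w + ∑ i, ω (g (d i) - d i) w • e i with hz
  have hez : ∀ j, ω (e j) z = 0 := fun j => by
    simp [hz, hRw _ (he j), hF.iso j]
  have he'z : ∀ j, ω (g (d j) - d j) z = 0 := fun j => by
    have : ∀ i, ω (g (d j) - d j) (e i) = if i = j then -1 else 0 := fun i => by
      rw [h.skew, hF.pair]; split_ifs <;> simp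
    rw [hz]
    simp only [map_add, map_sum, map_smul, this]
    simp
  have hsz : ω s z = 1 := by
    simp [hz, hsw, hsR _ (he _)]
  have hze' : ∀ j, ω z (g (d j) - d j) = 0 := fun j => by rw [h.skew, he'z, neg_zero]
  have hgz : ∀ x ∈ R, ω (g x) z = ω x z := by
    intro x hx
    rw [← hsd] at hx
    induction hx using Submodule.span_induction with
    | mem x hx =>
      obtain ⟨j, rfl⟩ := hx
      have := he'z j
      rw [map_sub, LinearMap.sub_apply] at this
      linear_combination this
    | zero => simp
    | add x y _ _ hx hy => simp [hx, hy]
    | smul a x _ hx => simp [hx]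
  refine ⟨?_, ?_, ?_, ?_, ?_, ?_⟩
  · rintro (i | i) (j | j)
    · exact hF.iso i j
    · exact hRs _ (he i)
    · exact hsR _ (he j)
    · exact h.alt _
  · rintro (i | i) (j | j)
    · exact hF.iso' i j
    · exact he'z i
    · exact hze' j
    · exact h.alt _
  · rintro (i | i) (j | j)
    · simpa using hF.pair i j
    · simpa using hez i
    · simpa using hse' j
    · simpa using hsz
  · rintro (i | i) (j | j)
    · simpa using hF.gpair i j
    · simp only [Sum.elim_inl, Sum.elim_inr]
      rw [hgz _ (he i), hez]; simp
    · simp only [Sum.elim_inl, Sum.elim_inr, hs, map_smul, LinearMap.smul_apply, hse']; simp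
    · simp only [Sum.elim_inr, hs, map_smul, LinearMap.smul_apply, hsz]; simp
  · rintro (i | i) hi
    · simp at hi
    · exact hs
  · rintro (i | i) (j | j) hij hi hj
    · simp at hi
    · simp at hi
    · simp at hj
    · exact absurd rfl hij

end

section

variable {F U : Type} [Field F] [AddCommGroup U] [Module F U]
  {ω : LinearMap.BilinForm F U} {g gi : Module.End F U}

theorem dec_of_unipotent [FiniteDimensional F U] (h : IsSympl ω g gi)
    (bad : ∀ Z, Flex ω g gi Z → Z = ⊥) {k : ℕ}
    (hk : ∃ u ∈ nuKer g gi k, ev g gi ((X : F[X]) ^ k) u ≠ 0)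
    (hq : ∀ u ∈ nuKer g gi k, ω (g (ev g gi ((X : F[X]) ^ k) u)) u = 0)
    (hproj : ∀ u, ∃ u' ∈ nuKer g gi k, ∀ x ∈ nuKer g gi k, ω x u = ω x u')
    (IH : ∀ (V : Type) [AddCommGroup V] [Module F V] [FiniteDimensional F V]
      (ω : LinearMap.BilinForm F V) (g gi : Module.End F V), IsSympl ω g gi →
      finrank F V < finrank F U → Dec ω g) : Dec ω g := by
  have fixs := fixed_of_bad h bad hq hproj
  obtain ⟨v, hv, hs0⟩ := hk
  set s := ev g gi ((X : F[X]) ^ k) v with hs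
  have hgs : g s = s := fixs v hv
  have hgis : gi s = s := by conv_lhs => rw [← hgs, h.left]
  set N : Module.End F U := g - 1 with hN
  have N_apply : ∀ x, N x = g x - x := fun x => by simp [hN]
  have Ns : N s = 0 := by rw [N_apply, hgs, sub_self]
  have NN : ∀ x, N (N x) = g (ev g gi X x) := fun x => by
    rw [N_apply, N_apply, map_sub, h.sq, ev_X, nu_apply, LinearMap.add_apply]
    simp only [map_add, map_sub]; abel
  have Ncomm : ∀ (p : F[X]) x, N (ev g gi p x) = ev g gi p (N x) := fun p x => by
    rw [N_apply, N_apply, h.comm_nu, map_sub]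
  have Nadj : ∀ x y, ω (N x) y = - ω x (gi (N y)) := fun x y => by
    rw [N_apply, N_apply, map_sub, LinearMap.sub_apply, map_sub, map_sub, h.left, h.adj]; ring
  let E : Submodule F U := (cyc g gi v).map (gi ∘ₗ N)
  have hEmem : ∀ p, gi (N (ev g gi p v)) ∈ E := fun p =>
    ⟨_, mem_cyc.2 ⟨p, rfl⟩, rfl⟩
  have hNker : ∀ {x}, x ∈ nuKer g gi k → N x ∈ nuKer g gi k := fun {x} hx => by
    rw [N_apply]; exact Submodule.sub_mem _ (h.map_nuKer hx) hx
  have hEle : E ≤ nuKer g gi k := by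
    rintro _ ⟨_, hx, rfl⟩
    obtain ⟨p, rfl⟩ := mem_cyc.1 hx
    exact h.map_nuKer' (hNker (aeval_mem_nuKer p hv))
  have hsE : s ∉ E := by
    rintro ⟨_, hx, hxs⟩
    obtain ⟨p, rfl⟩ := mem_cyc.1 hx
    have h1 : N (ev g gi p v) = s := by
      rw [← hgs, ← hxs, LinearMap.comp_apply, h.right]
    have h2 : g (ev g gi X (ev g gi p v)) = 0 := by rw [← NN, h1, Ns]
    have h3 : ev g gi (X * p) v = 0 := by
      rw [aeval_mul_apply, ← h.left (ev g gi X _), h2, map_zero]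
    obtain ⟨c, hc⟩ := aeval_of_X_mul hv hs0 h3
    rw [hc, ← hs, map_smul, Ns, smul_zero] at h1
    exact hs0 h1.symm
  obtain ⟨w, hw, hEw, hsw⟩ := exists_sep h hproj E hEle (aeval_mem_nuKer (X ^ k) hv) hsE
  replace hsw : ω s w = 1 := hsw
  have hvNw : ∀ p, ω (ev g gi p v) (N w) = 0 := fun p => by
    have := hEw _ (hEmem p)
    rw [h.adj', N_apply, map_sub, LinearMap.sub_apply, h.iso] at this
    rw [N_apply, map_sub]; linear_combination -this
  set sw := ev g gi ((X : F[X]) ^ k) w with hsw_def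
  have hgsw : g sw = sw := fixs w hw
  have hswv : ω sw v = -1 := by
    rw [hsw_def, h.nu_adj, h.skew, ← hs, hsw]
  let V : Submodule F U := cyc g gi v ⊔ (cyc g gi w).map N
  have memV : ∀ {x}, x ∈ V ↔ ∃ f f', x = ev g gi f v + N (ev g gi f' w) := by
    intro x
    constructor
    · intro hx
      obtain ⟨_, h1, _, ⟨_, h2, rfl⟩, rfl⟩ := Submodule.mem_sup.1 hx
      obtain ⟨p, rfl⟩ := mem_cyc.1 h1
      obtain ⟨p', rfl⟩ := mem_cyc.1 h2
      exact ⟨p, p', rfl⟩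
    · rintro ⟨f, f', rfl⟩
      exact Submodule.add_mem_sup (mem_cyc.2 ⟨f, rfl⟩) ⟨_, mem_cyc.2 ⟨f', rfl⟩, rfl⟩
  have hsV : s ∈ V := memV.2 ⟨X ^ k, 0, by simp [hs]⟩
  have evV : ∀ q, ∀ x ∈ V, ev g gi q x ∈ V := by
    intro q x hx
    obtain ⟨f, f', rfl⟩ := memV.1 hx
    refine memV.2 ⟨q * f, q * f', ?_⟩
    rw [map_add, aeval_mul_apply, aeval_mul_apply, Ncomm q]
  have hNN0 : ∀ x y, ω (N x) (N y) = ω x (ev g gi X y) * (-1) := fun x y => by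
    rw [Nadj, NN, h.left]; ring
  have isoV : ∀ x ∈ V, ∀ y ∈ V, ω x y = 0 := by
    intro x hx y hy
    obtain ⟨f, f', rfl⟩ := memV.1 hx
    obtain ⟨q, q', rfl⟩ := memV.1 hy
    have h1 : ∀ f q', ω (ev g gi f v) (N (ev g gi q' w)) = 0 := fun f q' => by
      rw [Ncomm, ← h.nu_adj, ← aeval_mul_apply, hvNw]
    have h2 : ω (N (ev g gi f' w)) (ev g gi q v) = 0 := by rw [h.skew, h1, neg_zero]
    simp only [map_add, LinearMap.add_apply, h1, h2, hNN0, ← aeval_mul_apply]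
    rw [h.nu_nu, h.nu_nu]; ring
  have gN : ∀ x ∈ V, ∀ y ∈ V, ω (g x) y = ω (N x) y := fun x hx y hy => by
    rw [N_apply, map_sub, LinearMap.sub_apply, isoV x hx y hy, sub_zero]
  have tauV : ∀ x ∈ V, (g + gi) x ∈ V := fun x hx => by
    obtain ⟨f, f', rfl⟩ := memV.1 hx
    have hτ : ∀ y, (g + gi) y = ev g gi (X * 1 + (1 + 1) * 1) y := fun y => by
      rw [← tau_ev]; simp
    rw [hτ]; exact evV _ _ hx
  have sym : ∀ x ∈ V, ∀ y ∈ V, ω (g x) y = ω (g y) x := fun x hx y hy =>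
    h.symm_of (isoV _ (tauV x hx) _ hy)
  have kerV : ∀ x ∈ V, (∀ y ∈ V, ω (g x) y = 0) → ∃ c : F, x = c • s := by
    intro x hx hxy
    suffices ∀ j ≤ k, ∃ f f' : F[X], x = ev g gi (X ^ j * f) v + N (ev g gi (X ^ j * f') w) by
      obtain ⟨f, f', hff⟩ := this _ le_rfl
      rw [aeval_top hv, aeval_top hw, map_smul, ← hsw_def, N_apply, hgsw, sub_self, smul_zero,
        add_zero] at hff
      exact ⟨_, hff⟩
    intro j
    induction j with
    | zero =>
      intro _
      obtain ⟨f, f', rfl⟩ := memV.1 hx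
      exact ⟨f, f', by simp⟩
    | succ j ih =>
      intro hj
      obtain ⟨f, f', hff⟩ := ih (by omega)
      obtain ⟨l, rfl⟩ : ∃ l, k = l + 1 := ⟨k - 1, by omega⟩
      have hx2 : ev g gi (X ^ (l - j)) x =
          ev g gi (X ^ l * f) v + N (ev g gi (X ^ l * f') w) := by
        rw [hff, map_add, ← Ncomm, ← aeval_mul_apply, ← aeval_mul_apply, ← mul_assoc, ← mul_assoc,
            ← pow_add, Nat.sub_add_cancel (by omega)]
      have hXl : ∀ (p : F[X]) (x : U), ev g gi X (ev g gi (X ^ l * p) x) =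
          ev g gi (X ^ (l + 1) * p) x := fun p x => by
        rw [← aeval_mul_apply, ← mul_assoc, ← pow_succ']
      have hNx2 : N (ev g gi (X ^ (l - j)) x) =
          N (ev g gi (X ^ l * f) v) + f'.coeff 0 • sw := by
        rw [hx2, map_add, NN, hXl, aeval_top hw, map_smul, hgsw]
      have test : ∀ y ∈ V, ω (N (ev g gi (X ^ l * f) v)) y + f'.coeff 0 * ω sw y = 0 :=
          fun y hy => by
        have hy' := evV (X ^ (l - j)) y hy
        have := hxy _ hy'
        rw [gN _ hx _ hy', ← h.nu_adj, ← Ncomm, hNx2] at this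
        simpa using this
      have hNw : N w ∈ V := memV.2 ⟨0, 1, by simp⟩
      have t1 := test _ hNw
      have hswNw : ω sw (N w) = 0 := by
        rw [N_apply, map_sub, ← h.adj']
        have : gi sw = sw := by conv_lhs => rw [← hgsw, h.left]
        rw [this, sub_self]
      rw [hswNw, hNN0, ← h.nu_adj, hXl, aeval_top hv, ← hs] at t1
      have t1' : f.coeff 0 = 0 := by simpa [hsw] using t1
      obtain ⟨a, rfl⟩ := X_dvd_iff.2 t1'
      have t2 := test v (memV.2 ⟨1, 0, by simp⟩)
      rw [← mul_assoc, ← pow_succ, aeval_top hv, ← hs, map_smul, Ns, hswv] at t2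
      have t2' : f'.coeff 0 = 0 := by simpa using t2
      obtain ⟨a', rfl⟩ := X_dvd_iff.2 t2'
      exact ⟨a, a', by rw [hff, pow_succ, mul_assoc, mul_assoc]⟩
  let R : Submodule F U := V ⊓ LinearMap.ker (ω.flip w)
  have hRV : ∀ x ∈ R, x ∈ V := fun x hx => hx.1
  have hRw : ∀ x ∈ R, ω x w = 0 := fun x hx => hx.2
  have hVR : ∀ x ∈ V, x - ω x w • s ∈ R := fun x hx => by
    refine ⟨V.sub_mem hx (V.smul_mem _ hsV), ?_⟩
    show ω (x - ω x w • s) w = 0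
    simp [hsw]
  have symR : ∀ x ∈ R, ∀ y ∈ R, ω (g x) y = ω (g y) x := fun x hx y hy =>
    sym x hx.1 y hy.1
  have isoR : ∀ x ∈ R, ∀ y ∈ R, ω x y = 0 := fun x hx y hy => isoV x hx.1 y hy.1
  have ndR : ∀ x ∈ R, (∀ y ∈ R, ω (g x) y = 0) → x = 0 := by
    intro x hx hxy
    obtain ⟨c, rfl⟩ := kerV x hx.1 fun y hy => by
      have h1 := hxy _ (hVR y hy)
      have h2 : ω (g x) s = 0 := by rw [h.adj, hgis]; exact isoV _ hx.1 _ hsV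
      simpa [h2] using h1
    have := hRw _ hx
    simp only [map_smul, LinearMap.smul_apply, hsw, smul_eq_mul, mul_one] at this
    rw [this, zero_smul]
  obtain ⟨e, d, he, hd, hse, hsd, hed⟩ := exists_dual_families R symR ndR
  have hF := fam_of_dual h R isoR symR e d he hd hed
  have hF' := fam_of_dual h.neg R isoR (fun x hx y hy => by simp [symR x hx y hy]) e
    (fun j => -d j) he (fun j => R.neg_mem (hd j)) (fun i j => by simpa using hed i j)
  have hsR : ∀ x ∈ R, ω s x = 0 := fun x hx => isoV _ hsV _ hx.1
  have hG := fam_add_unit h R e d he hd hsd hF s w 1 (by simp [sgn, hgs]) hsR hsw hRw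
  have hsd' : Submodule.span F (Set.range fun j => -d j) = R := by
    refine le_antisymm (Submodule.span_le.2 ?_) ?_
    · rintro _ ⟨i, rfl⟩; exact R.neg_mem (hd i)
    · conv_lhs => rw [← hsd]
      refine Submodule.span_le.2 ?_
      rintro _ ⟨i, rfl⟩
      rw [← neg_neg (d i)]
      exact Submodule.neg_mem _ (Submodule.subset_span ⟨i, rfl⟩)
  have hG' := fam_add_unit h.neg R e (fun j => -d j) he (fun j => R.neg_mem (hd j)) hsd' hF' s w
    (-1) (by simp [sgn, hgs]) hsR hsw hRw
  let D : Submodule F U := (V ⊔ V.map N) ⊔ Submodule.span F {w}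
  have hVD : ∀ x ∈ V, x ∈ D := fun x hx => Submodule.mem_sup_left (Submodule.mem_sup_left hx)
  have hND : ∀ x ∈ V, N x ∈ D := fun x hx =>
    Submodule.mem_sup_left (Submodule.mem_sup_right ⟨x, hx, rfl⟩)
  have hwD : w ∈ D := Submodule.mem_sup_right (Submodule.mem_span_singleton_self w)
  have hgV : ∀ x ∈ V, g x ∈ D := fun x hx => by
    rw [← sub_add_cancel (g x) x, ← N_apply]
    exact D.add_mem (hND x hx) (hVD x hx)
  have hNw : N w ∈ V := memV.2 ⟨0, 1, by simp⟩
  have hgiV : ∀ x ∈ V, gi x ∈ D := fun x hx => by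
    have : gi x = (g + gi) x - g x := by simp
    rw [this]
    exact D.sub_mem (hVD _ (tauV x hx)) (hgV x hx)
  have hDind : ∀ P : Module.End F U, (∀ x ∈ V, P x ∈ D) → (∀ x ∈ V, P (N x) ∈ D) → P w ∈ D →
      ∀ x ∈ D, P x ∈ D := by
    intro P h1 h2 h3
    show D ≤ D.comap P
    refine sup_le (sup_le h1 ?_) ?_
    · rintro _ ⟨x, hx, rfl⟩; exact h2 x hx
    · rw [Submodule.span_le]; rintro _ rfl; exact h3
  have hgD : ∀ x ∈ D, g x ∈ D := by
    refine hDind g hgV (fun x hx => ?_) ?_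
    · rw [← sub_add_cancel (g (N x)) (N x), ← N_apply, NN]
      exact D.add_mem (hgV _ (evV X x hx)) (hND x hx)
    · rw [← sub_add_cancel (g w) w, ← N_apply]
      exact D.add_mem (hVD _ hNw) hwD
  have hgiD : ∀ x ∈ D, gi x ∈ D := by
    refine hDind gi hgiV (fun x hx => ?_) ?_
    · rw [N_apply, map_sub, h.left]
      exact D.sub_mem (hVD _ hx) (hgiV x hx)
    · have : gi w = w - gi (N w) := by rw [N_apply, map_sub, h.left]; abel
      rw [this]
      exact D.sub_mem hwD (hgiV _ hNw)
  have hDe : ∀ i, e i ∈ D := fun i => hVD _ (he i).1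
  have hDsum : ∀ a : Fin (finrank F R) → F, w + ∑ i, a i • e i ∈ D := fun a =>
    D.add_mem hwD (D.sum_mem fun i _ => D.smul_mem _ (hDe i))
  have hDs : s ∈ D := hVD _ hsV
  have hD : D = Submodule.span F (Set.range (Sum.elim (Sum.elim e fun _ : Unit => s)
      (Sum.elim (fun j => g (d j) - d j) fun _ : Unit => w + ∑ i, ω (g (d i) - d i) w • e i))) := by
    apply le_antisymm
    · set S := Submodule.span F (Set.range (Sum.elim (Sum.elim e fun _ : Unit => s)
        (Sum.elim (fun j => g (d j) - d j)
          fun _ : Unit => w + ∑ i, ω (g (d i) - d i) w • e i))) with hS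
      have se : ∀ i, e i ∈ S := fun i => Submodule.subset_span ⟨.inl (.inl i), rfl⟩
      have ss : s ∈ S := Submodule.subset_span ⟨.inl (.inr ()), rfl⟩
      have sRS : R ≤ S := by
        conv_lhs => rw [← hse]
        rw [Submodule.span_le]; rintro _ ⟨i, rfl⟩; exact se i
      have sN : R ≤ S.comap N := by
        conv_lhs => rw [← hsd]
        rw [Submodule.span_le]; rintro _ ⟨i, rfl⟩
        show N (d i) ∈ S
        rw [N_apply]
        exact Submodule.subset_span ⟨.inr (.inl i), rfl⟩
      refine sup_le (sup_le (fun x hx => ?_) ?_) ?_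
      · rw [← sub_add_cancel x (ω x w • s)]
        exact S.add_mem (sRS (hVR x hx)) (S.smul_mem _ ss)
      · rintro _ ⟨x, hx, rfl⟩
        have := sN (hVR x hx)
        rw [Submodule.mem_comap, map_sub, map_smul, Ns, smul_zero, sub_zero] at this
        exact this
      · rw [Submodule.span_singleton_le_iff_mem]
        have h1 : w + ∑ i, ω (g (d i) - d i) w • e i ∈ S :=
          Submodule.subset_span ⟨.inr (.inr ()), rfl⟩
        have h2 := S.sub_mem h1 (S.sum_mem (t := Finset.univ)
          fun i _ => S.smul_mem (ω (g (d i) - d i) w) (se i))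
        simpa using h2
    · rw [Submodule.span_le]
      rintro _ ⟨(i | i) | (i | i), rfl⟩
      · exact hDe i
      · exact hDs
      · exact D.sub_mem (hgV _ (hd i).1) (hVD _ (hd i).1)
      · exact hDsum _
  obtain ⟨hc, hnd⟩ := span_hyperbolic h hG.iso hG.iso' hG.pair D hD
  have ht : -(Sum.elim (fun _ : Fin (finrank F R) => (0 : ℤ)) fun _ : Unit => (1 : ℤ)) =
      Sum.elim (fun _ => 0) fun _ => -1 := by ext (i | i) <;> simp
  rw [← ht] at hG'
  refine dec_of_piece h D (fun h0 => ?_) hnd hgD hgiD _ _ _ _ _ ?_ ?_ ?_ ?_ hG hG' hc IH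
  · rw [h0, Submodule.mem_bot] at hDs; exact hs0 hDs
  · rintro (i | i); exacts [hDe i, hDs]
  · rintro (i | i); exacts [D.sub_mem (hgV _ (hd i).1) (hVD _ (hd i).1), hDsum _]
  · rintro (i | i); exacts [hDe i, hDs]
  · rintro (i | i)
    · have := D.add_mem (hgV _ (hd i).1) (hVD _ (hd i).1)
      simpa using this
    · exact hDsum _

end

section

variable {F U : Type} [Field F] [AddCommGroup U] [Module F U]
  {ω : LinearMap.BilinForm F U} {g gi : Module.End F U}

theorem Dec.of_neg (h : Dec ω (-g)) : Dec ω g := by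
  obtain ⟨ι, _, _, t, e, e', f, f', h1, h2, h3⟩ := h
  exact ⟨ι, _, _, -t, f, f', e, e', by simpa using h2, by simpa using h1, h3⟩

theorem flex_cyclic (h : IsSympl ω g gi) {π : F[X]} (hπ : Irreducible π) {k : ℕ} {v : U}
    (hv : aeval (g + gi) (π ^ (k + 1)) v = 0)
    (hne : ω (g (aeval (g + gi) (π ^ k) v)) v ≠ 0) :
    ∃ Z, Flex ω g gi Z ∧ Z ≠ ⊥ := by
  set τ := g + gi with hτ
  have amul : ∀ (p q : F[X]) (x : U), aeval τ (p * q) x = aeval τ p (aeval τ q x) :=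
    fun p q x => by rw [map_mul, Module.End.mul_apply]
  let Z : Submodule F U := LinearMap.range (LinearMap.applyₗ v ∘ₗ (aeval (R := F) τ).toLinearMap)
  have memZ : ∀ {x}, x ∈ Z ↔ ∃ p : F[X], aeval τ p v = x := by simp [Z]
  refine ⟨Z, ⟨?_, ?_, ?_⟩, ?_⟩
  · intro x hx
    obtain ⟨p, rfl⟩ := memZ.1 hx
    exact memZ.2 ⟨X * p, by rw [amul, aeval_X]⟩
  · intro x hx y hy
    obtain ⟨p, rfl⟩ := memZ.1 hx
    obtain ⟨q, rfl⟩ := memZ.1 hy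
    exact h.aeval_aeval p q v
  · intro x hx hxy
    suffices ∀ j ≤ k + 1, ∃ f : F[X], x = aeval τ (π ^ j * f) v by
      obtain ⟨f, rfl⟩ := this _ le_rfl
      rw [mul_comm, amul, hv, map_zero]
    intro j
    induction j with
    | zero =>
      intro _
      obtain ⟨p, rfl⟩ := memZ.1 hx
      exact ⟨p, by simp⟩
    | succ j ih =>
      intro hj
      obtain ⟨f, hf⟩ := ih (by omega)
      by_cases hd : π ∣ f
      · obtain ⟨q, rfl⟩ := hd
        exact ⟨q, by rw [hf, pow_succ, mul_assoc]⟩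
      · exfalso
        obtain ⟨a, b, hab⟩ := ((hπ.coprime_iff_not_dvd.2 hd).pow_left (m := k + 1)).symm
        have h1 : aeval τ a x = aeval τ (π ^ j) v := by
          rw [hf, ← amul]
          have : a * (π ^ j * f) = π ^ j + (-(π ^ j) * b) * π ^ (k + 1) := by
            linear_combination (π ^ j) * hab
          rw [this, map_add, LinearMap.add_apply, amul _ (π ^ (k + 1)), hv, map_zero, add_zero]
        apply hne
        have h2 := hxy (aeval τ (a * π ^ (k - j)) v) (memZ.2 ⟨_, rfl⟩)
        rw [← h.aeval_adj, ← h.comm_aeval, mul_comm, amul, h1, ← amul, ← pow_add,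
          Nat.sub_add_cancel (by omega)] at h2
        exact h2
  · intro h0
    have : v ∈ Z := memZ.2 ⟨1, by simp⟩
    rw [h0, Submodule.mem_bot] at this
    exact hne (by rw [this, map_zero])

theorem bad_primary [FiniteDimensional F U] (h : IsSympl ω g gi)
    (bad : ∀ Z, Flex ω g gi Z → Z = ⊥) {π : F[X]} (hπ : Irreducible π)
    (hdvd : π ∣ minpoly F (g + gi)) :
    π ∣ (X - C 1 - C 1) * (X + C 1 + C 1) ∧ ∃ k : ℕ,
    (∃ u, aeval (g + gi) (π ^ (k + 1)) u = 0 ∧ aeval (g + gi) (π ^ k) u ≠ 0) ∧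
    (∀ u, aeval (g + gi) (π ^ (k + 1)) u = 0 → ω (g (aeval (g + gi) (π ^ k) u)) u = 0) ∧
    (∀ u, ∃ u', aeval (g + gi) (π ^ (k + 1)) u' = 0 ∧
      ∀ x, aeval (g + gi) (π ^ (k + 1)) x = 0 → ω x u = ω x u') := by
  set τ := g + gi with hτ
  have amul : ∀ (p q : F[X]) (x : U), aeval τ (p * q) x = aeval τ p (aeval τ q x) :=
    fun p q x => by rw [map_mul, Module.End.mul_apply]
  have hm0 : minpoly F τ ≠ 0 := minpoly.ne_zero (Algebra.IsIntegral.isIntegral τ)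
  obtain ⟨r, hr, hnd⟩ := (FiniteMultiplicity.of_prime_left hπ.prime hm0).exists_eq_pow_mul_and_not_dvd
  obtain ⟨k, hk⟩ : ∃ k, multiplicity π (minpoly F τ) = k + 1 := by
    refine ⟨multiplicity π (minpoly F τ) - 1, ?_⟩
    have : multiplicity π (minpoly F τ) ≠ 0 := fun h0 => by
      rw [h0, pow_zero, one_mul] at hr
      exact hnd (hr ▸ hdvd)
    omega
  rw [hk] at hr
  obtain ⟨a, c, hac⟩ := (hπ.coprime_iff_not_dvd.2 hnd).pow_left (m := k + 1)
  have hker : ∀ u, aeval τ (π ^ (k + 1)) (aeval τ (c * r) u) = 0 := fun u => by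
    rw [← amul]
    have : π ^ (k + 1) * (c * r) = c * minpoly F τ := by rw [hr]; ring
    rw [this, amul, minpoly.aeval]; simp
  have h3 : ∀ u, ∃ u', aeval τ (π ^ (k + 1)) u' = 0 ∧
      ∀ x, aeval τ (π ^ (k + 1)) x = 0 → ω x u = ω x u' := by
    intro u
    refine ⟨_, hker u, fun x hx => ?_⟩
    have : u = aeval τ (a * π ^ (k + 1)) u + aeval τ (c * r) u := by
      rw [← LinearMap.add_apply, ← map_add, hac]; simp
    conv_lhs => rw [this]
    rw [map_add, ← h.aeval_adj, ← hτ, amul, hx]; simp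
  have h1 : ∃ u, aeval τ (π ^ (k + 1)) u = 0 ∧ aeval τ (π ^ k) u ≠ 0 := by
    by_contra! hcon
    have : aeval τ (π ^ k * (c * r)) = 0 := by
      ext u
      rw [amul]; exact hcon _ (hker u)
    have h4 := minpoly.dvd F τ this
    have hr0 : r ≠ 0 := fun h0 => hm0 (by rw [hr, h0, mul_zero])
    rw [hr, pow_succ, mul_assoc, mul_dvd_mul_iff_left (pow_ne_zero _ hπ.ne_zero),
      mul_dvd_mul_iff_right hr0] at h4
    obtain ⟨c', rfl⟩ := h4
    apply hπ.not_isUnit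
    refine isUnit_of_dvd_one ⟨a * π ^ k + c' * r, ?_⟩
    rw [← hac]; ring
  have h2 : ∀ u, aeval τ (π ^ (k + 1)) u = 0 → ω (g (aeval τ (π ^ k) u)) u = 0 := by
    intro u hu
    by_contra hne
    obtain ⟨Z, hZ, hZ0⟩ := flex_cyclic h hπ hu hne
    exact hZ0 (bad Z hZ)
  refine ⟨?_, k, h1, h2, h3⟩
  obtain ⟨u, hu, hs0⟩ := h1
  set s := aeval τ (π ^ k) u with hs
  have hgs : g s = gi s := by
    rw [← sub_eq_zero]
    apply h.nd
    intro y
    have gcomm : ∀ (p : F[X]) x, g (aeval τ p x) = aeval τ p (g x) := h.comm_aeval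
    have gicomm : ∀ (p : F[X]) x, gi (aeval τ p x) = aeval τ p (gi x) := fun p x => by
      rw [← h.left (aeval τ p (gi x)), gcomm, h.right]
    have giτ : gi s = aeval τ (π ^ k) (gi u) := gicomm _ _
    have hmem : aeval τ (π ^ (k + 1)) (g s - gi s) = 0 := by
      have z : aeval τ (π ^ (k + 1)) s = 0 := by
        rw [hs, ← amul, mul_comm, amul, hu, map_zero]
      rw [map_sub, ← gcomm, ← gicomm, z, map_zero, map_zero, sub_zero]
    obtain ⟨y', hy', hy2⟩ := h3 y
    have e1 := h2 u hu
    have e2 := h2 y' hy'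
    have e3 := h2 (u + y') (by rw [map_add, hu, hy', add_zero])
    simp only [map_add, LinearMap.add_apply, ← hs] at e1 e2 e3
    have e4 : ω (g (aeval τ (π ^ k) y')) u = - ω (gi s) y' := by
      rw [h.adj, h.aeval_adj, ← hτ, ← giτ, h.skew]
    rw [hy2 _ hmem, map_sub, LinearMap.sub_apply]
    linear_combination e3 - e1 - e2 - e4
  have hπs : aeval τ π s = 0 := by
    rw [hs, ← amul, ← pow_succ', hu]
  have hqs : aeval τ ((X - C 1 - C 1) * (X + C 1 + C 1) : F[X]) s = 0 := by
    have hτs : τ s = g s + g s := by rw [hτ, LinearMap.add_apply, ← hgs]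
    have hgg : g (g s) = s := by rw [hgs, h.right]
    have hgig : gi (g s) = s := h.left s
    rw [amul]
    simp only [map_add, map_sub, aeval_X, map_one, LinearMap.add_apply, LinearMap.sub_apply,
      Module.End.one_apply, hτs]
    simp only [hτ, LinearMap.add_apply, hgg, hgig]
    abel
  by_contra hnd'
  obtain ⟨a, b, hab⟩ := hπ.coprime_iff_not_dvd.2 hnd'
  apply hs0
  have : aeval τ (a * π + b * ((X - C 1 - C 1) * (X + C 1 + C 1))) s = s := by rw [hab]; simp
  rw [← this, map_add, LinearMap.add_apply, amul, amul, hπs, hqs, map_zero, map_zero, add_zero]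

theorem dec_of_bad [FiniteDimensional F U] (h : IsSympl ω g gi)
    (bad : ∀ Z, Flex ω g gi Z → Z = ⊥) (hdvd : X - C 1 - C 1 ∣ minpoly F (g + gi))
    (IH : ∀ (V : Type) [AddCommGroup V] [Module F V] [FiniteDimensional F V]
      (ω : LinearMap.BilinForm F V) (g gi : Module.End F V), IsSympl ω g gi →
      finrank F V < finrank F U → Dec ω g) : Dec ω g := by
  have hirr : Irreducible (X - C 1 - C 1 : F[X]) := by
    rw [sub_sub, ← C_add]; exact irreducible_X_sub_C _
  obtain ⟨-, k, h1, h2, h3⟩ := bad_primary h bad hirr hdvd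
  have hev : ∀ j (x : U), ev g gi ((X : F[X]) ^ j) x = aeval (g + gi) ((X - C 1 - C 1 : F[X]) ^ j) x :=
    fun j x => by rw [aeval_nu]; simp
  have hk : ∀ x, x ∈ nuKer g gi k ↔ aeval (g + gi) ((X - C 1 - C 1 : F[X]) ^ (k + 1)) x = 0 :=
    fun x => by rw [nuKer, LinearMap.mem_ker, hev]
  refine dec_of_unipotent h bad (k := k) ?_ ?_ ?_ IH
  · simpa only [hk, hev] using h1
  · simpa only [hk, hev] using h2
  · simpa only [hk] using h3

theorem dec_step [FiniteDimensional F U] (h : IsSympl ω g gi)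
    (IH : ∀ (V : Type) [AddCommGroup V] [Module F V] [FiniteDimensional F V]
      (ω : LinearMap.BilinForm F V) (g gi : Module.End F V), IsSympl ω g gi →
      finrank F V < finrank F U → Dec ω g) : Dec ω g := by
  rcases subsingleton_or_nontrivial U with hU | hU
  · refine ⟨Empty, inferInstance, inferInstance, Empty.elim, Empty.elim, Empty.elim, Empty.elim,
      Empty.elim, ?_, ?_, ?_⟩
    · constructor <;> rintro ⟨⟩
    · constructor <;> rintro ⟨⟩
    · simp [finrank_zero_of_subsingleton]
  by_cases hbad : ∃ Z, Flex ω g gi Z ∧ Z ≠ ⊥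
  · obtain ⟨Z, hZ, hne⟩ := hbad
    exact dec_of_flex h Z hZ hne IH
  push Not at hbad
  obtain ⟨π, hmon, hirr, hdvd⟩ := exists_monic_irreducible_factor _ (minpoly.not_isUnit F (g + gi))
  have h2 := (bad_primary h hbad hirr hdvd).1
  rcases hirr.prime.dvd_or_dvd h2 with h3 | h3
  · have hirr' : Irreducible (X - C 1 - C 1 : F[X]) := by
      rw [sub_sub, ← C_add]; exact irreducible_X_sub_C _
    exact dec_of_bad h hbad (((hirr.dvd_irreducible_iff_associated hirr').1 h3).symm.dvd.trans hdvd) IH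
  · have hirr' : Irreducible (X + C 1 + C 1 : F[X]) := by
      rw [add_assoc, ← C_add, ← sub_neg_eq_add, ← C_neg]; exact irreducible_X_sub_C _
    have h4 := ((hirr.dvd_irreducible_iff_associated hirr').1 h3).symm.dvd.trans hdvd
    refine Dec.of_neg (dec_of_bad h.neg (fun Z hZ => hbad Z (by simpa using hZ.neg)) ?_ IH)
    have h5 : minpoly F (g + gi) ∣ (minpoly F (-g + -gi)).comp (-X) := by
      apply minpoly.dvd
      rw [aeval_comp]
      have : aeval (g + gi) (-X : F[X]) = -g + -gi := by simp [add_comm]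
      rw [this, minpoly.aeval]
    obtain ⟨q, hq⟩ := h4.trans h5
    have h6 := congrArg (eval (-(1 + 1))) hq
    rw [sub_sub, ← C_add, dvd_iff_isRoot, IsRoot]
    simpa [eval_comp] using h6

theorem exists_dec [FiniteDimensional F U] (h : IsSympl ω g gi) : Dec ω g := by
  suffices ∀ n : ℕ, ∀ (V : Type) [AddCommGroup V] [Module F V] [FiniteDimensional F V]
      (ω : LinearMap.BilinForm F V) (g gi : Module.End F V), IsSympl ω g gi →
      finrank F V = n → Dec ω g from this _ U ω g gi h rfl
  intro n
  induction n using Nat.strong_induction_on with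
  | _ n ih =>
    intro V _ _ _ ω g gi hV hn
    exact dec_step hV fun W _ _ _ ω' g' gi' hW hlt => ih _ (hn ▸ hlt) W ω' g' gi' hW rfl

end

section

variable {F U : Type} [Field F] [AddCommGroup U] [Module F U]
  {ω : LinearMap.BilinForm F U} {g gi : Module.End F U}

/-- A hyperbolic system in which `g` exchanges `p` and `q` can be changed so that the coordinates
of `g` have a block form with a unipotent factorisation. -/
theorem exists_mixed (h : IsSympl ω g gi) {R Q : Type} [Fintype R] [Fintype Q] [DecidableEq R]
    [DecidableEq Q] (r r' : R → U) (p p' q q' : Q → U)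
    (rr : ∀ i j, ω (r i) (r j) = 0) (rp : ∀ i j, ω (r i) (p j) = 0) (rq : ∀ i j, ω (r i) (q j) = 0)
    (pp : ∀ i j, ω (p i) (p j) = 0) (pq : ∀ i j, ω (p i) (q j) = 0) (qq : ∀ i j, ω (q i) (q j) = 0)
    (rr2 : ∀ i j, ω (r' i) (r' j) = 0) (rp2 : ∀ i j, ω (r' i) (p' j) = 0)
    (rq2 : ∀ i j, ω (r' i) (q' j) = 0) (pp2 : ∀ i j, ω (p' i) (p' j) = 0)
    (pq2 : ∀ i j, ω (p' i) (q' j) = 0) (qq2 : ∀ i j, ω (q' i) (q' j) = 0)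
    (rr1 : ∀ i j, ω (r i) (r' j) = if i = j then 1 else 0)
    (rp1 : ∀ i j, ω (r i) (p' j) = 0) (rq1 : ∀ i j, ω (r i) (q' j) = 0)
    (pr1 : ∀ i j, ω (p i) (r' j) = 0) (pp1 : ∀ i j, ω (p i) (p' j) = if i = j then 1 else 0)
    (pq1 : ∀ i j, ω (p i) (q' j) = 0) (qr1 : ∀ i j, ω (q i) (r' j) = 0)
    (qp1 : ∀ i j, ω (q i) (p' j) = 0) (qq1 : ∀ i j, ω (q i) (q' j) = if i = j then 1 else 0)
    (gp : ∀ i, g (p i) = q i) (gq : ∀ i, g (q i) = p i)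
    (grr : ∀ i j, ω (g (r i)) (r' j) = if i = j then 1 else 0)
    (grp : ∀ i j, ω (g (r i)) (p' j) = 0) (grq : ∀ i j, ω (g (r i)) (q' j) = 0)
    (α γ σ : Q → F) (hσ : ∀ i, σ i * σ i = 1) (hβ : ∀ i, γ i - σ i ≠ 0)
    (gqp : ∀ i j, ω (g (q' i)) (p' j) = if i = j then α i else 0)
    (gqq : ∀ i j, ω (g (q' i)) (q' j) = if i = j then γ i else 0) :
    ∃ E E' : R ⊕ (Q ⊕ Q) → U, (∀ i j, ω (E i) (E j) = 0) ∧ (∀ i j, ω (E' i) (E' j) = 0) ∧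
      (∀ i j, ω (E i) (E' j) = if i = j then 1 else 0) ∧
      ∃ x β : Q → F,
      (∀ i j, ω (g (E (.inl i))) (E' (.inl j)) = if i = j then 1 else 0) ∧
      (∀ i j, ω (g (E (.inl i))) (E' (.inr j)) = 0) ∧
      (∀ i j, ω (g (E (.inr i))) (E' (.inl j)) = 0) ∧
      (∀ i j, ω (g (E (.inr (.inl i)))) (E' (.inr (.inl j))) = if i = j then 1 else 0) ∧
      (∀ i j, ω (g (E (.inr (.inl i)))) (E' (.inr (.inr j))) = if i = j then x i else 0) ∧
      (∀ i j, ω (g (E (.inr (.inr i)))) (E' (.inr (.inl j))) = if i = j then β i else 0) ∧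
      (∀ i j, ω (g (E (.inr (.inr i)))) (E' (.inr (.inr j))) =
        if i = j then 1 + x i * β i else 0) := by
  have gip : ∀ i, gi (p i) = q i := fun i => by rw [← gq, h.left]
  have giq : ∀ i, gi (q i) = p i := fun i => by rw [← gp, h.left]
  have pr : ∀ i j, ω (p i) (r j) = 0 := fun i j => by rw [h.skew, rp, neg_zero]
  have qr : ∀ i j, ω (q i) (r j) = 0 := fun i j => by rw [h.skew, rq, neg_zero]
  have qp : ∀ i j, ω (q i) (p j) = 0 := fun i j => by rw [h.skew, pq, neg_zero]
  have pr2 : ∀ i j, ω (p' i) (r' j) = 0 := fun i j => by rw [h.skew, rp2, neg_zero]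
  have qr2 : ∀ i j, ω (q' i) (r' j) = 0 := fun i j => by rw [h.skew, rq2, neg_zero]
  have qp2 : ∀ i j, ω (q' i) (p' j) = 0 := fun i j => by rw [h.skew, pq2, neg_zero]
  have rr3 : ∀ i j, ω (r' i) (r j) = if j = i then -1 else 0 := fun i j => by
    rw [h.skew, rr1]; split_ifs <;> simp
  have pp3 : ∀ i j, ω (p' i) (p j) = if j = i then -1 else 0 := fun i j => by
    rw [h.skew, pp1]; split_ifs <;> simp
  have qq3 : ∀ i j, ω (q' i) (q j) = if j = i then -1 else 0 := fun i j => by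
    rw [h.skew, qq1]; split_ifs <;> simp
  have rp3 : ∀ i j, ω (r' i) (p j) = 0 := fun i j => by rw [h.skew, pr1, neg_zero]
  have rq3 : ∀ i j, ω (r' i) (q j) = 0 := fun i j => by rw [h.skew, qr1, neg_zero]
  have pr3 : ∀ i j, ω (p' i) (r j) = 0 := fun i j => by rw [h.skew, rp1, neg_zero]
  have pq3 : ∀ i j, ω (p' i) (q j) = 0 := fun i j => by rw [h.skew, qp1, neg_zero]
  have qr3 : ∀ i j, ω (q' i) (r j) = 0 := fun i j => by rw [h.skew, rq1, neg_zero]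
  have qp3 : ∀ i j, ω (q' i) (p j) = 0 := fun i j => by rw [h.skew, pq1, neg_zero]
  have grp0 : ∀ i j, ω (g (r i)) (p j) = 0 := fun i j => by rw [h.adj, gip, rq]
  have grq0 : ∀ i j, ω (g (r i)) (q j) = 0 := fun i j => by rw [h.adj, giq, rp]
  have gqp0 : ∀ i j, ω (g (q' i)) (p j) = if j = i then -1 else 0 := fun i j => by
    rw [h.adj, gip, qq3]
  have gqq0 : ∀ i j, ω (g (q' i)) (q j) = 0 := fun i j => by rw [h.adj, giq, qp3]
  let ζ : Q → R → F := fun j i => ω (g (q' j)) (r' i)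
  have hζ : ∀ j i, ω (g (q' j)) (r' i) = ζ j i := fun _ _ => rfl
  let β : Q → F := fun j => γ j - σ j
  have hβ0 : ∀ j, β j ≠ 0 := hβ
  let x : Q → F := fun j => 2 * σ j
  let P : Q → U := fun j => p j + (β j)⁻¹ • ∑ i, ζ j i • r i
  let P' : Q → U := fun j => p' j + (σ j + α j) • p j + q' j
  let Q' : Q → U := fun j => -q j + p j + x j • q' j
  let R' : R → U := fun i => r' i - ∑ j, (ζ j i * (β j)⁻¹) • P' j
  have a1 : ∀ i j, ω (r i) (P' j) = 0 := fun i j => by simp [P', rp1, rp, rq1]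
  have a2 : ∀ i j, ω (r i) (Q' j) = 0 := fun i j => by simp [Q', rp, rq, rq1]
  have a3 : ∀ i j, ω (r i) (R' j) = if i = j then 1 else 0 := fun i j => by
    simp [R', rr1, a1]
  have b1 : ∀ i j, ω (P i) (P' j) = if i = j then 1 else 0 := fun i j => by
    simp [P, a1]; simp [P', pp1, pp, pq1]
  have b2 : ∀ i j, ω (P i) (Q' j) = 0 := fun i j => by
    simp [P, a2]; simp [Q', pp, pq, pq1]
  have b3 : ∀ i j, ω (P i) (R' j) = 0 := fun i j => by
    simp only [R', map_sub, map_sum, map_smul, b1]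
    simp [P, pr1, rr1]
    ring
  have c1 : ∀ i j, ω (q' i) (P' j) = 0 := fun i j => by simp [P', qp2, qp3, qq2]
  have c2 : ∀ i j, ω (q' i) (Q' j) = if i = j then 1 else 0 := fun i j => by
    simp [Q', qp3, qq3, qq2, eq_comm]
    split_ifs <;> simp
  have c3 : ∀ i j, ω (q' i) (R' j) = 0 := fun i j => by simp [R', qr2, c1]
  have d1 : ∀ i j, ω (P' i) (P' j) = 0 := fun i j => by
    simp only [P', map_add, LinearMap.add_apply, map_smul, LinearMap.smul_apply, pp2, pq2, pp, pp1,
      pq1, qp2, qq2, pp3, qp3]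
    by_cases hij : i = j
    · subst hij; simp
    · simp [hij, Ne.symm hij]
  have d2 : ∀ i j, ω (P' i) (Q' j) = 0 := fun i j => by
    simp only [P', Q', map_add, LinearMap.add_apply, map_smul, LinearMap.smul_apply, pq2, pp,
      pq1, qq2, pp3, qp3, map_neg, pq3, pq, qq3]
    by_cases hij : i = j
    · subst hij; simp
    · simp [Ne.symm hij]
  have d3 : ∀ i j, ω (Q' i) (Q' j) = 0 := fun i j => by
    simp only [Q', map_add, LinearMap.add_apply, map_smul, LinearMap.smul_apply, pp,
      pq1, qq2, qp3, map_neg, pq, qq3, qq, qp, LinearMap.neg_apply, qq1]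
    by_cases hij : i = j
    · subst hij; simp [x]
    · simp [hij, Ne.symm hij]
  have d4 : ∀ i j, ω (r' i) (P' j) = 0 := fun i j => by simp [P', rp2, rp3, rq2]
  have d4' : ∀ i j, ω (P' i) (r' j) = 0 := fun i j => by rw [h.skew, d4, neg_zero]
  have d5 : ∀ i j, ω (r' i) (Q' j) = 0 := fun i j => by simp [Q', rp3, rq3, rq2]
  have d6 : ∀ i j, ω (R' i) (P' j) = 0 := fun i j => by simp [R', d4, d1]
  have d7 : ∀ i j, ω (R' i) (Q' j) = 0 := fun i j => by simp [R', d5, d2]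
  have d8 : ∀ i j, ω (R' i) (R' j) = 0 := fun i j => by simp [R', d1, d4, d4', rr2]
  have e1 : ∀ i j, ω (g (r i)) (P' j) = 0 := fun i j => by simp [P', grp, grp0, grq]
  have e2 : ∀ i j, ω (g (r i)) (Q' j) = 0 := fun i j => by simp [Q', grp0, grq0, grq]
  have e3 : ∀ i j, ω (g (r i)) (R' j) = if i = j then 1 else 0 := fun i j => by
    simp [R', grr, e1]
  have f1 : ∀ i j, ω (g (P i)) (P' j) = if i = j then 1 else 0 := fun i j => by
    simp [P, e1, gp]; simp [P', qp1, qp, qq1]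
  have f2 : ∀ i j, ω (g (P i)) (Q' j) = if i = j then x i else 0 := fun i j => by
    simp only [P, map_add, map_smul, map_sum, LinearMap.add_apply, LinearMap.smul_apply,
      LinearMap.sum_apply, e2, gp, smul_zero, Finset.sum_const_zero, add_zero]
    simp only [Q', map_add, map_neg, map_smul, qq, qp, qq1]
    by_cases hij : i = j
    · subst hij; simp
    · simp [hij]
  have f3 : ∀ i j, ω (g (P i)) (R' j) = 0 := fun i j => by
    simp only [R', map_sub, map_sum, map_smul, f1]
    simp [P, gp, qr1, grr]
    ring
  have k1 : ∀ i j, ω (g (q' i)) (P' j) = if i = j then β i else 0 := fun i j => by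
    simp only [P', map_add, map_smul, gqp, gqp0, gqq]
    by_cases hij : i = j
    · subst hij; simp [β]; ring
    · simp [hij, Ne.symm hij]
  have k2 : ∀ i j, ω (g (q' i)) (Q' j) = if i = j then 1 + x i * β i else 0 := fun i j => by
    simp only [Q', map_add, map_smul, map_neg, gqp0, gqq, gqq0]
    by_cases hij : i = j
    · subst hij; simp [β, x]; linear_combination 2 * hσ i
    · simp [hij, Ne.symm hij]
  have k3 : ∀ i j, ω (g (q' i)) (R' j) = 0 := fun i j => by
    simp only [R', map_sub, map_sum, map_smul, k1, hζ]
    simp [hβ0]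
  have sk : ∀ {a b}, ω a b = 0 → ω b a = 0 := fun {a b} hab => by rw [h.skew, hab, neg_zero]
  have n1 : ∀ i j, ω (P i) (r j) = 0 := fun i j => by simp [P, pr, rr]
  have n2 : ∀ i j, ω (P i) (P j) = 0 := fun i j => by
    simp only [P, map_add, LinearMap.add_apply, map_smul, LinearMap.smul_apply, map_sum,
      LinearMap.sum_apply, pp, pr, rp, rr]; simp
  have n3 : ∀ i j, ω (P i) (q' j) = 0 := fun i j => by simp [P, pq1, rq1]
  refine ⟨Sum.elim r (Sum.elim P q'), Sum.elim R' (Sum.elim P' Q'), ?_, ?_, ?_, x, β, e3, ?_, ?_,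
    f1, f2, k1, k2⟩
  · rintro (i | i | i) (j | j | j)
    exacts [rr _ _, sk (n1 _ _), rq1 _ _, n1 _ _, n2 _ _, n3 _ _, qr3 _ _, sk (n3 _ _), qq2 _ _]
  · rintro (i | i | i) (j | j | j)
    exacts [d8 _ _, d6 _ _, d7 _ _, sk (d6 _ _), d1 _ _, d2 _ _, sk (d7 _ _), sk (d2 _ _), d3 _ _]
  · rintro (i | i | i) (j | j | j)
    · simpa using a3 i j
    · simpa using a1 i j
    · simpa using a2 i j
    · simpa using b3 i j
    · simpa using b1 i j
    · simpa using b2 i j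
    · simpa using c3 i j
    · simpa using c1 i j
    · simpa using c2 i j
  · rintro i (j | j)
    exacts [e1 _ _, e2 _ _]
  · rintro (i | i) j
    exacts [f3 _ _, k3 _ _]

end

section

variable {F U : Type} [Field F] [AddCommGroup U] [Module F U]
  {ω : LinearMap.BilinForm F U} {g gi : Module.End F U}

theorem Fam.exists_rearranged {ι : Type} [Fintype ι] [DecidableEq ι] {t : ι → ℤ} {e e' : ι → U}
    (h : IsSympl ω g gi) (hf : Fam ω g t e e')
    (hc : Fintype.card {i // t i = -1} ≤ Fintype.card {i // t i = 1})
    (h2 : ∀ i, t i = -1 → (2 : F) ≠ 0) :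
    ∃ (R Q : Type) (_ : Fintype R) (_ : Fintype Q) (_ : DecidableEq R) (_ : DecidableEq Q),
      Fintype.card R + 2 * Fintype.card Q = Fintype.card ι ∧
      ∃ E E' : R ⊕ (Q ⊕ Q) → U, (∀ i j, ω (E i) (E j) = 0) ∧ (∀ i j, ω (E' i) (E' j) = 0) ∧
      (∀ i j, ω (E i) (E' j) = if i = j then 1 else 0) ∧
      ∃ x β : Q → F,
      (∀ i j, ω (g (E (.inl i))) (E' (.inl j)) = if i = j then 1 else 0) ∧
      (∀ i j, ω (g (E (.inl i))) (E' (.inr j)) = 0) ∧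
      (∀ i j, ω (g (E (.inr i))) (E' (.inl j)) = 0) ∧
      (∀ i j, ω (g (E (.inr (.inl i)))) (E' (.inr (.inl j))) = if i = j then 1 else 0) ∧
      (∀ i j, ω (g (E (.inr (.inl i)))) (E' (.inr (.inr j))) = if i = j then x i else 0) ∧
      (∀ i j, ω (g (E (.inr (.inr i)))) (E' (.inr (.inl j))) = if i = j then β i else 0) ∧
      (∀ i j, ω (g (E (.inr (.inr i)))) (E' (.inr (.inr j))) =
        if i = j then 1 + x i * β i else 0) := by
  classical
  obtain ⟨s⟩ := Function.Embedding.nonempty_of_card_le hc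
  let Q := {i // t i = -1}
  let u : Q ⊕ Q → ι := Sum.elim (fun j => s j) (fun j => j)
  have hne : ∀ i j : Q, (s i : ι) ≠ j := fun i j hij => by
    have h1 := (s i).2
    rw [hij, j.2] at h1
    norm_num at h1
  have hu : Function.Injective u := by
    rintro (i | i) (j | j) hij
    · exact congrArg _ (s.injective (Subtype.ext hij))
    · exact absurd hij (hne i j)
    · exact absurd hij.symm (hne j i)
    · exact congrArg _ (Subtype.ext hij)
  let R := {i // i ∉ Set.range u}
  have hR1 : ∀ (i : R) (j : Q), (i : ι) ≠ s j := fun i j hij => i.2 ⟨.inl j, hij.symm⟩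
  have hR2 : ∀ (i : R) (j : Q), (i : ι) ≠ j := fun i j hij => i.2 ⟨.inr j, hij.symm⟩
  have hR3 : ∀ i : R, sgn F (t i) = 1 := fun i => by
    rw [sgn, if_neg]
    exact fun hi => hR2 i ⟨i, hi⟩ rfl
  have s1 : ∀ j : Q, sgn F (t (s j)) = 1 := fun j => by rw [(s j).2]; simp [sgn]
  have s2 : ∀ j : Q, sgn F (t j) = -1 := fun j => by rw [j.2]; simp [sgn]
  have t1 : ∀ j : Q, t (s j) ≠ 0 := fun j => by rw [(s j).2]; simp
  have t2 : ∀ j : Q, t j ≠ 0 := fun j => by rw [j.2]; simp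
  have g1 : ∀ j : Q, g (e (s j)) = e (s j) := fun j => by rw [hf.fix _ (t1 j), s1, one_smul]
  have g2 : ∀ j : Q, g (e j) = -e j := fun j => by rw [hf.fix _ (t2 j), s2, neg_smul, one_smul]
  have two : ∀ j : Q, (2 : F) ≠ 0 := fun j => h2 j j.2
  have si : ∀ i j : Q, (s i : ι) = s j ↔ i = j := fun i j =>
    ⟨fun h => s.injective (Subtype.ext h), fun h => by rw [h]⟩
  have vi : ∀ i j : Q, (i : ι) = j ↔ i = j := fun i j => Subtype.ext_iff.symm
  have ri : ∀ i j : R, (i : ι) = j ↔ i = j := fun i j => Subtype.ext_iff.symm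
  have hne' : ∀ i j : Q, (j : ι) ≠ s i := fun i j => (hne i j).symm
  have gij : ∀ i j, i ≠ j → ω (g (e i)) (e' j) = 0 := fun i j hij => by rw [hf.gpair, if_neg hij]
  let a : Q → F := fun j => ω (g (e' (s j))) (e' (s j))
  let b : Q → F := fun j => ω (g (e' j)) (e' j)
  let γ : Q → F := fun j => (2⁻¹ * 2⁻¹) * (a j + b j)
  let σ : Q → F := fun j => if γ j = 1 then -1 else 1
  have x1 : ∀ i j : Q, i ≠ j → ω (g (e' (s i))) (e' (s j)) = 0 := fun i j hij =>
    hf.gpair' _ _ (fun h => hij ((si i j).1 h)) (t1 i) (t1 j)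
  have x2 : ∀ i j : Q, i ≠ j → ω (g (e' i)) (e' j) = 0 := fun i j hij =>
    hf.gpair' _ _ (fun h => hij (Subtype.ext h)) (t2 i) (t2 j)
  have x3 : ∀ i j : Q, ω (g (e' (s i))) (e' j) = 0 := fun i j =>
    hf.gpair' _ _ (hne i j) (t1 i) (t2 j)
  have x4 : ∀ i j : Q, ω (g (e' i)) (e' (s j)) = 0 := fun i j =>
    hf.gpair' _ _ (hne' j i) (t2 i) (t1 j)
  have hcard : Fintype.card R + 2 * Fintype.card Q = Fintype.card ι := by
    have e1 : R ⊕ (Q ⊕ Q) ≃ ι := (Equiv.sumComm _ _).trans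
      ((Equiv.sumCongr (Equiv.ofInjective u hu) (Equiv.refl _)).trans
        (Equiv.Set.sumCompl (Set.range u)))
    rw [← Fintype.card_congr e1]
    simp [two_mul]
  refine ⟨R, Q, inferInstance, inferInstance, inferInstance, inferInstance, hcard, ?_⟩
  refine exists_mixed h (fun i : R => e i) (fun i => e' i) (fun j : Q => e (s j) + e j)
    (fun j => (2⁻¹ : F) • (e' (s j) + e' j)) (fun j => e (s j) - e j)
    (fun j => (2⁻¹ : F) • (e' (s j) - e' j))
    ?_ ?_ ?_ ?_ ?_ ?_ ?_ ?_ ?_ ?_ ?_ ?_ ?_ ?_ ?_ ?_ ?_ ?_ ?_ ?_ ?_ ?_ ?_ ?_ ?_ ?_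
    (fun j => (2⁻¹ * 2⁻¹) * (a j - b j)) γ σ ?_ ?_ ?_ ?_
  iterate 6 · intro i j; simp [hf.iso]
  iterate 6 · intro i j; simp [hf.iso']
  · intro i j; simp [hf.pair, ri]
  · intro i j; simp [hf.pair, hR1, hR2]
  · intro i j; simp [hf.pair, hR1, hR2]
  · intro i j; simp [hf.pair, (hR1 _ _).symm, (hR2 _ _).symm]
  · intro i j; simp [hf.pair, hne, hne', si, vi]
    split_ifs
    · field_simp [two i]; norm_num
    · simp
  · intro i j; simp [hf.pair, hne, hne', si, vi]
  · intro i j; simp [hf.pair, (hR1 _ _).symm, (hR2 _ _).symm]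
  · intro i j; simp [hf.pair, hne, hne', si, vi]
  · intro i j; simp [hf.pair, hne, hne', si, vi]
    split_ifs
    · field_simp [two i]; norm_num
    · simp
  · intro i; simp [g1, g2, sub_eq_add_neg]
  · intro i; simp [g1, g2]
  · intro i j; rw [hf.gpair]; simp [hR3, ri]
  · intro i j; simp [gij, hR1, hR2]
  · intro i j; simp [gij, hR1, hR2]
  · intro i; dsimp only [σ]; split_ifs <;> simp
  · intro i
    dsimp only [σ]
    split_ifs with h1
    · rw [h1, sub_neg_eq_add, one_add_one_eq_two]; exact two i
    · exact sub_ne_zero.2 h1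
  · intro i j
    simp only [map_smul, map_add, map_sub, LinearMap.smul_apply,
      LinearMap.sub_apply, x3, x4, smul_eq_mul]
    split_ifs with hij
    · subst hij; simp only [a, b]; ring
    · simp [x1 i j hij, x2 i j hij]
  · intro i j
    simp only [map_smul, map_sub, LinearMap.smul_apply,
      LinearMap.sub_apply, x3, x4, smul_eq_mul]
    split_ifs with hij
    · subst hij; simp only [γ, a, b]; ring
    · simp [x1 i j hij, x2 i j hij]

theorem Fam.exists_block {ι : Type} [Fintype ι] [DecidableEq ι] {t : ι → ℤ} {e e' : ι → U}
    (h : IsSympl ω g gi) (hf : Fam ω g t e e')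
    (hc : Fintype.card {i // t i = -1} ≤ Fintype.card {i // t i = 1})
    (h2 : ∀ i, t i = -1 → (2 : F) ≠ 0) (T : Type) [Fintype T] [DecidableEq T]
    (hT : Fintype.card ι = 2 * Fintype.card T) :
    ∃ E E' : T ⊕ T → U, (∀ i j, ω (E i) (E j) = 0) ∧ (∀ i j, ω (E' i) (E' j) = 0) ∧
      (∀ i j, ω (E i) (E' j) = if i = j then 1 else 0) ∧
      ∃ b c : Matrix T T F, ∀ i j,
        ω (g (E j)) (E' i) = Matrix.fromBlocks 1 b c (1 + c * b) i j := by
  obtain ⟨R, Q, _, _, _, _, hcard, E, E', iso, iso', pair, x, β, rr, rq, qr, pp, pq, qp, qq⟩ :=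
    hf.exists_rearranged h hc h2
  let T' := Fin (Fintype.card T - Fintype.card Q)
  have e1 : R ≃ T' ⊕ T' := Fintype.equivOfCardEq (by simp [T']; omega)
  have e2 : T ≃ T' ⊕ Q := Fintype.equivOfCardEq (by simp [T']; omega)
  let θ : (T' ⊕ Q) ⊕ (T' ⊕ Q) → R ⊕ (Q ⊕ Q) :=
    Sum.elim (Sum.elim (fun i => .inl (e1.symm (.inl i))) (fun j => .inr (.inl j)))
      (Sum.elim (fun i => .inl (e1.symm (.inr i))) (fun j => .inr (.inr j)))
  have hθ : Function.Injective θ := by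
    rintro ((i | i) | (i | i)) ((j | j) | (j | j)) hij <;> simp [θ] at hij ⊢ <;> exact hij
  have hinj : Function.Injective (θ ∘ Sum.map e2 e2) :=
    hθ.comp (e2.injective.sumMap e2.injective)
  refine ⟨E ∘ θ ∘ Sum.map e2 e2, E' ∘ θ ∘ Sum.map e2 e2, fun i j => iso _ _, fun i j => iso' _ _,
    fun i j => ?_, Matrix.diagonal fun i => Sum.elim 0 β (e2 i),
    Matrix.diagonal fun i => Sum.elim 0 x (e2 i), ?_⟩
  · exact (pair _ _).trans (if_congr hinj.eq_iff rfl rfl)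
  · let β' : T' ⊕ Q → F := Sum.elim 0 β
    let x' : T' ⊕ Q → F := Sum.elim 0 x
    rw [Matrix.diagonal_mul_diagonal, ← Matrix.diagonal_one, Matrix.diagonal_add]
    have key : ∀ i j, ω (g (E (θ j))) (E' (θ i)) = Matrix.fromBlocks (Matrix.diagonal fun _ => 1)
        (Matrix.diagonal β') (Matrix.diagonal x') (Matrix.diagonal (1 + x' * β')) i j := by
      rintro ((i | i) | (i | i)) ((j | j) | (j | j)) <;>
        simp only [θ, β', x', rr, rq, qr, pp, pq, qp, qq, Matrix.diagonal_apply, Sum.elim_inl,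
          Sum.elim_inr, Matrix.fromBlocks_apply₁₁, Matrix.fromBlocks_apply₁₂,
          Matrix.fromBlocks_apply₂₁, Matrix.fromBlocks_apply₂₂, Sum.inl.injEq, Sum.inr.injEq,
          reduceCtorEq, if_false, EmbeddingLike.apply_eq_iff_eq, Pi.zero_apply, ite_self,
          Pi.add_apply, Pi.mul_apply, Pi.one_apply, mul_zero, add_zero] <;>
        first
        | done
        | (by_cases hij : i = j
           · subst hij; simp
           · simp [hij, Ne.symm hij])
    intro i j
    refine (key _ _).trans ?_
    rcases i with i | i <;> rcases j with j | j <;>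
      simp [Matrix.diagonal_apply, Matrix.one_apply, β', x']

theorem Fam.zero {ι : Type} [DecidableEq ι] {t : ι → ℤ} {e e' : ι → U} (hf : Fam ω g t e e')
    (h2 : (2 : F) = 0) : Fam ω g (0 : ι → ℤ) e e' where
  iso := hf.iso
  iso' := hf.iso'
  pair := hf.pair
  gpair i j := by
    have h1 : (-1 : F) = 1 := by linear_combination -h2
    rw [hf.gpair]
    simp [sgn, h1]
  fix i hi := absurd rfl hi
  gpair' i j _ hi := absurd rfl hi

/-- Up to sign, every isometry has the block `[1, b; c, 1 + c * b]` on a suitable pair of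
complementary Lagrangians. -/
theorem IsSympl.exists_block [FiniteDimensional F U] (h : IsSympl ω g gi) (T : Type) [Fintype T]
    [DecidableEq T] (hT : finrank F U = 2 * Fintype.card (T ⊕ T)) :
    ∃ ε : F, (ε = 1 ∨ ε = -1) ∧ ∃ E E' : T ⊕ T → U, (∀ i j, ω (E i) (E j) = 0) ∧
      (∀ i j, ω (E' i) (E' j) = 0) ∧ (∀ i j, ω (E i) (E' j) = if i = j then 1 else 0) ∧
      ∃ b c : Matrix T T F, ∀ i j,
        ε * ω (g (E j)) (E' i) = Matrix.fromBlocks 1 b c (1 + c * b) i j := by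
  obtain ⟨ι, _, _, t, e, e', f, f', he, hf, hι⟩ := exists_dec h
  have hcard : Fintype.card ι = 2 * Fintype.card T := by
    rw [Fintype.card_sum] at hT
    omega
  by_cases h2 : (2 : F) = 0
  · obtain ⟨E, E', h3⟩ := (he.zero h2).exists_block h (by simp) (by simp) T hcard
    exact ⟨1, .inl rfl, E, E', by simpa only [one_mul] using h3⟩
  · rcases le_total (Fintype.card {i // t i = -1}) (Fintype.card {i // t i = 1}) with h1 | h1
    · obtain ⟨E, E', h3⟩ := he.exists_block h h1 (fun _ _ => h2) T hcard
      exact ⟨1, .inl rfl, E, E', by simpa only [one_mul] using h3⟩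
    · have h3 : Fintype.card {i // (-t) i = -1} ≤ Fintype.card {i // (-t) i = 1} := by
        simpa only [Pi.neg_apply, neg_eq_iff_eq_neg, neg_neg] using h1
      obtain ⟨E, E', h4⟩ := hf.exists_block h.neg h3 (fun _ _ => h2) T hcard
      refine ⟨-1, .inr rfl, E, E', ?_⟩
      simpa only [LinearMap.neg_apply, map_neg, neg_mul, one_mul] using h4

end

section

open Matrix

variable {F : Type} [Field F] {l : Type} [Fintype l] [DecidableEq l]

/-- The standard symplectic form on coordinate vectors. -/
noncomputable def stdForm (l F : Type) [Field F] [Fintype l] [DecidableEq l] :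
    LinearMap.BilinForm F (l ⊕ l → F) :=
  Matrix.toBilin' (-Matrix.J l F)

theorem stdForm_apply (x y : l ⊕ l → F) :
    stdForm l F x y = ∑ i, x (.inl i) * y (.inr i) - ∑ i, x (.inr i) * y (.inl i) := by
  rw [stdForm, Matrix.toBilin'_apply', Matrix.J, Matrix.neg_mulVec, dotProduct_neg,
    Matrix.fromBlocks_mulVec]
  simp [dotProduct, Fintype.sum_sum_type, Matrix.neg_mulVec]
  ring

theorem isSympl_stdForm (G : symplecticGroup l F) :
    IsSympl (stdForm l F) (Matrix.toLin' (G : Matrix (l ⊕ l) (l ⊕ l) F))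
      (Matrix.toLin' (G⁻¹ : symplecticGroup l F)) where
  alt x := by
    rw [stdForm_apply]
    simp [mul_comm]
  nd x hx := by
    ext (i | i)
    · simpa [stdForm_apply, Pi.single_apply] using hx (Pi.single (.inr i) 1)
    · simpa [stdForm_apply, Pi.single_apply] using hx (Pi.single (.inl i) 1)
  iso x y := by
    have hG := SymplecticGroup.mem_iff'.1 G.2
    simp only [stdForm, Matrix.toBilin'_apply', Matrix.toLin'_apply]
    rw [Matrix.dotProduct_mulVec, Matrix.vecMul_mulVec, ← Matrix.dotProduct_mulVec,
      Matrix.mulVec_mulVec, mul_neg, neg_mul, hG]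
  right x := by
    rw [Matrix.toLin'_apply, Matrix.toLin'_apply, Matrix.mulVec_mulVec,
      ← Submonoid.coe_mul, mul_inv_cancel, Submonoid.coe_one, Matrix.one_mulVec]
  left x := by
    rw [Matrix.toLin'_apply, Matrix.toLin'_apply, Matrix.mulVec_mulVec,
      ← Submonoid.coe_mul, inv_mul_cancel, Submonoid.coe_one, Matrix.one_mulVec]

/-- Every symplectic matrix is, up to sign and conjugation, one whose upper left block is
`[1, b; c, 1 + c * b]`. -/
theorem exists_conj_block {T : Type} [Fintype T] [DecidableEq T]
    (G : symplecticGroup (T ⊕ T) F) :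
    ∃ ε : F, (ε = 1 ∨ ε = -1) ∧ ∃ H : symplecticGroup (T ⊕ T) F, ∃ b c : Matrix T T F,
      (ε • ((H⁻¹ * G * H : symplecticGroup (T ⊕ T) F) :
        Matrix ((T ⊕ T) ⊕ (T ⊕ T)) ((T ⊕ T) ⊕ (T ⊕ T)) F)).toBlocks₁₁ =
        Matrix.fromBlocks 1 b c (1 + c * b) := by
  obtain ⟨ε, hε, E, E', iso, iso', pair, b, c, hbc⟩ := (isSympl_stdForm G).exists_block T (by
    simp; ring)
  have pair' : ∀ i j, stdForm (T ⊕ T) F (E' i) (E j) = if j = i then -1 else 0 := fun i j => by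
    rw [(isSympl_stdForm G).skew, pair]; split_ifs <;> simp
  let H : Matrix ((T ⊕ T) ⊕ (T ⊕ T)) ((T ⊕ T) ⊕ (T ⊕ T)) F := Matrix.of fun k d => Sum.elim E E' d k
  have key : ∀ (A : Matrix ((T ⊕ T) ⊕ (T ⊕ T)) ((T ⊕ T) ⊕ (T ⊕ T)) F) i j,
      (Hᵀ * Matrix.J (T ⊕ T) F * A) i j = - stdForm (T ⊕ T) F (Sum.elim E E' i) (A.col j) := by
    intro A i j
    rw [stdForm, Matrix.toBilin'_apply', Matrix.neg_mulVec, dotProduct_neg, neg_neg,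
      Matrix.mul_assoc, Matrix.mul_apply]
    rfl
  have hH : H ∈ symplecticGroup (T ⊕ T) F := by
    rw [SymplecticGroup.mem_iff']
    ext i j
    rw [key, show H.col j = Sum.elim E E' j from rfl]
    rcases i with i | i <;> rcases j with j | j <;>
      simp [Matrix.J, iso, iso', pair, pair', Matrix.one_apply, eq_comm]
    split_ifs <;> simp
  refine ⟨ε, hε, ⟨H, hH⟩, b, c, ?_⟩
  rw [← Matrix.ext_iff]
  intro i j
  have hJ : ∀ (A : Matrix ((T ⊕ T) ⊕ (T ⊕ T)) ((T ⊕ T) ⊕ (T ⊕ T)) F) i j,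
      (-Matrix.J (T ⊕ T) F * A) (.inl i) j = A (.inr i) j := by
    intro A i j
    simp [Matrix.J, Matrix.mul_apply, Fintype.sum_sum_type, Matrix.one_apply]
  rw [← hbc, Submonoid.coe_mul, Submonoid.coe_mul, SymplecticGroup.coe_inv, Matrix.mul_assoc,
    Matrix.mul_assoc, Matrix.mul_assoc, ← Matrix.mul_assoc Hᵀ]
  refine congrArg (ε * ·) ((hJ _ _ _).trans ((key _ _ _).trans ?_))
  rw [(isSympl_stdForm G).skew, neg_neg]
  rfl

end

section

open Matrix

variable {F : Type} [Field F] {m : Type} [Fintype m] [DecidableEq m]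

theorem fromBlocks_mem_symplecticGroup {A B C D : Matrix m m F} (h1 : Aᵀ * C = Cᵀ * A)
    (h2 : Bᵀ * D = Dᵀ * B) (h3 : Aᵀ * D - Cᵀ * B = 1) :
    Matrix.fromBlocks A B C D ∈ symplecticGroup m F := by
  have h4 := congrArg Matrix.transpose h3
  simp only [transpose_sub, transpose_mul, transpose_transpose, transpose_one] at h4
  rw [SymplecticGroup.mem_iff', Matrix.J, fromBlocks_transpose, fromBlocks_multiply,
    fromBlocks_multiply]
  congr 1
  · simp [h1]
  · simp only [mul_zero, mul_one, zero_add, mul_neg, add_zero, neg_mul]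
    rw [← h3]; abel
  · simp only [mul_zero, mul_one, zero_add, mul_neg, add_zero, neg_mul]
    rw [← h4]; abel
  · simp [h2]

/-- The Siegel Levi subgroup. -/
def levi : GL m F →* symplecticGroup m F where
  toFun A := ⟨Matrix.fromBlocks A 0 0 ((A⁻¹ : GL m F) : Matrix m m F)ᵀ,
    fromBlocks_mem_symplecticGroup (by simp) (by simp) (by
      rw [← Matrix.transpose_mul, Units.inv_mul]; simp)⟩
  map_one' := by
    ext1
    simp
  map_mul' A B := by
    ext1
    refine Eq.trans ?_ (fromBlocks_multiply _ _ _ _ _ _ _ _).symm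
    change Matrix.fromBlocks ((A : Matrix m m F) * (B : Matrix m m F)) 0 0
      (((B⁻¹ : GL m F) : Matrix m m F) * ((A⁻¹ : GL m F) : Matrix m m F))ᵀ = _
    rw [Matrix.transpose_mul]
    simp

theorem coe_levi (A : GL m F) : (levi A : Matrix (m ⊕ m) (m ⊕ m) F) =
    Matrix.fromBlocks A 0 0 ((A⁻¹ : GL m F) : Matrix m m F)ᵀ := rfl

/-- Lower unipotent elements. -/
def lower (S : Matrix m m F) (hS : Sᵀ = S) : symplecticGroup m F :=
  ⟨Matrix.fromBlocks 1 0 S 1, fromBlocks_mem_symplecticGroup (by simp [hS]) (by simp) (by simp)⟩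

/-- Upper unipotent elements. -/
def upper (S : Matrix m m F) (hS : Sᵀ = S) : symplecticGroup m F :=
  ⟨Matrix.fromBlocks 1 S 0 1, fromBlocks_mem_symplecticGroup (by simp) (by simp [hS]) (by simp)⟩

theorem coe_lower (S : Matrix m m F) (hS : Sᵀ = S) :
    (lower S hS : Matrix (m ⊕ m) (m ⊕ m) F) = Matrix.fromBlocks 1 0 S 1 := rfl

theorem coe_upper (S : Matrix m m F) (hS : Sᵀ = S) :
    (upper S hS : Matrix (m ⊕ m) (m ⊕ m) F) = Matrix.fromBlocks 1 S 0 1 := rfl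

theorem symplectic_blocks {A B C D : Matrix m m F}
    (h : Matrix.fromBlocks A B C D ∈ symplecticGroup m F) :
    Aᵀ * C = Cᵀ * A ∧ A * Bᵀ = B * Aᵀ ∧ Aᵀ * D - Cᵀ * B = 1 := by
  have h1 := SymplecticGroup.mem_iff'.1 h
  have h2 := SymplecticGroup.mem_iff.1 h
  simp only [Matrix.J, fromBlocks_transpose, fromBlocks_multiply, Matrix.fromBlocks_inj, mul_zero,
    mul_one, mul_neg, zero_add, add_zero, neg_mul] at h1 h2
  obtain ⟨a1, a2, a3, a4⟩ := h1
  obtain ⟨b1, b2, b3, b4⟩ := h2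
  refine ⟨?_, ?_, ?_⟩
  · rw [← sub_eq_zero, ← neg_eq_zero, ← a1]; abel
  · rw [← sub_eq_zero, ← neg_eq_zero, ← b1]; abel
  · rw [← neg_inj, ← a2]; abel

theorem exists_siegel_factorization (X : symplecticGroup m F) (A : GL m F)
    (hA : (X : Matrix (m ⊕ m) (m ⊕ m) F).toBlocks₁₁ = A) :
    ∃ S hS t ht, X = lower S hS * levi A * upper t ht := by
  obtain ⟨X, hX⟩ := X
  obtain ⟨A', B, C, D, rfl⟩ : ∃ A B C D : Matrix m m F, X = Matrix.fromBlocks A B C D :=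
    ⟨_, _, _, _, (fromBlocks_toBlocks X).symm⟩
  obtain rfl : A' = A := by simpa using hA
  obtain ⟨h1, h2, h3⟩ := symplectic_blocks hX
  have e1 : ((A⁻¹ : GL m F) : Matrix m m F) * A = 1 := A.inv_mul
  have e2 : (A : Matrix m m F) * ((A⁻¹ : GL m F) : Matrix m m F) = 1 := A.mul_inv
  set a : Matrix m m F := (A : Matrix m m F)
  set a' : Matrix m m F := ((A⁻¹ : GL m F) : Matrix m m F)
  have e3 : aᵀ * a'ᵀ = 1 := by rw [← Matrix.transpose_mul, e1, transpose_one]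
  have e4 : a'ᵀ * aᵀ = 1 := by rw [← Matrix.transpose_mul, e2, transpose_one]
  have hS : (C * a')ᵀ = C * a' := by
    calc (C * a')ᵀ = a'ᵀ * (Cᵀ * a) * a' := by
            rw [transpose_mul, Matrix.mul_assoc, Matrix.mul_assoc, e2, Matrix.mul_one]
      _ = C * a' := by rw [← h1, ← Matrix.mul_assoc, e4, Matrix.one_mul]
  have ht : (a' * B)ᵀ = a' * B := by
    calc (a' * B)ᵀ = a' * (a * Bᵀ) * a'ᵀ := by
            rw [transpose_mul, ← Matrix.mul_assoc, e1, Matrix.one_mul]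
      _ = a' * B := by rw [h2, Matrix.mul_assoc, Matrix.mul_assoc, e3, Matrix.mul_one]
  refine ⟨C * a', hS, a' * B, ht, ?_⟩
  ext1
  rw [Submonoid.coe_mul, Submonoid.coe_mul, coe_lower, coe_levi, coe_upper, fromBlocks_multiply,
    fromBlocks_multiply]
  change Matrix.fromBlocks a B C D = Matrix.fromBlocks ((1 * a + 0 * 0) * 1 + _) ((1 * a + 0 * 0) * (a' * B) + _)
    ((C * a' * a + _) * 1 + _) ((C * a' * a + 1 * 0) * (a' * B) + (C * a' * 0 + 1 * a'ᵀ) * 1)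
  congr 1
  · simp
  · rw [← Matrix.mul_assoc _ a' B]; simp [e2]
  · simp [Matrix.mul_assoc, e1]
  · calc D = a'ᵀ * (aᵀ * D - Cᵀ * B) + a'ᵀ * Cᵀ * B := by
          rw [Matrix.mul_sub, ← Matrix.mul_assoc, e4]; simp [Matrix.mul_assoc]
      _ = _ := by
          rw [h3, ← transpose_mul, hS]
          simp only [Matrix.mul_one, Matrix.one_mul, Matrix.mul_zero, add_zero, zero_add]
          rw [Matrix.mul_assoc C a' a, e1, Matrix.mul_one, Matrix.mul_assoc, add_comm]

theorem exists_transpose_mul_mul_sub (N R : Matrix m m F)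
    (hN : ∀ s : Matrix m m F, Nᵀ * s * N = s → s = 0) (hR : Rᵀ = R) :
    ∃ s : Matrix m m F, sᵀ = s ∧ Nᵀ * s * N - s = R := by
  let f : Matrix m m F →ₗ[F] Matrix m m F :=
    { toFun s := Nᵀ * s * N - s
      map_add' s t := by simp only [Matrix.mul_add, Matrix.add_mul]; abel
      map_smul' c s := by simp [smul_sub] }
  have hf : Function.Injective f := by
    rw [← LinearMap.ker_eq_bot, LinearMap.ker_eq_bot']
    exact fun s hs => hN s (sub_eq_zero.1 hs)
  obtain ⟨s, hs⟩ := LinearMap.surjective_of_injective hf R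
  refine ⟨s, hf ?_, hs⟩
  have := congrArg Matrix.transpose hs
  rw [hR, ← hs] at this
  simpa [f, Matrix.mul_assoc] using this

theorem exists_mul_sub_mul {T : Type} [Fintype T] [DecidableEq T] (A B R : Matrix T T F)
    (h : ∀ s : Matrix T T F, A * s = s * B → s = 0) : ∃ s : Matrix T T F, A * s - s * B = R := by
  let f : Matrix T T F →ₗ[F] Matrix T T F :=
    { toFun s := A * s - s * B
      map_add' s t := by simp only [Matrix.mul_add, Matrix.add_mul]; abel
      map_smul' c s := by simp [smul_sub] }
  have hf : Function.Injective f := by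
    rw [← LinearMap.ker_eq_bot, LinearMap.ker_eq_bot']
    exact fun s hs => h s (sub_eq_zero.1 hs)
  exact LinearMap.surjective_of_injective hf R

theorem isConj_lower_mul_levi (S : Matrix m m F) (hS : Sᵀ = S) (N : GL m F)
    (hN : ∀ s : Matrix m m F, (N : Matrix m m F)ᵀ * s * N = s → s = 0) :
    IsConj (levi N) (lower S hS * levi N) := by
  obtain ⟨s, hs, hsS⟩ := exists_transpose_mul_mul_sub (N : Matrix m m F)
    ((N : Matrix m m F)ᵀ * S * N) hN (by simp [Matrix.mul_assoc, hS])
  rw [isConj_iff]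
  refine ⟨lower s hs, ?_⟩
  rw [mul_inv_eq_iff_eq_mul]
  ext1
  simp only [Submonoid.coe_mul, coe_lower, coe_levi, fromBlocks_multiply]
  congr 1
  · simp
  · simp
  · have e3 : ((N⁻¹ : GL m F) : Matrix m m F)ᵀ * (N : Matrix m m F)ᵀ = 1 := by
      rw [← Matrix.transpose_mul, Units.mul_inv, transpose_one]
    simp only [Matrix.mul_one, Matrix.one_mul, Matrix.mul_zero, add_zero, zero_add]
    have := congrArg (((N⁻¹ : GL m F) : Matrix m m F)ᵀ * ·) hsS
    simp only [Matrix.mul_sub, ← Matrix.mul_assoc, e3, Matrix.one_mul] at this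
    rw [← this]; abel
  · simp

theorem isConj_upper_mul_levi (S : Matrix m m F) (hS : Sᵀ = S) (N : GL m F)
    (hN : ∀ s : Matrix m m F, (N : Matrix m m F) * s * (N : Matrix m m F)ᵀ = s → s = 0) :
    IsConj (levi N) (upper S hS * levi N) := by
  obtain ⟨s, hs, hsS⟩ := exists_transpose_mul_mul_sub ((N : Matrix m m F)ᵀ) (-S)
    (by simpa using hN) (by simp [hS])
  rw [isConj_iff]
  refine ⟨upper s hs, ?_⟩
  rw [mul_inv_eq_iff_eq_mul]
  ext1
  simp only [Submonoid.coe_mul, coe_upper, coe_levi, fromBlocks_multiply]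
  congr 1
  · simp
  · have e3 : (N : Matrix m m F)ᵀ * ((N⁻¹ : GL m F) : Matrix m m F)ᵀ = 1 := by
      rw [← Matrix.transpose_mul, Units.inv_mul, transpose_one]
    simp only [Matrix.mul_one, Matrix.one_mul, Matrix.mul_zero, add_zero, zero_add]
    have := congrArg (· * ((N⁻¹ : GL m F) : Matrix m m F)ᵀ) hsS
    simp only [Matrix.sub_mul, Matrix.mul_assoc, e3, Matrix.mul_one, transpose_transpose] at this
    rw [sub_eq_iff_eq_add] at this
    rw [this]; simp
  · simp
  · simp

end

section

theorem map_mem_wordImage {d : ℕ} {w : FreeGroup (Fin d)} {G H : Type*} [Group G] [Group H]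
    (f : G →* H) {x : G} (hx : x ∈ wordImage w G) : f x ∈ wordImage w H := by
  obtain ⟨v, rfl⟩ := hx
  refine ⟨f ∘ v, ?_⟩
  have : FreeGroup.lift (f ∘ v) = f.comp (FreeGroup.lift v) := by ext; simp
  exact DFunLike.congr_fun this w

theorem isConj_mem_wordImage {d : ℕ} {w : FreeGroup (Fin d)} {G : Type*} [Group G] {x y : G}
    (hx : x ∈ wordImage w G) (h : IsConj x y) : y ∈ wordImage w G := by
  obtain ⟨c, rfl⟩ := isConj_iff.1 h
  exact map_mem_wordImage (MulAut.conj c).toMonoidHom hx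

open Matrix

variable {F : Type} [Field F] {m : Type} [Fintype m] [DecidableEq m]
  {T : Type} [Fintype T] [DecidableEq T]

/-- Lower block unipotent matrices. -/
def lowerGL (s : Matrix T T F) : GL (T ⊕ T) F where
  val := Matrix.fromBlocks 1 0 s 1
  inv := Matrix.fromBlocks 1 0 (-s) 1
  val_inv := by simp [fromBlocks_multiply]
  inv_val := by simp [fromBlocks_multiply]

/-- Upper block unipotent matrices. -/
def upperGL (s : Matrix T T F) : GL (T ⊕ T) F where
  val := Matrix.fromBlocks 1 s 0 1
  inv := Matrix.fromBlocks 1 (-s) 0 1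
  val_inv := by simp [fromBlocks_multiply]
  inv_val := by simp [fromBlocks_multiply]

theorem isConj_lowerGL_mul {M : GL (T ⊕ T) F} {M1 M2 : Matrix T T F}
    (hM : (M : Matrix (T ⊕ T) (T ⊕ T) F) = Matrix.fromBlocks M1 0 0 M2)
    (h : ∀ s : Matrix T T F, M2 * s = s * M1 → s = 0) (c : Matrix T T F) :
    IsConj M (lowerGL c * M) := by
  obtain ⟨s, hs⟩ := exists_mul_sub_mul M2 M1 (-(c * M1)) h
  refine isConj_iff.2 ⟨lowerGL s, ?_⟩
  rw [mul_inv_eq_iff_eq_mul]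
  ext1
  simp only [Units.val_mul, hM, lowerGL, fromBlocks_multiply]
  congr 1
  · simp
  · simp
  · simp only [Matrix.mul_one, Matrix.one_mul, Matrix.mul_zero, add_zero, zero_add]
    rw [sub_eq_iff_eq_add] at hs
    rw [hs]; abel
  · simp

theorem isConj_of_upperGL_mul {M P : GL (T ⊕ T) F} {M1 M2 : Matrix T T F}
    (hM : (M : Matrix (T ⊕ T) (T ⊕ T) F) = Matrix.fromBlocks M1 0 0 M2)
    (h : ∀ s : Matrix T T F, M1 * s = s * M2 → s = 0) (b : Matrix T T F)
    (hP : upperGL b * P = M) : IsConj M P := by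
  obtain ⟨s, hs⟩ := exists_mul_sub_mul M1 M2 (b * M2) h
  refine isConj_iff.2 ⟨upperGL s, ?_⟩
  rw [mul_inv_eq_iff_eq_mul, ← mul_right_inj (upperGL b), ← mul_assoc (upperGL b) P, hP]
  ext1
  simp only [Units.val_mul, hM, upperGL, fromBlocks_multiply]
  congr 1
  · simp
  · simp only [Matrix.mul_one, Matrix.one_mul, Matrix.mul_zero, add_zero, zero_add]
    rw [sub_eq_iff_eq_add] at hs
    rw [hs, add_comm]
  · simp
  · simp

theorem eq_zero_of_transpose_mul_mul_eq {M N : GL m F} (h : IsConj M N)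
    (hM : ∀ s : Matrix m m F, (M : Matrix m m F)ᵀ * s * M = s → s = 0) (s : Matrix m m F)
    (hs : (N : Matrix m m F)ᵀ * s * N = s) : s = 0 := by
  obtain ⟨q, hq⟩ := isConj_iff.1 h
  have hq1 : (q : Matrix m m F) * M = N * q := by
    rw [← Units.val_mul, ← Units.val_mul, ← hq]; simp
  have hq2 : (M : Matrix m m F)ᵀ * (q : Matrix m m F)ᵀ = (q : Matrix m m F)ᵀ * (N : Matrix m m F)ᵀ := by
    rw [← transpose_mul, ← transpose_mul, hq1]
  have h0 : (q : Matrix m m F)ᵀ * s * (q : Matrix m m F) = 0 := by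
    apply hM
    calc _ = ((M : Matrix m m F)ᵀ * (q : Matrix m m F)ᵀ) * s * (q * M) := by
          simp only [Matrix.mul_assoc]
      _ = (q : Matrix m m F)ᵀ * ((N : Matrix m m F)ᵀ * s * N) * q := by
          rw [hq1, hq2]; simp only [Matrix.mul_assoc]
      _ = _ := by rw [hs]
  have e1 : (q : Matrix m m F) * ((q⁻¹ : GL m F) : Matrix m m F) = 1 := Units.mul_inv q
  have e2 : ((q⁻¹ : GL m F) : Matrix m m F)ᵀ * (q : Matrix m m F)ᵀ = 1 := by
    rw [← transpose_mul, e1, transpose_one]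
  calc s = (((q⁻¹ : GL m F) : Matrix m m F)ᵀ * (q : Matrix m m F)ᵀ) * s *
        ((q : Matrix m m F) * ((q⁻¹ : GL m F) : Matrix m m F)) := by
        rw [e1, e2, Matrix.one_mul, Matrix.mul_one]
    _ = ((q⁻¹ : GL m F) : Matrix m m F)ᵀ * ((q : Matrix m m F)ᵀ * s * (q : Matrix m m F)) *
        ((q⁻¹ : GL m F) : Matrix m m F) := by simp only [Matrix.mul_assoc]
    _ = 0 := by rw [h0, Matrix.mul_zero, Matrix.zero_mul]

theorem eq_zero_of_mul_mul_transpose_eq {M N : GL m F} (h : IsConj M N)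
    (hM : ∀ s : Matrix m m F, (M : Matrix m m F) * s * (M : Matrix m m F)ᵀ = s → s = 0)
    (s : Matrix m m F) (hs : (N : Matrix m m F) * s * (N : Matrix m m F)ᵀ = s) : s = 0 := by
  obtain ⟨q, hq⟩ := isConj_iff.1 h.symm
  have hq1 : (q : Matrix m m F) * N = M * q := by
    rw [← Units.val_mul, ← Units.val_mul, ← hq]; simp
  have hq2 : (N : Matrix m m F)ᵀ * (q : Matrix m m F)ᵀ = (q : Matrix m m F)ᵀ * (M : Matrix m m F)ᵀ := by
    rw [← transpose_mul, ← transpose_mul, hq1]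
  have h0 : (q : Matrix m m F) * s * (q : Matrix m m F)ᵀ = 0 := by
    apply hM
    calc _ = ((M : Matrix m m F) * (q : Matrix m m F)) * s *
          ((q : Matrix m m F)ᵀ * (M : Matrix m m F)ᵀ) := by
          simp only [Matrix.mul_assoc]
      _ = (q : Matrix m m F) * ((N : Matrix m m F) * s * (N : Matrix m m F)ᵀ) *
          (q : Matrix m m F)ᵀ := by
          rw [← hq1, ← hq2]; simp only [Matrix.mul_assoc]
      _ = _ := by rw [hs]
  have e1 : ((q⁻¹ : GL m F) : Matrix m m F) * (q : Matrix m m F) = 1 := Units.inv_mul q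
  have e2 : (q : Matrix m m F)ᵀ * ((q⁻¹ : GL m F) : Matrix m m F)ᵀ = 1 := by
    rw [← transpose_mul, e1, transpose_one]
  calc s = (((q⁻¹ : GL m F) : Matrix m m F) * (q : Matrix m m F)) * s *
        ((q : Matrix m m F)ᵀ * ((q⁻¹ : GL m F) : Matrix m m F)ᵀ) := by
        rw [e1, e2, Matrix.one_mul, Matrix.mul_one]
    _ = ((q⁻¹ : GL m F) : Matrix m m F) * ((q : Matrix m m F) * s * (q : Matrix m m F)ᵀ) *
        ((q⁻¹ : GL m F) : Matrix m m F)ᵀ := by simp only [Matrix.mul_assoc]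
    _ = 0 := by rw [h0, Matrix.mul_zero, Matrix.zero_mul]

theorem coe_levi_neg_one :
    (levi (-1 : GL m F) : Matrix (m ⊕ m) (m ⊕ m) F) = -1 := by
  rw [coe_levi, inv_neg, inv_one, Units.val_neg, Units.val_one, transpose_neg, transpose_one,
    ← fromBlocks_one, fromBlocks_neg]
  simp

theorem exists_sign {ε : F} (hε : ε = 1 ∨ ε = -1) :
    ∃ e : GL m F, (e = 1 ∨ e = -1) ∧ (∀ X, levi e * X = X * levi e) ∧
      ∀ X : symplecticGroup m F, ((levi e * X : symplecticGroup m F) :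
        Matrix (m ⊕ m) (m ⊕ m) F) = ε • (X : Matrix (m ⊕ m) (m ⊕ m) F) := by
  rcases hε with rfl | rfl
  · exact ⟨1, .inl rfl, by simp, by simp⟩
  · refine ⟨-1, .inr rfl, fun X => ?_, fun X => ?_⟩
    · ext1
      rw [Submonoid.coe_mul, Submonoid.coe_mul, coe_levi_neg_one, neg_one_mul, mul_neg_one]
    · rw [Submonoid.coe_mul, coe_levi_neg_one, neg_smul, one_smul, neg_one_mul]

theorem eq_conj_mul_conj {G : Type*} [Group G] {z H g x y : G} (hz : ∀ X, z * X = X * z)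
    (h : z * (H⁻¹ * g * H) = x * y) : g = (H * x * H⁻¹) * (H * (z⁻¹ * y) * H⁻¹) := by
  have h1 : x * z⁻¹ = z⁻¹ * x := by rw [mul_inv_eq_iff_eq_mul, mul_assoc, ← hz, inv_mul_cancel_left]
  calc g = H * (z⁻¹ * (z * (H⁻¹ * g * H))) * H⁻¹ := by group
    _ = H * (x * z⁻¹ * y) * H⁻¹ := by rw [h, h1, mul_assoc z⁻¹]
    _ = _ := by group

/-- If `M` is block diagonal, without resonances, and takes suitable word values, then every
symplectic matrix is a product of word values. -/
theorem exists_mul_eq {d1 d2 : ℕ} {w1 : FreeGroup (Fin d1)} {w2 : FreeGroup (Fin d2)}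
    {M : GL (T ⊕ T) F} {M1 M2 : Matrix T T F}
    (hM : (M : Matrix (T ⊕ T) (T ⊕ T) F) = Matrix.fromBlocks M1 0 0 M2)
    (h12 : ∀ s : Matrix T T F, M1 * s = s * M2 → s = 0)
    (h21 : ∀ s : Matrix T T F, M2 * s = s * M1 → s = 0)
    (hlow : ∀ s : Matrix (T ⊕ T) (T ⊕ T) F,
      (M : Matrix (T ⊕ T) (T ⊕ T) F)ᵀ * s * M = s → s = 0)
    (hup : ∀ s : Matrix (T ⊕ T) (T ⊕ T) F,
      (M : Matrix (T ⊕ T) (T ⊕ T) F) * s * (M : Matrix (T ⊕ T) (T ⊕ T) F)ᵀ = s → s = 0)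
    (h1 : M ∈ wordImage w1 (GL (T ⊕ T) F)) (h2 : M⁻¹ ∈ wordImage w2 (GL (T ⊕ T) F))
    (h3 : -M⁻¹ ∈ wordImage w2 (GL (T ⊕ T) F)) (g : symplecticGroup (T ⊕ T) F) :
    ∃ a ∈ wordImage w1 (symplecticGroup (T ⊕ T) F),
      ∃ b ∈ wordImage w2 (symplecticGroup (T ⊕ T) F), g = a * b := by
  obtain ⟨ε, hε, H, b, c, hbc⟩ := exists_conj_block g
  obtain ⟨e, he, hcomm, hcoe⟩ := exists_sign (m := T ⊕ T) hε
  have heM : e⁻¹ * M⁻¹ ∈ wordImage w2 (GL (T ⊕ T) F) := by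
    rcases he with rfl | rfl
    · rwa [inv_one, one_mul]
    · rwa [inv_neg, inv_one, neg_one_mul]
  obtain ⟨S, hS, t, ht, hX⟩ := exists_siegel_factorization (levi e * (H⁻¹ * g * H))
    (lowerGL c * upperGL b) (by
      rw [hcoe, hbc, Units.val_mul, lowerGL, upperGL, fromBlocks_multiply]
      simp [add_comm])
  have ht' : (-t)ᵀ = -t := by rw [transpose_neg, ht]
  obtain ⟨P, hP⟩ : ∃ P, upperGL b * P = M := ⟨(upperGL b)⁻¹ * M, mul_inv_cancel_left _ _⟩
  have c1 := isConj_lowerGL_mul hM h21 c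
  have c2 := isConj_of_upperGL_mul hM h12 b hP
  have c3 : IsConj (levi M) (lower S hS * levi (lowerGL c * M)) :=
    (levi.map_isConj c1).trans (isConj_lower_mul_levi S hS _ (eq_zero_of_transpose_mul_mul_eq c1 hlow))
  have c4 : IsConj (levi M) (upper (-t) ht' * levi P) :=
    (levi.map_isConj c2).trans (isConj_upper_mul_levi (-t) ht' _ (eq_zero_of_mul_mul_transpose_eq c2 hup))
  have hut : upper t ht = (upper (-t) ht')⁻¹ := by
    rw [eq_inv_iff_mul_eq_one]
    ext1
    simp [coe_upper, fromBlocks_multiply]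
  have m1 := isConj_mem_wordImage (map_mem_wordImage levi h1) c3
  have m2 : (levi e)⁻¹ * (upper (-t) ht' * levi P)⁻¹ ∈
      wordImage w2 (symplecticGroup (T ⊕ T) F) := by
    refine isConj_mem_wordImage (map_mem_wordImage levi heM) ?_
    obtain ⟨k, hk⟩ := isConj_iff.1 c4
    refine isConj_iff.2 ⟨k, ?_⟩
    have hci : (levi e)⁻¹ * k = k * (levi e)⁻¹ := by
      rw [eq_mul_inv_iff_mul_eq, mul_assoc, ← hcomm, inv_mul_cancel_left]
    rw [← hk, map_mul, map_inv, map_inv, ← mul_assoc k, ← hci]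
    group
  have hX' : levi e * (H⁻¹ * g * H) =
      lower S hS * levi (lowerGL c * M) * (upper (-t) ht' * levi P)⁻¹ := by
    rw [hX, ← hP, map_mul, map_mul, map_mul, hut, _root_.mul_inv_rev]
    group
  exact ⟨_, isConj_mem_wordImage m1 (isConj_iff.2 ⟨H, rfl⟩), _,
    isConj_mem_wordImage m2 (isConj_iff.2 ⟨H, rfl⟩), eq_conj_mul_conj hcomm hX'⟩

end

section Magnus

/-- The unipotent elements `1 + n • N` for `N * N = 0`. -/
def unipotentHom {S : Type*} [Ring S] (N : S) (hN : N * N = 0) : Multiplicative ℤ →* Sˣ :=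
  MonoidHom.toHomUnits
    { toFun n := 1 + (n.toAdd : ℤ) • N
      map_one' := by simp
      map_mul' a b := by
        rw [mul_add, add_mul, add_mul, smul_mul_smul_comm, hN, toAdd_mul, add_smul]
        simp [add_assoc] }

theorem unipotentHom_apply {S : Type*} [Ring S] (N : S) (hN : N * N = 0) (n : Multiplicative ℤ) :
    (unipotentHom N hN n : S) = 1 + n.toAdd • N := rfl

variable {d : ℕ} (R : Type) [CommRing R] (a : ℕ → Option (Fin d))

/-- The weighted shift attached to the letter `i`. -/
def shiftOp (i : Fin d) : Module.End R (ℕ → R) where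
  toFun y l := Nat.casesOn l 0 fun k => if a k = some i then y k else 0
  map_add' y z := by
    ext (_ | k)
    · simp
    · by_cases h : a k = some i <;> simp [h]
  map_smul' c y := by
    ext (_ | k)
    · simp
    · by_cases h : a k = some i <;> simp [h]

theorem shiftOp_zero (i : Fin d) (y : ℕ → R) : shiftOp R a i y 0 = 0 := rfl

theorem shiftOp_succ (i : Fin d) (y : ℕ → R) (k : ℕ) :
    shiftOp R a i y (k + 1) = if a k = some i then y k else 0 := rfl

variable {a} (ha : ∀ l i, a l = some i → a (l + 1) ≠ some i)

include ha in
theorem shiftOp_mul_self (i : Fin d) : shiftOp R a i * shiftOp R a i = 0 := by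
  refine LinearMap.ext fun y => ?_
  ext (_ | _ | k)
  · rfl
  · rw [Module.End.mul_apply, shiftOp_succ, shiftOp_zero]; simp
  · rw [Module.End.mul_apply, shiftOp_succ, shiftOp_succ]
    split_ifs with h1 h2
    · exact absurd h1 (ha _ _ h2)
    · rfl
    · rfl

/-- The Magnus type representation attached to a sequence of letters. -/
def magnus : FreeGroup (Fin d) →* (Module.End R (ℕ → R))ˣ :=
  FreeGroup.lift fun i => unipotentHom (shiftOp R a i) (shiftOp_mul_self R ha i) (.ofAdd 1)

theorem magnus_of_zpow (i : Fin d) (n : ℤ) (y : ℕ → R) :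
    (magnus R ha (FreeGroup.of i ^ n) : Module.End R (ℕ → R)) y = y + n • shiftOp R a i y := by
  rw [map_zpow, magnus, FreeGroup.lift_apply_of, ← map_zpow, unipotentHom_apply]
  simp

theorem magnus_mul (γ δ : FreeGroup (Fin d)) (y : ℕ → R) :
    (magnus R ha (γ * δ) : Module.End R (ℕ → R)) y =
      (magnus R ha γ : Module.End R (ℕ → R)) ((magnus R ha δ : Module.End R (ℕ → R)) y) := by
  rw [map_mul]; rfl

theorem magnus_inv (γ : FreeGroup (Fin d)) (y : ℕ → R) :
    (magnus R ha γ : Module.End R (ℕ → R)) ((magnus R ha γ⁻¹ : Module.End R (ℕ → R)) y) = y := by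
  rw [← magnus_mul, mul_inv_cancel, map_one]; rfl

theorem magnus_inv' (γ : FreeGroup (Fin d)) (y : ℕ → R) :
    (magnus R ha γ⁻¹ : Module.End R (ℕ → R)) ((magnus R ha γ : Module.End R (ℕ → R)) y) = y := by
  rw [← magnus_mul, inv_mul_cancel, map_one]; rfl

theorem magnus_induction {P : FreeGroup (Fin d) → Prop} (h1 : P 1)
    (hg : ∀ i, P (FreeGroup.of i)) (hi : ∀ γ, P γ → P γ⁻¹) (hm : ∀ γ δ, P γ → P δ → P (γ * δ))
    (γ : FreeGroup (Fin d)) : P γ :=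
  FreeGroup.induction_on γ h1 hg (fun _ h => hi _ h) hm

theorem magnus_apply_zero (γ : FreeGroup (Fin d)) (y : ℕ → R) :
    (magnus R ha γ : Module.End R (ℕ → R)) y 0 = y 0 := by
  induction γ using magnus_induction generalizing y with
  | h1 => simp
  | hg i =>
    have := magnus_of_zpow R ha i 1 y
    rw [zpow_one] at this
    rw [this]; simp [shiftOp_zero]
  | hi γ h =>
    have h2 := h ((magnus R ha γ⁻¹ : Module.End R (ℕ → R)) y)
    rw [magnus_inv] at h2
    exact h2.symm
  | hm γ δ h1 h2 => rw [magnus_mul, h1, h2]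

theorem shiftOp_tail (i : Fin d) (y : ℕ → R) (h0 : y 0 = 0) :
    (fun l => shiftOp R a i y (l + 1)) = shiftOp R (fun l => a (l + 1)) i fun l => y (l + 1) := by
  ext (_ | l)
  · simp [shiftOp_succ, h0, shiftOp_zero]
  · rfl

/-- On sequences starting with `0` the representation is compatible with shifting. -/
theorem magnus_tail (γ : FreeGroup (Fin d)) (y : ℕ → R) (h0 : y 0 = 0) :
    (fun l => (magnus R ha γ : Module.End R (ℕ → R)) y (l + 1)) =
      (magnus R (a := fun l => a (l + 1)) (fun l => ha (l + 1)) γ : Module.End R (ℕ → R))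
        fun l => y (l + 1) := by
  induction γ using magnus_induction generalizing y with
  | h1 => simp
  | hg i =>
    have h1 := magnus_of_zpow R ha i 1 y
    have h2 := magnus_of_zpow R (a := fun l => a (l + 1)) (fun l => ha (l + 1)) i 1
      fun l => y (l + 1)
    rw [zpow_one, one_smul] at h1 h2
    rw [h1, h2, ← shiftOp_tail R i y h0]; rfl
  | hi γ h =>
    have h3 := h ((magnus R ha γ⁻¹ : Module.End R (ℕ → R)) y) (by rw [magnus_apply_zero, h0])
    rw [magnus_inv] at h3
    rw [h3, magnus_inv']
  | hm γ δ h1 h2 =>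
    rw [magnus_mul, magnus_mul, ← h2 y h0, ← h1 _ (by rw [magnus_apply_zero, h0])]

variable {R} in
theorem magnus_natural {S : Type} [CommRing S] (f : R →+* S) (γ : FreeGroup (Fin d))
    (y : ℕ → R) : (magnus S ha γ : Module.End S (ℕ → S)) (f ∘ y) =
      f ∘ (magnus R ha γ : Module.End R (ℕ → R)) y := by
  induction γ using magnus_induction generalizing y with
  | h1 => simp
  | hg i =>
    have h1 := magnus_of_zpow R ha i 1 y
    have h2 := magnus_of_zpow S ha i 1 (f ∘ y)
    rw [zpow_one, one_smul] at h1 h2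
    rw [h1, h2]
    ext (_ | l)
    · simp [shiftOp_zero]
    · simp only [Pi.add_apply, Function.comp_apply, shiftOp_succ, map_add]
      split_ifs <;> simp
  | hi γ h =>
    have h3 := h ((magnus R ha γ⁻¹ : Module.End R (ℕ → R)) y)
    rw [magnus_inv] at h3
    rw [← h3, magnus_inv']
  | hm γ δ h1 h2 => rw [magnus_mul, magnus_mul, h2, h1]

end Magnus

section Syllables

variable {d : ℕ}

/-- The product of a list of syllables. -/
def syllProd (L : List (Fin d × ℤ)) : FreeGroup (Fin d) :=
  (L.map fun s => FreeGroup.of s.1 ^ s.2).prod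

theorem syllProd_cons (s : Fin d × ℤ) (L : List (Fin d × ℤ)) :
    syllProd (s :: L) = FreeGroup.of s.1 ^ s.2 * syllProd L := by
  simp [syllProd]

theorem exists_syllables (w : FreeGroup (Fin d)) :
    ∃ L : List (Fin d × ℤ), L.IsChain (fun s s' => s.1 ≠ s'.1) ∧ (∀ s ∈ L, s.2 ≠ 0) ∧
      syllProd L = w := by
  induction w using FreeGroup.induction_on with
  | C1 => exact ⟨[], by simp, by simp, rfl⟩
  | of i => exact ⟨[(i, 1)], by simp, by simp, by simp [syllProd]⟩
  | inv_of i h => exact ⟨[(i, -1)], by simp, by simp, by simp [syllProd]⟩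
  | mul x y hx hy =>
    obtain ⟨L, -, -, rfl⟩ := hx
    induction L with
    | nil => simpa [syllProd] using hy
    | cons s L ih =>
      obtain ⟨L', hc, h0, hL⟩ := ih
      rw [syllProd_cons, mul_assoc, ← hL]
      obtain ⟨i, n⟩ := s
      by_cases hn : n = 0
      · exact ⟨L', hc, h0, by simp [hn]⟩
      rcases L' with _ | ⟨⟨j, m⟩, L'⟩
      · exact ⟨[(i, n)], by simp, by simp [hn], by simp [syllProd]⟩
      by_cases hij : i = j
      · subst hij
        by_cases hnm : n + m = 0
        · refine ⟨L', hc.tail, fun s hs => h0 s (by simp [hs]), ?_⟩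
          rw [syllProd_cons, ← mul_assoc, ← zpow_add, hnm]
          simp
        · refine ⟨(i, n + m) :: L', ?_, ?_, ?_⟩
          · rw [List.isChain_cons] at hc ⊢
            exact hc
          · intro s hs
            rcases List.mem_cons.1 hs with rfl | hs
            · exact hnm
            · exact h0 s (by simp [hs])
          · rw [syllProd_cons, syllProd_cons, ← mul_assoc, ← zpow_add]
      · refine ⟨(i, n) :: (j, m) :: L', ?_, ?_, ?_⟩
        · rw [List.isChain_cons_cons]
          exact ⟨hij, hc⟩
        · intro s hs
          rcases List.mem_cons.1 hs with rfl | hs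
          · exact hn
          · exact h0 s hs
        · rw [syllProd_cons]

/-- The letters of a list of syllables, numbered from the right. -/
def letterAt : List (Fin d × ℤ) → ℕ → Option (Fin d)
  | [], _ => none
  | s :: L, l => if l = L.length then some s.1 else letterAt L l

theorem letterAt_eq_none (L : List (Fin d × ℤ)) (l : ℕ) (h : L.length ≤ l) :
    letterAt L l = none := by
  induction L with
  | nil => rfl
  | cons s L ih =>
    simp only [List.length_cons] at h
    rw [letterAt, if_neg (by omega), ih (by omega)]

theorem letterAt_ne (L : List (Fin d × ℤ)) (hL : L.IsChain (fun s s' => s.1 ≠ s'.1)) (l : ℕ)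
    (i : Fin d) (h : letterAt L l = some i) : letterAt L (l + 1) ≠ some i := by
  induction L with
  | nil => simp [letterAt]
  | cons s L ih =>
    rw [letterAt]
    split_ifs with h1
    · rcases L with _ | ⟨s', L⟩
      · simp at h1
      · simp only [List.length_cons, Nat.add_right_cancel_iff] at h1
        rw [letterAt, if_neg (by simp [h1]), letterAt, if_pos h1] at h
        rw [List.isChain_cons_cons] at hL
        intro h2
        exact hL.1 (Option.some_inj.1 (h2.trans h.symm))
    · by_cases h2 : l = L.length
      · rw [letterAt_eq_none L _ (by omega)]; simp
      · rw [letterAt, if_neg h2] at h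
        exact ih hL.tail h

theorem magnus_syllProd {a : ℕ → Option (Fin d)} (ha : ∀ l i, a l = some i → a (l + 1) ≠ some i)
    (L : List (Fin d × ℤ)) (h : ∀ l < L.length, a l = letterAt L l) :
    (magnus ℤ ha (syllProd L) : Module.End ℤ (ℕ → ℤ)) (Pi.single 0 1) L.length =
      (L.map Prod.snd).prod ∧
    ∀ l, L.length < l →
      (magnus ℤ ha (syllProd L) : Module.End ℤ (ℕ → ℤ)) (Pi.single 0 1) l = 0 := by
  induction L with
  | nil =>
    refine ⟨by simp [syllProd], fun l hl => ?_⟩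
    simp only [syllProd, List.map_nil, List.prod_nil, map_one]
    simp at hl
    simp [hl.ne']
  | cons s L ih =>
    obtain ⟨h1, h2⟩ := ih fun l hl => by
      rw [h l (by simp; omega), letterAt, if_neg hl.ne]
    rw [syllProd_cons, magnus_mul, magnus_of_zpow]
    constructor
    · have h3 := h L.length (by simp)
      rw [letterAt, if_pos rfl] at h3
      simp only [List.length_cons, Pi.add_apply, Pi.smul_apply, shiftOp_succ, h3, if_true, h1,
        List.map_cons, List.prod_cons, h2 _ (Nat.lt_succ_self _), smul_eq_mul, zero_add]
    · intro l hl
      simp only [List.length_cons] at hl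
      obtain ⟨k, rfl⟩ : ∃ k, l = k + 1 := ⟨l - 1, by omega⟩
      simp only [Pi.add_apply, Pi.smul_apply, shiftOp_succ, h2 (k + 1) (by omega),
        h2 k (by omega), ite_self, smul_zero, add_zero]

/-- For every non-trivial word there is a representation in which it acts as a non-trivial
translation of one coordinate and trivially on all earlier ones. -/
theorem exists_magnus {w : FreeGroup (Fin d)} (hw : w ≠ 1) :
    ∃ (m : ℕ) (κ : ℤ) (a : ℕ → Option (Fin d)) (ha : ∀ l i, a l = some i → a (l + 1) ≠ some i),
      κ ≠ 0 ∧ ∀ y : ℕ → ℤ,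
        (∀ l ≤ m, (magnus ℤ ha w : Module.End ℤ (ℕ → ℤ)) y l = y l) ∧
        (magnus ℤ ha w : Module.End ℤ (ℕ → ℤ)) y (m + 1) = y (m + 1) + κ * y 0 := by
  classical
  have hex : ∃ c : ℕ, ∃ (a : ℕ → Option (Fin d))
      (ha : ∀ l i, a l = some i → a (l + 1) ≠ some i) (y : ℕ → ℤ),
      (magnus ℤ ha w : Module.End ℤ (ℕ → ℤ)) y c ≠ y c := by
    obtain ⟨L, hc, h0, rfl⟩ := exists_syllables w
    refine ⟨L.length, letterAt L, letterAt_ne L hc, Pi.single 0 1, ?_⟩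
    rw [(magnus_syllProd _ L fun _ _ => rfl).1, Pi.single_eq_of_ne]
    · rw [ne_eq, List.prod_eq_zero_iff]
      simp only [List.mem_map, not_exists, not_and]
      exact h0
    · rw [ne_eq, List.length_eq_zero_iff]
      rintro rfl
      exact hw rfl
  obtain ⟨a, ha, y, hy⟩ := Nat.find_spec hex
  have hmin : ∀ c < Nat.find hex, ∀ (a : ℕ → Option (Fin d))
      (ha : ∀ l i, a l = some i → a (l + 1) ≠ some i) (y : ℕ → ℤ),
      (magnus ℤ ha w : Module.End ℤ (ℕ → ℤ)) y c = y c := fun c hc a ha y => by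
    by_contra h
    exact Nat.find_min hex hc ⟨a, ha, y, h⟩
  obtain ⟨m, hm⟩ : ∃ m, Nat.find hex = m + 1 := by
    refine Nat.exists_eq_succ_of_ne_zero fun h => hy ?_
    rw [h, magnus_apply_zero]
  rw [hm] at hy hmin
  let κ : ℤ := (magnus ℤ ha w : Module.End ℤ (ℕ → ℤ)) (Pi.single 0 1) (m + 1)
  have key : ∀ y : ℕ → ℤ,
      (magnus ℤ ha w : Module.End ℤ (ℕ → ℤ)) y (m + 1) = y (m + 1) + κ * y 0 := by
    intro y
    have hy' : y = y 0 • Pi.single 0 1 + (y - y 0 • Pi.single 0 1) := by abel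
    have h1 := congrFun (magnus_tail ℤ ha w (y - y 0 • Pi.single 0 1) (by simp)) m
    rw [hmin m (Nat.lt_succ_self _)] at h1
    conv_lhs => rw [hy', map_add, map_smul, Pi.add_apply, h1]
    simp [κ]
    ring
  refine ⟨m, κ, a, ha, fun h => hy ?_, fun y => ⟨fun l hl => hmin l (by omega) a ha y, key y⟩⟩
  rw [key, h]
  simp

end Syllables

section Blocks

variable (F I V : Type) [Field F] [AddCommGroup V] [Module F V]

/-- Block diagonal operators on a power of `V`. -/
def blockUnit : (I → (Module.End F V)ˣ) →* (Module.End F (I → V))ˣ :=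
  MonoidHom.toHomUnits
    { toFun f := LinearMap.pi fun i => (f i : Module.End F V) ∘ₗ LinearMap.proj i
      map_one' := by ext; simp
      map_mul' f g := by ext; simp }

/-- Permutation of the blocks of a power of `V`. -/
def permUnit : Equiv.Perm I →* (Module.End F (I → V))ˣ :=
  MonoidHom.toHomUnits
    { toFun π := LinearMap.funLeft F V (π⁻¹ : Equiv.Perm I)
      map_one' := by ext; simp
      map_mul' f g := by ext; simp }

variable {F I V}

theorem blockUnit_apply (f : I → (Module.End F V)ˣ) (x : I → V) (i : I) :
    (blockUnit F I V f : Module.End F (I → V)) x i = (f i : Module.End F V) (x i) := rfl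

theorem permUnit_apply (π : Equiv.Perm I) (x : I → V) (i : I) :
    (permUnit F I V π : Module.End F (I → V)) x i = x (π⁻¹ i) := rfl

theorem blockUnit_mul_permUnit (f : I → (Module.End F V)ˣ) (π : Equiv.Perm I) :
    blockUnit F I V f * permUnit F I V π = permUnit F I V π * blockUnit F I V (f ∘ π) := by
  refine Units.ext (LinearMap.ext fun x => funext fun i => ?_)
  simp only [Units.val_mul, Module.End.mul_apply, blockUnit_apply, permUnit_apply,
    Function.comp_apply, Equiv.Perm.inv_def, Equiv.apply_symm_apply]

end Blocks

section Exponents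

variable {d : ℕ} {a : ℕ → Option (Fin d)} (ha : ∀ l i, a l = some i → a (l + 1) ≠ some i)
  (m : ℕ) {R : Type} [CommRing R]

/-- The sequence starting with `1` and continuing with the entries of `u`. -/
def extendOne {m : ℕ} (u : Fin m → R) (l : ℕ) : R :=
  Nat.casesOn l 1 fun k => if h : k < m then u ⟨k, h⟩ else 0

variable (a) in
/-- The increment of coordinate `k + 1` under the letter `i`. -/
def increment {m : ℕ} (i : Fin d) (u : Fin m → R) (k : ℕ) : R :=
  if a k = some i then extendOne u k else 0

theorem extendOne_eq {m : ℕ} (y : ℕ → R) (h0 : y 0 = 1) (l : ℕ) (hl : l ≤ m) :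
    extendOne (fun k : Fin m => y (k + 1)) l = y l := by
  rcases l with _ | l
  · exact h0.symm
  · exact dif_pos (by omega)

include ha in
theorem increment_congr {m : ℕ} (i : Fin d) (u v : Fin m → R)
    (huv : ∀ k : Fin m, a k ≠ some i → u k = v k) (k : ℕ) :
    increment a i u k = increment a i v k := by
  unfold increment
  split_ifs with h
  · rcases k with _ | k
    · rfl
    · change dite _ _ _ = dite _ _ _
      split_ifs with hk
      · exact huv ⟨k, hk⟩ fun h' => ha _ _ h' h
      · rfl
  · rfl

/-- The permutation of initial segments induced by the letter `i`. -/
def letterPerm (i : Fin d) : Equiv.Perm (Fin m → R) where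
  toFun u k := u k + increment a i u k
  invFun u k := u k - increment a i u k
  left_inv u := by
    ext k
    change u k + _ - _ = u k
    rw [increment_congr ha i (fun k : Fin m => u k + increment a i u k) u]
    · ring
    · intro k hk
      simp [increment, hk]
  right_inv u := by
    ext k
    change u k - _ + _ = u k
    rw [increment_congr ha i (fun k : Fin m => u k - increment a i u k) u]
    · ring
    · intro k hk
      simp [increment, hk]

/-- The monomial representation of the free group attached to an operator `Λ`. -/
def monomialRep (t : ℕ) {F V : Type} [Field F] [AddCommGroup V] [Module F V]
    (Λ : (Module.End F V)ˣ) :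
    FreeGroup (Fin d) →* (Module.End F ((Fin m → ZMod (2 ^ t)) → V))ˣ :=
  FreeGroup.lift fun i =>
    permUnit F _ V (letterPerm ha m i) *
      blockUnit F _ V fun u => Λ ^ ((increment a i u m).val : ℤ)

theorem monomialRep_eq (t : ℕ) (γ : FreeGroup (Fin d)) :
    ∃ (π : Equiv.Perm (Fin m → ZMod (2 ^ t))) (e : (Fin m → ZMod (2 ^ t)) → ℤ),
      (∀ (F V : Type) [Field F] [AddCommGroup V] [Module F V] (Λ : (Module.End F V)ˣ),
        monomialRep ha m t Λ γ = permUnit F _ V π * blockUnit F _ V fun u => Λ ^ e u) ∧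
      ∀ y : ℕ → ZMod (2 ^ t), y 0 = 1 →
        (fun k : Fin m => (magnus (ZMod (2 ^ t)) ha γ : Module.End (ZMod (2 ^ t)) (ℕ → ZMod (2 ^ t))) y (k + 1)) =
          π (fun k => y (k + 1)) ∧
        (magnus (ZMod (2 ^ t)) ha γ : Module.End (ZMod (2 ^ t)) (ℕ → ZMod (2 ^ t))) y (m + 1) =
          y (m + 1) + e (fun k => y (k + 1)) := by
  induction γ using magnus_induction with
  | h1 =>
    refine ⟨1, 0, fun F V _ _ _ Λ => ?_, fun y hy => by simp⟩
    have : (fun u : Fin m → ZMod (2 ^ t) => Λ ^ (0 : (Fin m → ZMod (2 ^ t)) → ℤ) u) = 1 := by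
      ext; simp
    rw [this, map_one, map_one, map_one, one_mul]
  | hg i =>
    refine ⟨letterPerm ha m i, fun u => ((increment a i u m).val : ℤ),
      fun F V _ _ _ Λ => FreeGroup.lift_apply_of, fun y hy => ?_⟩
    have h1 := magnus_of_zpow (ZMod (2 ^ t)) ha i 1 y
    rw [zpow_one, one_smul] at h1
    have h2 : ∀ k ≤ m, shiftOp _ a i y (k + 1) =
        increment a i (fun k : Fin m => y (k + 1)) k := fun k hk => by
      rw [shiftOp_succ, increment, extendOne_eq y hy k hk]
    rw [h1]
    constructor
    · ext k
      change y (k + 1) + _ = y (k + 1) + _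
      rw [h2 k k.2.le]
    · rw [Pi.add_apply, h2 m le_rfl]
      simp
  | hi γ h =>
    obtain ⟨π, e, h1, h2⟩ := h
    refine ⟨π⁻¹, fun u => - e (π⁻¹ u), fun F V _ _ _ Λ => ?_, fun y hy => ?_⟩
    · rw [map_inv, h1, _root_.mul_inv_rev, ← map_inv, ← map_inv, blockUnit_mul_permUnit]
      congr 2
      ext u : 1
      simp
    · set z := (magnus (ZMod (2 ^ t)) ha γ⁻¹ : Module.End (ZMod (2 ^ t)) (ℕ → ZMod (2 ^ t))) y with hz
      have h3 := h2 z (by rw [hz, magnus_apply_zero, hy])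
      rw [hz, magnus_inv, ← hz] at h3
      rw [h3.1, h3.2, Equiv.Perm.inv_def, Equiv.symm_apply_apply]
      simp
  | hm γ δ hγ hδ =>
    obtain ⟨π, e, h1, h2⟩ := hγ
    obtain ⟨ρ, f, h3, h4⟩ := hδ
    refine ⟨π * ρ, fun u => e (ρ u) + f u, fun F V _ _ _ Λ => ?_, fun y hy => ?_⟩
    · have h5 : (fun u => Λ ^ (e (ρ u) + f u)) = ((fun u => Λ ^ e u) ∘ ρ) * fun u => Λ ^ f u :=
        funext fun u => zpow_add _ _ _
      rw [h5, map_mul, map_mul, map_mul, h1, h3, mul_assoc, mul_assoc,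
        ← mul_assoc _ (permUnit _ _ _ ρ), blockUnit_mul_permUnit, mul_assoc]
    · have h5 := h2 ((magnus (ZMod (2 ^ t)) ha δ : Module.End (ZMod (2 ^ t)) (ℕ → ZMod (2 ^ t))) y)
        (by rw [magnus_apply_zero, hy])
      rw [magnus_mul, h5.1, h5.2, (h4 y hy).1, (h4 y hy).2]
      simp [add_assoc, add_comm]

/-- For a non-trivial word, block diagonal operators with prescribed exponents modulo `2 ^ t`
are word values. -/
theorem exists_exponents {w : FreeGroup (Fin d)} (hw : w ≠ 1) :
    ∃ κ : ℤ, κ ≠ 0 ∧ ∀ t : ℕ, ∃ (I : Type) (_ : Fintype I) (_ : DecidableEq I) (r : ℕ)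
      (e : I → ℤ), Fintype.card I = 2 ^ r ∧ (∀ i, (2 ^ t : ℤ) ∣ e i - κ) ∧
      ∀ (F V : Type) [Field F] [AddCommGroup V] [Module F V] (Λ : (Module.End F V)ˣ),
        blockUnit F I V (fun i => Λ ^ e i) ∈ wordImage w (Module.End F (I → V))ˣ := by
  obtain ⟨m, κ, a, ha, hκ, hM⟩ := exists_magnus hw
  refine ⟨κ, hκ, fun t => ?_⟩
  obtain ⟨π, e, h1, h2⟩ := monomialRep_eq ha m t w
  have hM' : ∀ y : ℕ → ZMod (2 ^ t),
      (∀ l ≤ m, (magnus (ZMod (2 ^ t)) ha w : Module.End (ZMod (2 ^ t)) (ℕ → ZMod (2 ^ t))) y l = y l) ∧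
      (magnus (ZMod (2 ^ t)) ha w : Module.End (ZMod (2 ^ t)) (ℕ → ZMod (2 ^ t))) y (m + 1) = y (m + 1) + κ * y 0 := by
    intro y
    obtain ⟨z, rfl⟩ : ∃ z : ℕ → ℤ, y = Int.castRingHom _ ∘ z :=
      ⟨fun l => (y l).val, by ext l; simp⟩
    rw [magnus_natural]
    refine ⟨fun l hl => ?_, ?_⟩
    · rw [Function.comp_apply, (hM z).1 l hl]; rfl
    · rw [Function.comp_apply, (hM z).2]; simp
  have h3 : ∀ u : Fin m → ZMod (2 ^ t), (fun k : Fin m => extendOne u (k + 1)) = u := fun u => by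
    ext k
    exact dif_pos k.2
  have hπ : π = 1 := by
    ext u : 1
    have h4 := (h2 (extendOne u) rfl).1
    rw [h3] at h4
    rw [← h4, Equiv.Perm.one_apply]
    conv_rhs => rw [← h3 u]
    ext k
    exact (hM' _).1 _ k.2
  refine ⟨Fin m → ZMod (2 ^ t), inferInstance, inferInstance, t * m, e, ?_, fun u => ?_, ?_⟩
  · simp [ZMod.card, pow_mul]
  · have h4 := (h2 (extendOne u) rfl).2
    rw [h3, (hM' _).2] at h4
    have h5 : ((e u : ℤ) : ZMod (2 ^ t)) = κ := by
      have := add_left_cancel h4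
      rw [← this]
      simp [extendOne]
    have h6 := (ZMod.intCast_eq_intCast_iff_dvd_sub _ _ _).1 h5.symm
    exact_mod_cast h6
  · intro F V _ _ _ Λ
    have h4 := h1 F V Λ
    rw [hπ, map_one, one_mul] at h4
    rw [← h4]
    exact ⟨_, rfl⟩

end Exponents

section WordValues

variable {d d' : ℕ} {w : FreeGroup (Fin d)} {w' : FreeGroup (Fin d')}

theorem pi_mem_wordImage {I G : Type*} [Group G] {x : I → G}
    (hx : ∀ i, x i ∈ wordImage w G) : x ∈ wordImage w (I → G) := by
  choose f hf using hx
  refine ⟨fun k i => f i k, funext fun i => ?_⟩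
  rw [← hf i]
  exact DFunLike.congr_fun (FreeGroup.ext_hom ((Pi.evalMonoidHom _ i).comp
    (FreeGroup.lift fun k i => f i k)) (FreeGroup.lift (f i)) fun k => by simp) w

theorem prod_mem_wordImage {G H : Type*} [Group G] [Group H] {x : G} {y : H}
    (hx : x ∈ wordImage w G) (hy : y ∈ wordImage w H) : (x, y) ∈ wordImage w (G × H) := by
  obtain ⟨f, rfl⟩ := hx
  obtain ⟨g, rfl⟩ := hy
  refine ⟨fun k => (f k, g k), ?_⟩
  exact DFunLike.congr_fun (FreeGroup.ext_hom (FreeGroup.lift fun k => (f k, g k))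
    ((FreeGroup.lift f).prod (FreeGroup.lift g)) fun k => by simp) w

variable {F K : Type} [Field F] [Field K] [Algebra F K]

/-- A diagonal operator with exponents `e i * e' j` in a suitable matrix algebra is a value of
the first word, and its inverse, up to any sign, is a value of the second. -/
theorem exists_diagonal_values [FiniteDimensional F K] {I J C T : Type} [Fintype I] [Fintype J]
    [Fintype C] [Fintype T] [DecidableEq T]
    (hT : Fintype.card T = Fintype.card I * (Fintype.card J * (Fintype.card C * finrank F K)))
    {e : I → ℤ} {e' : J → ℤ}
    (he : ∀ (F V : Type) [Field F] [AddCommGroup V] [Module F V] (Λ : (Module.End F V)ˣ),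
        blockUnit F I V (fun i => Λ ^ e i) ∈ wordImage w (Module.End F (I → V))ˣ)
    (he' : ∀ (F V : Type) [Field F] [AddCommGroup V] [Module F V] (Λ : (Module.End F V)ˣ),
        blockUnit F J V (fun i => Λ ^ e' i) ∈ wordImage w' (Module.End F (J → V))ˣ)
    {θ : Kˣ} (hθ : ∀ j, θ ^ e' j = -1) :
    ∃ φ : (I → J → K) →ₐ[F] Matrix T T F, ∀ lam : Kˣ, ∃ M : GL T F,
      (M : Matrix T T F) = φ (fun i j => ((lam ^ (e i * e' j) : Kˣ) : K)) ∧
      M ∈ wordImage w (GL T F) ∧ M⁻¹ ∈ wordImage w' (GL T F) ∧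
      -M⁻¹ ∈ wordImage w' (GL T F) := by
  classical
  let V := C → K
  let W := I → J → V
  have hfin : finrank F W = Fintype.card T := by
    simp only [W, V, Module.finrank_pi_fintype, Finset.sum_const, Finset.card_univ, smul_eq_mul,
      hT]
  let b : Basis T F W := (Module.finBasis F W).reindex
    ((finCongr hfin).trans (Fintype.equivFin T).symm)
  let μ : Kˣ →* (Module.End F V)ˣ := Units.map ((Algebra.lsmul F F V : K →ₐ[F] Module.End F V) : K →* Module.End F V)
  let ψ : (I → J → K) →ₐ[F] Module.End F W := Algebra.lsmul F F W
  let Φ : (Module.End F W)ˣ →* GL T F :=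
    Units.map ((LinearMap.toMatrixAlgEquiv b : Module.End F W →* Matrix T T F))
  let Δ : (I → J → Kˣ) →* (Module.End F W)ˣ := (blockUnit F I (J → V)).comp
    (MonoidHom.pi fun i => (blockUnit F J V).comp <| (MonoidHom.pi fun j =>
      μ.comp (Pi.evalMonoidHom _ j)).comp (Pi.evalMonoidHom _ i))
  have hΔψ : ∀ x, (Δ x : Module.End F W) = ψ fun i j => (x i j : K) := fun x => rfl
  have hval : ∀ c : I → Kˣ, Δ (fun i j => c i ^ e' j) ∈ wordImage w' (Module.End F W)ˣ := by
    intro c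
    refine map_mem_wordImage (blockUnit F I (J → V)) (pi_mem_wordImage fun i => ?_)
    have := he' F V (μ (c i))
    simp only [← map_zpow] at this
    exact this
  have hneg : ∀ u : (Module.End F W)ˣ, Φ (-u) = - Φ u := fun u => Units.ext (by
    change LinearMap.toMatrixAlgEquiv b (-(u : Module.End F W)) = _
    rw [map_neg]; rfl)
  refine ⟨(LinearMap.toMatrixAlgEquiv b).toAlgHom.comp ψ, fun lam =>
    ⟨Φ (Δ fun i j => lam ^ (e i * e' j)), rfl, map_mem_wordImage _ ?_, ?_, ?_⟩⟩
  · have := he F (J → V) (blockUnit F J V fun j => μ (lam ^ e' j))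
    simp only [← map_zpow] at this
    have h0 : ∀ i j, μ (lam ^ (e i * e' j)) = μ (lam ^ e' j) ^ e i := fun i j => by
      rw [← map_zpow, ← zpow_mul, mul_comm]
    change blockUnit F I (J → V) (fun i => blockUnit F J V fun j => μ (lam ^ (e i * e' j))) ∈ _
    simp only [h0]
    exact this
  · rw [← map_inv, ← map_inv]
    refine map_mem_wordImage _ ?_
    convert hval fun i => lam ^ (- e i) using 2
    ext i j : 2
    simp [zpow_mul]
  · rw [← map_inv, ← map_inv, ← hneg]
    refine map_mem_wordImage _ ?_
    have h1 : -Δ (fun i j => lam ^ (e i * e' j))⁻¹ =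
        Δ fun i j => (θ * lam ^ (- e i)) ^ e' j := by
      ext1
      rw [Units.val_neg, hΔψ, hΔψ, ← map_neg]
      congr 1
      ext i j
      simp [mul_zpow, hθ, zpow_mul]
    rw [h1]
    exact hval _

end WordValues

section Assembly

open Matrix

variable {F : Type} [Field F] {T : Type} [Fintype T] [DecidableEq T]

/-- The block diagonal embedding. -/
def blockDiagGL : GL T F × GL T F →* GL (T ⊕ T) F :=
  MonoidHom.toHomUnits
    { toFun x := fromBlocks (x.1 : Matrix T T F) 0 0 (x.2 : Matrix T T F)
      map_one' := by simp
      map_mul' x y := by simp [fromBlocks_multiply] }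

theorem coe_blockDiagGL (x : GL T F × GL T F) :
    (blockDiagGL x : Matrix (T ⊕ T) (T ⊕ T) F) =
      fromBlocks (x.1 : Matrix T T F) 0 0 (x.2 : Matrix T T F) := rfl

theorem blockDiagGL_neg (x : GL T F × GL T F) : blockDiagGL (-x) = - blockDiagGL x := by
  refine Units.ext ?_
  rw [Units.val_neg, coe_blockDiagGL, coe_blockDiagGL, fromBlocks_neg]
  simp

theorem aeval_blockDiagGL (x : GL T F × GL T F) (p : F[X]) :
    aeval (blockDiagGL x : Matrix (T ⊕ T) (T ⊕ T) F) p =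
      fromBlocks (aeval (x.1 : Matrix T T F) p) 0 0 (aeval (x.2 : Matrix T T F) p) := by
  induction p using Polynomial.induction_on' with
  | add p q hp hq => simp [hp, hq, fromBlocks_add]
  | monomial k c =>
    rw [coe_blockDiagGL, aeval_monomial, aeval_monomial, aeval_monomial,
      fromBlocks_diagonal_pow]
    simp only [Algebra.algebraMap_eq_smul_one, smul_one_mul, fromBlocks_smul, smul_zero]

theorem mul_aeval_eq {A B s : Matrix T T F} (h : A * s = s * B) (p : F[X]) :
    aeval A p * s = s * aeval B p := by
  induction p using Polynomial.induction_on' with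
  | add p q hp hq => rw [map_add, map_add, add_mul, mul_add, hp, hq]
  | monomial k c =>
    have h1 : ∀ k : ℕ, A ^ k * s = s * B ^ k := fun k => by
      induction k with
      | zero => simp
      | succ k ih => rw [pow_succ, mul_assoc, h, ← mul_assoc, ih, mul_assoc, pow_succ]
    simp only [aeval_monomial, Algebra.algebraMap_eq_smul_one, one_mul, smul_mul_assoc,
      mul_smul_comm, h1]

theorem eq_zero_of_intertwine {A B s : Matrix T T F} (h : A * s = s * B) {p : F[X]}
    (hA : IsUnit (aeval A p)) (hB : aeval B p = 0) : s = 0 := by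
  have h1 := mul_aeval_eq h p
  rw [hB, mul_zero] at h1
  exact hA.mul_right_eq_zero.1 h1

theorem eq_zero_of_intertwine' {A B s : Matrix T T F} (h : A * s = s * B) {p : F[X]}
    (hA : aeval A p = 0) (hB : IsUnit (aeval B p)) : s = 0 := by
  have h1 := mul_aeval_eq h p
  rw [hA, zero_mul] at h1
  exact hB.mul_left_eq_zero.1 h1.symm

theorem aeval_transpose (A : Matrix T T F) (p : F[X]) : aeval Aᵀ p = (aeval A p)ᵀ := by
  induction p using Polynomial.induction_on' with
  | add p q hp hq => simp [hp, hq]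
  | monomial k c =>
    simp only [aeval_monomial, Algebra.algebraMap_eq_smul_one, smul_one_mul, transpose_smul,
      transpose_pow]

/-- The symplectic group is a product of word images as soon as the diagonal entries attached to
`lam₁` and `lam₂` are sufficiently independent. -/
theorem exists_mul_eq_of_separated {d d' : ℕ} {w : FreeGroup (Fin d)} {w' : FreeGroup (Fin d')}
    {K : Type} [Field K] [Algebra F K] {I J : Type}
    {e : I → ℤ} {e' : J → ℤ} (φ : (I → J → K) →ₐ[F] Matrix T T F)
    (hφ : ∀ lam : Kˣ, ∃ M : GL T F,
      (M : Matrix T T F) = φ (fun i j => ((lam ^ (e i * e' j) : Kˣ) : K)) ∧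
      M ∈ wordImage w (GL T F) ∧ M⁻¹ ∈ wordImage w' (GL T F) ∧
      -M⁻¹ ∈ wordImage w' (GL T F))
    (lam₁ lam₂ : Kˣ) (p q : F[X])
    (hp₁ : ∀ i j, aeval ((lam₁ ^ (e i * e' j) : Kˣ) : K) p = 0)
    (hp₂ : ∀ i j, aeval ((lam₂ ^ (e i * e' j) : Kˣ) : K) p = 0)
    (hp₁' : ∀ i j, aeval ((lam₁ ^ (-(e i * e' j)) : Kˣ) : K) p ≠ 0)
    (hp₂' : ∀ i j, aeval ((lam₂ ^ (-(e i * e' j)) : Kˣ) : K) p ≠ 0)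
    (hq₁ : ∀ i j, aeval ((lam₁ ^ (e i * e' j) : Kˣ) : K) q = 0)
    (hq₂ : ∀ i j, aeval ((lam₂ ^ (e i * e' j) : Kˣ) : K) q ≠ 0)
    (g : symplecticGroup (T ⊕ T) F) :
    ∃ a ∈ wordImage w (symplecticGroup (T ⊕ T) F),
      ∃ b ∈ wordImage w' (symplecticGroup (T ⊕ T) F), g = a * b := by
  have hev : ∀ (x : I → J → K) (r : F[X]), aeval (φ x) r = φ fun i j => aeval (x i j) r := by
    intro x r
    rw [aeval_algHom_apply]
    congr 1
    ext i j
    exact (aeval_algHom_apply ((Pi.evalAlgHom F (fun _ : J => K) j).comp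
      (Pi.evalAlgHom F (fun _ : I => J → K) i)) x r).symm
  have hzero : ∀ (x : I → J → K) (r : F[X]), (∀ i j, aeval (x i j) r = 0) →
      aeval (φ x) r = 0 := fun x r h => by
    rw [hev, ← map_zero φ]
    congr 1
    ext i j
    exact h i j
  have hunit : ∀ (x : I → J → K) (r : F[X]), (∀ i j, aeval (x i j) r ≠ 0) →
      IsUnit (aeval (φ x) r) := fun x r h => by
    rw [hev]
    refine IsUnit.map φ ?_
    simp only [Pi.isUnit_iff]
    exact fun i j => (h i j).isUnit
  have hinv : ∀ (lam : Kˣ) (M : GL T F),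
      (M : Matrix T T F) = φ (fun i j => ((lam ^ (e i * e' j) : Kˣ) : K)) →
      ((M⁻¹ : GL T F) : Matrix T T F) = φ (fun i j => ((lam ^ (-(e i * e' j)) : Kˣ) : K)) := by
    intro lam M hM
    refine Units.inv_eq_of_mul_eq_one_right ?_
    rw [hM, ← map_mul, ← map_one φ]
    congr 1
    ext i j
    change ((lam ^ (e i * e' j) : Kˣ) : K) * ((lam ^ (-(e i * e' j)) : Kˣ) : K) = 1
    rw [← Units.val_mul, ← _root_.zpow_add, add_neg_cancel, _root_.zpow_zero, Units.val_one]
  obtain ⟨M₁, hM₁, h₁, h₁', h₁''⟩ := hφ lam₁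
  obtain ⟨M₂, hM₂, h₂, h₂', h₂''⟩ := hφ lam₂
  have hMp : aeval (blockDiagGL (M₁, M₂) : Matrix (T ⊕ T) (T ⊕ T) F) p = 0 := by
    rw [aeval_blockDiagGL, hM₁, hM₂, hzero _ _ hp₁, hzero _ _ hp₂, fromBlocks_zero]
  have hMp' : IsUnit (aeval ((blockDiagGL (M₁, M₂))⁻¹ : Matrix (T ⊕ T) (T ⊕ T) F) p) := by
    rw [← Matrix.coe_units_inv, ← map_inv, aeval_blockDiagGL, Matrix.isUnit_iff_isUnit_det,
      det_fromBlocks_zero₁₂]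
    refine IsUnit.mul ?_ ?_
    · rw [← Matrix.isUnit_iff_isUnit_det, Prod.fst_inv, hinv _ _ hM₁]
      exact hunit _ _ hp₁'
    · rw [← Matrix.isUnit_iff_isUnit_det, Prod.snd_inv, hinv _ _ hM₂]
      exact hunit _ _ hp₂'
  have hdet : IsUnit (blockDiagGL (M₁, M₂) : Matrix (T ⊕ T) (T ⊕ T) F).det :=
    (Matrix.isUnit_iff_isUnit_det _).1 (blockDiagGL (M₁, M₂)).isUnit
  refine exists_mul_eq (M := blockDiagGL (M₁, M₂)) (coe_blockDiagGL _)
    (fun s hs => eq_zero_of_intertwine' hs (p := q) ?_ ?_)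
    (fun s hs => eq_zero_of_intertwine hs (p := q) ?_ ?_)
    (fun s hs => ?_) (fun s hs => ?_)
    (map_mem_wordImage _ (prod_mem_wordImage h₁ h₂)) ?_ ?_ g
  · rw [hM₁]; exact hzero _ _ hq₁
  · rw [hM₂]; exact hunit _ _ hq₂
  · rw [hM₂]; exact hunit _ _ hq₂
  · rw [hM₁]; exact hzero _ _ hq₁
  · refine eq_zero_of_intertwine (A := (blockDiagGL (M₁, M₂) : Matrix _ _ F)⁻¹ᵀ)
      (B := (blockDiagGL (M₁, M₂) : Matrix _ _ F)) (p := p) ?_ ?_ hMp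
    · conv_lhs => rw [← hs]
      rw [mul_assoc, ← mul_assoc, ← transpose_mul, Matrix.mul_nonsing_inv _ hdet,
        transpose_one, one_mul]
    · rw [aeval_transpose, Matrix.isUnit_transpose]
      exact hMp'
  · refine eq_zero_of_intertwine (A := (blockDiagGL (M₁, M₂) : Matrix _ _ F)⁻¹)
      (B := (blockDiagGL (M₁, M₂) : Matrix _ _ F)ᵀ) (p := p) ?_ hMp' ?_
    · conv_lhs => rw [← hs]
      rw [mul_assoc, ← mul_assoc, Matrix.nonsing_inv_mul _ hdet, one_mul]
    · rw [aeval_transpose, hMp, transpose_zero]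
  · rw [← map_inv]
    exact map_mem_wordImage _ (prod_mem_wordImage h₁' h₂')
  · rw [← map_inv, ← blockDiagGL_neg]
    exact map_mem_wordImage _ (prod_mem_wordImage h₁'' h₂'')

end Assembly

section Arithmetic

theorem eq_zero_of_dvd_of_small {q : ℤ} (hq : 2 ≤ q) {h : ℕ} {X Y B : ℤ} (hX : |X| ≤ B)
    (hY : |Y| ≤ B) (hB : B + 1 < 2 ^ h) {a : ℕ} (ha : a ≤ h)
    (hdvd : q ^ (2 * h) - 1 ∣ X * q ^ a + Y) : X * q ^ a + Y = 0 := by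
  have h1 : (2 : ℤ) ^ h ≤ q ^ h := pow_le_pow_left₀ (by norm_num) hq h
  have h2 : q ^ a ≤ q ^ h := pow_le_pow_right₀ (by linarith) ha
  have h0 : 0 < q ^ a := by positivity
  have hB0 : 0 ≤ B := (abs_nonneg X).trans hX
  refine Int.eq_zero_of_abs_lt_dvd hdvd ?_
  calc |X * q ^ a + Y| ≤ |X| * q ^ a + |Y| := by
        refine (abs_add_le _ _).trans ?_
        rw [abs_mul, abs_of_pos h0]
    _ ≤ B * q ^ h + B := by gcongr
    _ < q ^ (2 * h) - 1 := by
        rw [pow_mul', sq]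
        nlinarith

/-- If `q ^ (2 * h) - 1` divides a short combination of powers of `q`, the combination vanishes
up to a cyclic rotation. -/
theorem exists_eq_zero_of_dvd {q : ℤ} (hq : 2 ≤ q) {h : ℕ} {X Y B : ℤ} (hX : |X| ≤ B)
    (hY : |Y| ≤ B) (hB : B + 1 < 2 ^ h) {a : ℕ} (ha : a < 2 * h)
    (hdvd : q ^ (2 * h) - 1 ∣ X * q ^ a + Y) :
    ∃ b : ℕ, X * q ^ b + Y = 0 ∨ Y * q ^ b + X = 0 := by
  by_cases h1 : a ≤ h
  · exact ⟨a, .inl (eq_zero_of_dvd_of_small hq hX hY hB h1 hdvd)⟩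
  · refine ⟨2 * h - a, .inr (eq_zero_of_dvd_of_small hq hY hX hB (by omega) ?_)⟩
    have h2 : q ^ a * q ^ (2 * h - a) = q ^ (2 * h) := by
      rw [← pow_add]; congr 1; omega
    have h3 : Y * q ^ (2 * h - a) + X =
        (X * q ^ a + Y) * q ^ (2 * h - a) - X * (q ^ (2 * h) - 1) := by
      rw [← h2]; ring
    rw [h3]
    exact (hdvd.mul_right _).sub (dvd_mul_left _ _)

theorem odd_of_dvd_sub {u k : ℤ} (hk : Odd k) {s : ℕ} (hs : s ≠ 0) (h : (2 : ℤ) ^ s ∣ u - k) :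
    Odd u := by
  have h1 : (2 : ℤ) ∣ u - k := (dvd_pow_self _ hs).trans h
  have h2 : Even (u - k) := even_iff_two_dvd.2 h1
  simpa using h2.add_odd hk

theorem eight_dvd_of_add_eq_zero {u u' k c c' : ℤ} (hk : Odd k) (hu : 8 ∣ u - k)
    (hu' : 8 ∣ u' - k) (h : c * u + c' * u' = 0) : 8 ∣ c + c' := by
  have h1 : (8 : ℤ) ∣ (c + c') * k := by
    have h2 : (c + c') * k = (c * u + c' * u') - (c * (u - k) + c' * (u' - k)) := by ring
    rw [h2, h, zero_sub, dvd_neg]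
    exact (hu.mul_left _).add (hu'.mul_left _)
  refine IsCoprime.dvd_of_dvd_mul_right ?_ h1
  have h3 : IsCoprime (2 : ℤ) k := Int.isCoprime_two_left.2 hk
  simpa using h3.pow_left (m := 3)

theorem mul_pow_add_ne_zero_of_even {q u u' k c c' : ℤ} (hq : Even q) (hk : Odd k)
    (hu : 8 ∣ u - k) (hu' : 8 ∣ u' - k) (hc' : Odd c') (hcc : ¬ 8 ∣ c + c') (b : ℕ) :
    c * u * q ^ b + c' * u' ≠ 0 := by
  intro h
  have hu1 : Odd u' := odd_of_dvd_sub (s := 3) hk (by norm_num) (by simpa using hu')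
  rcases Nat.eq_zero_or_pos b with rfl | hb
  · rw [pow_zero, mul_one] at h
    exact hcc (eight_dvd_of_add_eq_zero hk hu hu' h)
  · have h1 : Even (c * u * q ^ b) := (hq.pow_of_ne_zero hb.ne').mul_left _
    have h2 : Odd (c * u * q ^ b + c' * u') := h1.add_odd (hc'.mul hu1)
    rw [h] at h2
    exact absurd h2 (by decide)

theorem mul_pow_add_ne_zero_of_large {q u u' k B : ℤ} (hk : Odd k)
    (hu : 8 ∣ u - k) (hu' : 8 ∣ u' - k) (hB : |u'| ≤ B) (hq : B < q) (b : ℕ) :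
    u * q ^ b + u' ≠ 0 := by
  intro h
  have hu1 : Odd u := odd_of_dvd_sub (s := 3) hk (by norm_num) (by simpa using hu)
  have hB0 : 0 ≤ B := (abs_nonneg _).trans hB
  rcases Nat.eq_zero_or_pos b with rfl | hb
  · have := eight_dvd_of_add_eq_zero (c := 1) (c' := 1) hk hu hu' (by simpa using h)
    revert this; decide
  · have h0 : u ≠ 0 := by rintro rfl; exact absurd hu1 (by decide)
    have h1 : |u'| = |u| * q ^ b := by
      rw [eq_neg_of_add_eq_zero_right h, abs_neg, abs_mul, abs_of_nonneg (a := q ^ b)]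
      exact pow_nonneg (by linarith) _
    have h2 : q ≤ q ^ b := le_self_pow₀ (by linarith) hb.ne'
    have h3 : 1 ≤ |u| := Int.one_le_abs h0
    nlinarith

theorem two_pow_dvd_pow_sub_one {q : ℤ} (hq : Odd q) (δ : ℕ) :
    (2 : ℤ) ^ (δ + 1) ∣ q ^ 2 ^ δ - 1 := by
  induction δ with
  | zero => simpa [even_iff_two_dvd] using hq.sub_odd odd_one
  | succ δ ih =>
    have h1 : q ^ 2 ^ (δ + 1) - 1 = (q ^ 2 ^ δ - 1) * (q ^ 2 ^ δ + 1) := by ring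
    rw [h1, pow_succ]
    exact mul_dvd_mul ih (even_iff_two_dvd.1 (hq.pow.add_odd odd_one))

theorem two_pow_dvd_add_one {q : ℤ} (hq : Odd q) {s : ℕ} (hs : 2 ≤ s) {a : ℕ}
    (h : (2 : ℤ) ^ s ∣ q ^ a + 1) : (2 : ℤ) ^ s ∣ q + 1 := by
  rcases Nat.even_or_odd a with ha | ha
  · exfalso
    obtain ⟨b, rfl⟩ := ha
    have h4 : (4 : ℤ) ∣ q ^ (b + b) + 1 := by
      refine dvd_trans ?_ h
      have := pow_dvd_pow (2 : ℤ) hs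
      norm_num at this
      exact this
    obtain ⟨r, hr⟩ : Odd (q ^ b) := hq.pow
    rw [pow_add, hr] at h4
    ring_nf at h4
    omega
  · have h1 : q ^ a + 1 = (q + 1) * ∑ i ∈ Finset.range a, q ^ i * (-1) ^ (a - 1 - i) := by
      have h2 := (Commute.all q (-1)).mul_geom_sum₂ a
      rw [ha.neg_one_pow] at h2
      linear_combination -h2
    have h3 : Odd (∑ i ∈ Finset.range a, q ^ i * (-1) ^ (a - 1 - i)) := by
      have h4 : Even (∑ i ∈ Finset.range a, (q ^ i * (-1) ^ (a - 1 - i) - 1)) :=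
        Finset.even_sum _ fun i _ => (hq.pow.mul (Odd.pow (by decide))).sub_odd odd_one
      rw [Finset.sum_sub_distrib, Finset.sum_const, Finset.card_range, nsmul_one] at h4
      have h5 := h4.add_odd ((Int.odd_coe_nat a).2 ha)
      rwa [sub_add_cancel] at h5
    rw [h1] at h
    exact IsCoprime.dvd_of_dvd_mul_right ((Int.isCoprime_two_left.2 h3).pow_left) h

theorem abs_mul_two_pow_mul_le {c u B C : ℤ} {v : ℕ} (hc : |c| ≤ C) (hu : |u| ≤ B) :
    |c * (2 ^ v * u)| ≤ C * (2 ^ v * B) := by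
  rw [abs_mul, abs_mul, abs_of_pos (a := (2 : ℤ) ^ v) (by positivity)]
  have := abs_nonneg u
  have := abs_nonneg c
  have : (0 : ℤ) ≤ C := by linarith
  gcongr

theorem not_dvd_of_even {q u u' k c c' B : ℤ} (hq : 2 ≤ q) (hq2 : Even q) (hk : Odd k)
    (hu : 8 ∣ u - k) (hu' : 8 ∣ u' - k) (hc : Odd c) (hc' : Odd c') (hcc : ¬ 8 ∣ c + c')
    (hc3 : |c| ≤ 3) (hc3' : |c'| ≤ 3) (huB : |u| ≤ B) (huB' : |u'| ≤ B) {v h : ℕ}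
    (hB : 3 * (2 ^ v * B) + 1 < 2 ^ h) {a : ℕ} (ha : a < 2 * h) :
    ¬ q ^ (2 * h) - 1 ∣ c * (2 ^ v * u) * q ^ a + c' * (2 ^ v * u') := by
  intro hd
  have h2 : (2 : ℤ) ^ v ≠ 0 := by positivity
  obtain ⟨b, hb | hb⟩ := exists_eq_zero_of_dvd hq (abs_mul_two_pow_mul_le hc3 huB)
    (abs_mul_two_pow_mul_le hc3' huB') hB ha hd
  · refine mul_pow_add_ne_zero_of_even hq2 hk hu hu' hc' hcc b (mul_left_cancel₀ h2 ?_)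
    linear_combination hb
  · refine mul_pow_add_ne_zero_of_even hq2 hk hu' hu hc (by rwa [add_comm]) b
      (mul_left_cancel₀ h2 ?_)
    linear_combination hb

theorem not_dvd_of_large {q u u' k c B : ℤ} (hq : 2 ≤ q) (hqB : B < q) (hk : Odd k)
    (hu : 8 ∣ u - k) (hu' : 8 ∣ u' - k) (hc : c ≠ 0)
    (hc3 : |c| ≤ 3) (huB : |u| ≤ B) (huB' : |u'| ≤ B) {v h : ℕ}
    (hB : 3 * (2 ^ v * B) + 1 < 2 ^ h) {a : ℕ} (ha : a < 2 * h) :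
    ¬ q ^ (2 * h) - 1 ∣ c * (2 ^ v * u) * q ^ a + c * (2 ^ v * u') := by
  intro hd
  have h2 : c * (2 : ℤ) ^ v ≠ 0 := by positivity
  obtain ⟨b, hb | hb⟩ := exists_eq_zero_of_dvd hq (abs_mul_two_pow_mul_le hc3 huB)
    (abs_mul_two_pow_mul_le hc3 huB') hB ha hd
  · refine mul_pow_add_ne_zero_of_large hk hu hu' huB' hqB b (mul_left_cancel₀ h2 ?_)
    linear_combination hb
  · refine mul_pow_add_ne_zero_of_large hk hu' hu huB hqB b (mul_left_cancel₀ h2 ?_)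
    linear_combination hb

theorem not_dvd_of_small {q u u' k c D : ℤ} {s v : ℕ} (hs : 2 ≤ s) (hq : 0 ≤ q)
    (hqB : q + 1 < 2 ^ s) (hq2 : Odd q) (hk : Odd k) (hu : 2 ^ s ∣ u - k) (hu' : 2 ^ s ∣ u' - k)
    (hc : c = 1 ∨ c = 2) (hD : 2 ^ (v + s + 1) ∣ D) (a : ℕ) :
    ¬ D ∣ c * (2 ^ v * u) * q ^ a + c * (2 ^ v * u') := by
  intro hd
  have h1 : (2 : ℤ) ^ (v + 1) * 2 ^ s ∣ 2 ^ (v + 1) * (u * q ^ a + u') := by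
    have h2 : (2 : ℤ) ^ (v + 1) * 2 ^ s = 2 ^ (v + s + 1) := by ring
    rw [h2]
    rcases hc with rfl | rfl
    · exact ((hD.trans hd).mul_right 2).trans (dvd_of_eq (by ring))
    · exact (hD.trans hd).trans (dvd_of_eq (by ring))
  have h3 := (mul_dvd_mul_iff_left (by positivity)).1 h1
  have h4 : (2 : ℤ) ^ s ∣ k * (q ^ a + 1) := by
    have h5 : k * (q ^ a + 1) = (u * q ^ a + u') - ((u - k) * q ^ a + (u' - k)) := by ring
    rw [h5]
    exact h3.sub ((hu.mul_right _).add hu')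
  have h6 := IsCoprime.dvd_of_dvd_mul_left
    ((Int.isCoprime_two_left.2 hk).pow_left (m := s)) h4
  have h7 := Int.le_of_dvd (by linarith) (two_pow_dvd_add_one hq2 hs h6)
  linarith

theorem not_dvd_of_odd_add {q u u' c c' D : ℤ} {v : ℕ} (hq : Odd q) (hu : Odd u) (hu' : Odd u')
    (hc : Odd (c + c')) (hD : 2 ^ (v + 1) ∣ D) (a : ℕ) :
    ¬ D ∣ c * (2 ^ v * u) * q ^ a + c' * (2 ^ v * u') := by
  intro hd
  have h1 : (2 : ℤ) ^ v * 2 ∣ 2 ^ v * (c * (u * q ^ a) + c' * u') := by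
    rw [← pow_succ]
    exact (hD.trans hd).trans (dvd_of_eq (by ring))
  have h3 := even_iff_two_dvd.2 ((mul_dvd_mul_iff_left (by positivity)).1 h1)
  have h4 : Odd (u * q ^ a) := hu.mul hq.pow
  simp only [← Int.not_even_iff_odd, Int.even_add, Int.even_mul] at *
  tauto

end Arithmetic

section FiniteFields

variable {F K : Type} [Field F] [Fintype F] [Field K] [Algebra F K] [FiniteDimensional F K]

theorem exists_eq_pow_of_aeval_minpoly {α β : K} (h : aeval β (minpoly F α) = 0) :
    ∃ a < finrank F K, β = α ^ Fintype.card F ^ a := by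
  have : Finite K := Module.finite_of_finite F
  obtain ⟨σ, rfl⟩ := minpoly.exists_algEquiv_of_root' (Algebra.IsAlgebraic.isAlgebraic α) h
  obtain ⟨a, rfl⟩ := (FiniteField.bijective_frobeniusAlgEquivOfAlgebraic_pow F K).2 σ
  refine ⟨a, a.2, ?_⟩
  rw [AlgEquiv.coe_pow, FiniteField.coe_frobeniusAlgEquivOfAlgebraic_iterate]

theorem aeval_minpoly_ne_zero {lam : Kˣ}
    (hlam : (orderOf lam : ℤ) = (Fintype.card F : ℤ) ^ finrank F K - 1) {X Y : ℤ}
    (h : ∀ a < finrank F K, ¬ (Fintype.card F : ℤ) ^ finrank F K - 1 ∣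
      X * (Fintype.card F : ℤ) ^ a + Y) :
    aeval ((lam ^ (-Y) : Kˣ) : K) (minpoly F ((lam ^ X : Kˣ) : K)) ≠ 0 := by
  intro h0
  obtain ⟨a, ha, h1⟩ := exists_eq_pow_of_aeval_minpoly h0
  refine h a ha ?_
  rw [← hlam, orderOf_dvd_iff_zpow_eq_one]
  rw [← Units.val_pow_eq_pow_val, Units.val_inj] at h1
  rw [zpow_add, zpow_mul, ← Nat.cast_pow, zpow_natCast, ← h1, ← zpow_add, neg_add_cancel,
    zpow_zero]

variable {d d' : ℕ} {w : FreeGroup (Fin d)} {w' : FreeGroup (Fin d')}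

/-- The factorization of symplectic matrices over a finite field, given exponents without
resonances. -/
theorem exists_mul_eq_of_not_dvd {I J C T : Type} [Fintype I] [Fintype J]
    [Fintype C] [Fintype T] [DecidableEq T]
    (hT : Fintype.card T = Fintype.card I * (Fintype.card J * (Fintype.card C * finrank F K)))
    {e : I → ℤ} {e' : J → ℤ}
    (he : ∀ (F V : Type) [Field F] [AddCommGroup V] [Module F V] (Λ : (Module.End F V)ˣ),
        blockUnit F I V (fun i => Λ ^ e i) ∈ wordImage w (Module.End F (I → V))ˣ)
    (he' : ∀ (F V : Type) [Field F] [AddCommGroup V] [Module F V] (Λ : (Module.End F V)ˣ),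
        blockUnit F J V (fun i => Λ ^ e' i) ∈ wordImage w' (Module.End F (J → V))ˣ)
    {θ : Kˣ} (hθ : ∀ j, θ ^ e' j = -1) {k : ℤ}
    (hk : ∀ c c' : ℤ, ((c = 1 ∨ c = k) ∧ (c' = 1 ∨ c' = k) ∨ c = 1 ∧ c' = -k) →
      ∀ i j i' j', ∀ a < finrank F K, ¬ (Fintype.card F : ℤ) ^ finrank F K - 1 ∣
        c * (e i * e' j) * (Fintype.card F : ℤ) ^ a + c' * (e i' * e' j'))
    (g : Matrix.symplecticGroup (T ⊕ T) F) :
    ∃ a ∈ wordImage w (Matrix.symplecticGroup (T ⊕ T) F),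
      ∃ b ∈ wordImage w' (Matrix.symplecticGroup (T ⊕ T) F), g = a * b := by
  have : Finite K := Module.finite_of_finite F
  have : Fintype K := Fintype.ofFinite K
  obtain ⟨φ, hφ⟩ := exists_diagonal_values hT he he' hθ
  obtain ⟨lam, hlam⟩ := IsCyclic.exists_generator (α := Kˣ)
  have hord : (orderOf lam : ℤ) = (Fintype.card F : ℤ) ^ finrank F K - 1 := by
    rw [orderOf_eq_card_of_forall_mem_zpowers hlam, Nat.card_units, Nat.card_eq_fintype_card,
      Module.card_eq_pow_finrank (K := F), Nat.cast_sub (Nat.one_le_pow _ _ Fintype.card_pos)]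
    simp
  have hne : ∀ c c' : ℤ, ((c = 1 ∨ c = k) ∧ (c' = 1 ∨ c' = k) ∨ c = 1 ∧ c' = -k) →
      ∀ i j i' j', aeval ((lam ^ (-(c' * (e i' * e' j'))) : Kˣ) : K)
        (minpoly F ((lam ^ (c * (e i * e' j)) : Kˣ) : K)) ≠ 0 :=
    fun c c' h i j i' j' => aeval_minpoly_ne_zero hord (hk c c' h i j i' j')
  let P : ℤ → F[X] := fun c => ∏ i, ∏ j, minpoly F ((lam ^ (c * (e i * e' j)) : Kˣ) : K)
  have hP : ∀ c i j, aeval ((lam ^ (c * (e i * e' j)) : Kˣ) : K) (P c) = 0 := fun c i j => by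
    simp only [P, map_prod]
    exact Finset.prod_eq_zero (Finset.mem_univ i)
      (Finset.prod_eq_zero (Finset.mem_univ j) (minpoly.aeval _ _))
  have hP' : ∀ c c' : ℤ, ((c = 1 ∨ c = k) ∧ (c' = 1 ∨ c' = k) ∨ c = 1 ∧ c' = -k) →
      ∀ i' j', aeval ((lam ^ (-(c' * (e i' * e' j'))) : Kˣ) : K) (P c) ≠ 0 :=
    fun c c' h i' j' => by
      simp only [P, map_prod]
      exact Finset.prod_ne_zero_iff.2 fun i _ => Finset.prod_ne_zero_iff.2 fun j _ =>
        hne c c' h i j i' j'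
  refine exists_mul_eq_of_separated φ hφ lam (lam ^ k) (P 1 * P k) (P 1) (fun i j => ?_)
    (fun i j => ?_) (fun i j => ?_) (fun i j => ?_) (fun i j => ?_) (fun i j => ?_) g
  · rw [map_mul, ← one_mul (e i * e' j), hP, zero_mul]
  · rw [map_mul, ← zpow_mul, hP, mul_zero]
  · rw [map_mul, ← one_mul (e i * e' j)]
    exact mul_ne_zero (hP' 1 1 (by simp) i j) (hP' k 1 (by simp) i j)
  · rw [map_mul, ← zpow_mul, mul_neg]
    exact mul_ne_zero (hP' 1 k (by simp) i j) (hP' k k (by simp) i j)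
  · rw [← one_mul (e i * e' j), hP]
  · have := hP' 1 (-k) (by simp) i j
    rwa [neg_mul, neg_neg, zpow_mul] at this

theorem exists_zpow_eq_neg_one {J : Type} {v : ℕ} {u' : J → ℤ} (hu : ∀ j, Odd (u' j))
    (h : Odd (Fintype.card F) → (2 : ℤ) ^ (v + 1) ∣ (Fintype.card F : ℤ) ^ finrank F K - 1) :
    ∃ θ : Kˣ, ∀ j, θ ^ (2 ^ v * u' j) = -1 := by
  have : Finite K := Module.finite_of_finite F
  have : Fintype K := Fintype.ofFinite K
  rcases Nat.even_or_odd (Fintype.card F) with h2 | h2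
  · have h3 : ringChar F = 2 := (FiniteField.even_card_iff_char_two).2 (Nat.even_iff.1 h2)
    have : CharP F 2 := ringChar.of_eq h3
    have : CharP K 2 := charP_of_injective_algebraMap (algebraMap F K).injective 2
    refine ⟨1, fun j => Units.ext ?_⟩
    simp [CharTwo.neg_eq]
  · obtain ⟨lam, hlam⟩ := IsCyclic.exists_generator (α := Kˣ)
    have hord : (orderOf lam : ℤ) = (Fintype.card F : ℤ) ^ finrank F K - 1 := by
      rw [orderOf_eq_card_of_forall_mem_zpowers hlam, Nat.card_units, Nat.card_eq_fintype_card,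
        Module.card_eq_pow_finrank (K := F), Nat.cast_sub (Nat.one_le_pow _ _ Fintype.card_pos)]
      simp
    obtain ⟨r, hr⟩ := h h2
    rw [← hord] at hr
    have hr0 : r ≠ 0 := by
      rintro rfl
      rw [mul_zero, Nat.cast_eq_zero] at hr
      exact (orderOf_pos lam).ne' hr
    have h4 : lam ^ (r * 2 ^ v) = -1 := by
      have h5 : lam ^ (r * 2 ^ v) * lam ^ (r * 2 ^ v) = 1 := by
        rw [← zpow_add, ← orderOf_dvd_iff_zpow_eq_one, hr]
        exact dvd_of_eq (by ring)
      have h6 : lam ^ (r * 2 ^ v) ≠ 1 := by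
        rw [ne_eq, ← orderOf_dvd_iff_zpow_eq_one, hr]
        intro h7
        have h8 : r * 2 ^ v * 2 ∣ r * 2 ^ v * 1 := by
          rw [mul_one]
          exact (dvd_of_eq (by ring)).trans h7
        have h9 := (mul_dvd_mul_iff_left (by positivity)).1 h8
        exact absurd h9 (by decide)
      have h7 : ((lam ^ (r * 2 ^ v) : Kˣ) : K) * (lam ^ (r * 2 ^ v) : Kˣ) = 1 := by
        rw [← Units.val_mul, h5, Units.val_one]
      rcases mul_self_eq_one_iff.1 h7 with h8 | h8
      · exact absurd (Units.ext h8) h6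
      · exact Units.ext h8
    refine ⟨lam ^ r, fun j => ?_⟩
    rw [← zpow_mul, ← mul_assoc, zpow_mul, h4, (hu j).neg_one_zpow]

end FiniteFields

section Reindex

open Matrix

variable {F : Type} [Field F] {l m : Type} [Fintype l] [DecidableEq l] [Fintype m] [DecidableEq m]

/-- Relabelling of the index set of a symplectic group. -/
def symplecticReindex (e : l ≃ m) : symplecticGroup l F →* symplecticGroup m F where
  toFun A := ⟨(A : Matrix (l ⊕ l) (l ⊕ l) F).submatrix (e.sumCongr e).symm (e.sumCongr e).symm, by
    have hJ : Matrix.J m F = (Matrix.J l F).submatrix (e.sumCongr e).symm (e.sumCongr e).symm := by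
      ext (i | i) (j | j) <;> simp [Matrix.J, one_apply]
    rw [SymplecticGroup.mem_iff, hJ, transpose_submatrix, submatrix_mul_equiv,
      submatrix_mul_equiv, SymplecticGroup.mem_iff.1 A.2]⟩
  map_one' := by ext1; simp
  map_mul' A B := by ext1; simp

theorem symplecticReindex_symm_apply (e : l ≃ m) (A : symplecticGroup l F) :
    symplecticReindex e.symm (symplecticReindex e A) = A := by
  ext i j
  rcases i with i | i <;> rcases j with j | j <;> simp [symplecticReindex]

end Reindex

section Final

variable {d d' : ℕ} {w : FreeGroup (Fin d)} {w' : FreeGroup (Fin d')}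

theorem exists_odd_exponents (hw : w ≠ 1) :
    ∃ (v : ℕ) (k : ℤ), Odd k ∧ ∀ s : ℕ, ∃ (I : Type) (_ : Fintype I) (r : ℕ)
      (u : I → ℤ), Fintype.card I = 2 ^ r ∧ (∀ i, (2 ^ s : ℤ) ∣ u i - k) ∧
      ∀ (F V : Type) [Field F] [AddCommGroup V] [Module F V] (Λ : (Module.End F V)ˣ),
        blockUnit F I V (fun i => Λ ^ (2 ^ v * u i)) ∈
          wordImage w (Module.End F (I → V))ˣ := by
  obtain ⟨κ, hκ, h⟩ := exists_exponents hw
  obtain ⟨k, hk, hk2⟩ := (Int.finiteMultiplicity_iff (a := 2) (b := κ)).2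
    ⟨by decide, hκ⟩ |>.exists_eq_pow_mul_and_not_dvd
  set v := multiplicity 2 κ
  refine ⟨v, k, by rwa [← Int.not_even_iff_odd, even_iff_two_dvd], fun s => ?_⟩
  obtain ⟨I, _, _, r, e, hI, he, hB⟩ := h (v + s)
  have h1 : ∀ i, ∃ u, e i = 2 ^ v * u ∧ (2 ^ s : ℤ) ∣ u - k := fun i => by
    obtain ⟨c, hc⟩ := he i
    refine ⟨k + 2 ^ s * c, ?_, by simp⟩
    rw [hk] at hc
    linear_combination hc
  choose u hu hu' using h1
  simp only [hu] at hB
  exact ⟨I, inferInstance, r, u, hI, hu', hB⟩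

/-- The factorization for symplectic groups of rank divisible by a suitable power of two. -/
theorem exists_mul_eq_fin {F : Type} [Field F] [Fintype F] {I J : Type} [Fintype I] [Fintype J]
    {r r' δ n : ℕ} (hI : Fintype.card I = 2 ^ r) (hJ : Fintype.card J = 2 ^ r')
    (hn : 2 ^ (1 + r + r' + δ) ∣ n) {v v' : ℕ} {u : I → ℤ} {u' : J → ℤ}
    (he : ∀ (F V : Type) [Field F] [AddCommGroup V] [Module F V] (Λ : (Module.End F V)ˣ),
        blockUnit F I V (fun i => Λ ^ (2 ^ v * u i)) ∈ wordImage w (Module.End F (I → V))ˣ)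
    (he' : ∀ (F V : Type) [Field F] [AddCommGroup V] [Module F V] (Λ : (Module.End F V)ˣ),
        blockUnit F J V (fun i => Λ ^ (2 ^ v' * u' i)) ∈ wordImage w' (Module.End F (J → V))ˣ)
    (hu' : ∀ j, Odd (u' j)) (hδ : v' ≤ δ) {k : ℤ}
    (hk : ∀ c c' : ℤ, ((c = 1 ∨ c = k) ∧ (c' = 1 ∨ c' = k) ∨ c = 1 ∧ c' = -k) →
      ∀ i j i' j', ∀ a < 2 ^ δ, ¬ (Fintype.card F : ℤ) ^ 2 ^ δ - 1 ∣
        c * (2 ^ (v + v') * (u i * u' j)) * (Fintype.card F : ℤ) ^ a +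
          c' * (2 ^ (v + v') * (u i' * u' j')))
    (g : Matrix.symplecticGroup (Fin n) F) :
    ∃ a ∈ wordImage w (Matrix.symplecticGroup (Fin n) F),
      ∃ b ∈ wordImage w' (Matrix.symplecticGroup (Fin n) F), g = a * b := by
  obtain ⟨c, rfl⟩ := hn
  let p := ringChar F
  have : Fact p.Prime := ⟨CharP.char_is_prime F p⟩
  have : NeZero (2 ^ δ) := ⟨by positivity⟩
  let K := FiniteField.Extension F p (2 ^ δ)
  have hK : finrank F K = 2 ^ δ := FiniteField.finrank_extension F p (2 ^ δ)
  let T := Fin (2 ^ r * (2 ^ r' * (c * 2 ^ δ)))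
  have hT : Fintype.card T =
      Fintype.card I * (Fintype.card J * (Fintype.card (Fin c) * finrank F K)) := by
    simp only [T, Fintype.card_fin, hI, hJ, hK]
  let ε : Fin (2 ^ (1 + r + r' + δ) * c) ≃ T ⊕ T := Fintype.equivOfCardEq (by
    simp only [T, Fintype.card_fin, Fintype.card_sum]; ring)
  obtain ⟨θ, hθ⟩ := exists_zpow_eq_neg_one (F := F) (K := K) (v := v') hu' fun hq => by
    rw [hK]
    refine (pow_dvd_pow 2 (by omega)).trans (two_pow_dvd_pow_sub_one ?_ δ)
    exact_mod_cast hq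
  have hkey : ∀ i j, 2 ^ v * u i * (2 ^ v' * u' j) = 2 ^ (v + v') * (u i * u' j) :=
    fun i j => by ring
  obtain ⟨a, ha, b, hb, hab⟩ := exists_mul_eq_of_not_dvd (K := K) hT he he' hθ (k := k)
    (by simpa only [hkey, hK] using hk) (symplecticReindex ε g)
  refine ⟨_, map_mem_wordImage (symplecticReindex ε.symm) ha, _,
    map_mem_wordImage (symplecticReindex ε.symm) hb, ?_⟩
  rw [← map_mul, ← hab, symplecticReindex_symm_apply]

end Final

section Final

theorem mul_sub_mul_dvd {u u' k k' D : ℤ} (h : D ∣ u - k) (h' : D ∣ u' - k') :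
    D ∣ u * u' - k * k' := by
  have h1 : u * u' - k * k' = (u - k) * u' + k * (u' - k') := by ring
  rw [h1]
  exact (h.mul_right _).add (h'.mul_left _)

/-- Absence of resonances for the exponents of level `3` when `q` is even or large. -/
theorem not_dvd_of_even_or_large {ι : Type} {q B k : ℤ} {v η : ℕ} {E : ι → ℤ} (hq : 2 ≤ q)
    (hqB : Odd q → B < q) (hk : Odd k) (hE : ∀ x, 8 ∣ E x - k) (hEB : ∀ x, |E x| ≤ B)
    (hB : 3 * (2 ^ v * B) + 1 < 2 ^ 2 ^ η) (hv : v ≤ η) :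
    ∃ κ : ℤ, ∀ c c' : ℤ, ((c = 1 ∨ c = κ) ∧ (c' = 1 ∨ c' = κ) ∨ c = 1 ∧ c' = -κ) →
      ∀ x y, ∀ a < 2 ^ (η + 1), ¬ q ^ 2 ^ (η + 1) - 1 ∣
        c * (2 ^ v * E x) * q ^ a + c' * (2 ^ v * E y) := by
  have hEo : ∀ x, Odd (E x) := fun x => odd_of_dvd_sub (s := 3) hk (by norm_num) (hE x)
  rcases Int.even_or_odd q with hq2 | hq2
  · refine ⟨3, fun c c' hc x y a ha => ?_⟩
    rw [pow_succ' 2 η] at ha ⊢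
    rcases hc with ⟨rfl | rfl, rfl | rfl⟩ | ⟨rfl, rfl⟩ <;>
    exact not_dvd_of_even hq hq2 hk (hE x) (hE y) (by decide) (by decide) (by decide)
      (by norm_num) (by norm_num) (hEB x) (hEB y) hB ha
  · refine ⟨2, fun c c' hc x y a ha => ?_⟩
    have hD : (2 : ℤ) ^ (v + 1) ∣ q ^ 2 ^ (η + 1) - 1 :=
      (pow_dvd_pow 2 (by omega)).trans (two_pow_dvd_pow_sub_one hq2 (η + 1))
    have h1 : ∀ c : ℤ, c ≠ 0 → |c| ≤ 3 → ¬ q ^ 2 ^ (η + 1) - 1 ∣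
        c * (2 ^ v * E x) * q ^ a + c * (2 ^ v * E y) := fun c hc hc3 => by
      rw [pow_succ' 2 η] at ha ⊢
      exact not_dvd_of_large hq (hqB hq2) hk (hE x) (hE y) hc hc3 (hEB x) (hEB y) hB ha
    have h2 : ∀ c c' : ℤ, Odd (c + c') → ¬ q ^ 2 ^ (η + 1) - 1 ∣
        c * (2 ^ v * E x) * q ^ a + c' * (2 ^ v * E y) := fun c c' hc =>
      not_dvd_of_odd_add hq2 (hEo x) (hEo y) hc hD a
    rcases hc with ⟨rfl | rfl, rfl | rfl⟩ | ⟨rfl, rfl⟩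
    · exact h1 1 (by norm_num) (by norm_num)
    · exact h2 _ _ (by decide)
    · exact h2 _ _ (by decide)
    · exact h1 2 (by norm_num) (by norm_num)
    · exact h2 _ _ (by decide)

/-- Absence of resonances for odd `q` that is small compared with the level of the exponents. -/
theorem not_dvd_of_odd_of_small {ι : Type} {q k : ℤ} {s v η : ℕ} {E : ι → ℤ} (hq : 2 ≤ q)
    (hq2 : Odd q) (hs : 2 ≤ s) (hqs : q + 1 < 2 ^ s) (hk : Odd k) (hE : ∀ x, 2 ^ s ∣ E x - k)
    (hv : v + s ≤ η + 1) :
    ∀ c c' : ℤ, ((c = 1 ∨ c = 2) ∧ (c' = 1 ∨ c' = 2) ∨ c = 1 ∧ c' = -2) →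
      ∀ x y, ∀ a < 2 ^ (η + 1), ¬ q ^ 2 ^ (η + 1) - 1 ∣
        c * (2 ^ v * E x) * q ^ a + c' * (2 ^ v * E y) := by
  intro c c' hc x y a _
  have hEo : ∀ x, Odd (E x) := fun x => odd_of_dvd_sub hk (by omega) (hE x)
  have hD : (2 : ℤ) ^ (v + s + 1) ∣ q ^ 2 ^ (η + 1) - 1 :=
    (pow_dvd_pow 2 (by omega)).trans (two_pow_dvd_pow_sub_one hq2 (η + 1))
  have h1 : ∀ c : ℤ, c = 1 ∨ c = 2 → ¬ q ^ 2 ^ (η + 1) - 1 ∣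
      c * (2 ^ v * E x) * q ^ a + c * (2 ^ v * E y) := fun c hc =>
    not_dvd_of_small hs (by linarith) hqs hq2 hk (hE x) (hE y) hc hD a
  have h2 : ∀ c c' : ℤ, Odd (c + c') → ¬ q ^ 2 ^ (η + 1) - 1 ∣
      c * (2 ^ v * E x) * q ^ a + c' * (2 ^ v * E y) := fun c c' hc =>
    not_dvd_of_odd_add hq2 (hEo x) (hEo y) hc ((pow_dvd_pow 2 (by omega)).trans hD) a
  rcases hc with ⟨rfl | rfl, rfl | rfl⟩ | ⟨rfl, rfl⟩
  · exact h1 1 (.inl rfl)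
  · exact h2 _ _ (by decide)
  · exact h2 _ _ (by decide)
  · exact h1 2 (.inr rfl)
  · exact h2 _ _ (by decide)

end Final

end SymplecticWord

theorem stmt6 {d1 d2 : ℕ} (w1 : FreeGroup (Fin d1)) (w2 : FreeGroup (Fin d2))
    (hw1 : w1 ≠ 1) (hw2 : w2 ≠ 1) :
    ∃ N : ℕ, ∀ n : ℕ, 2 ^ N ∣ n → ∀ q : ℕ, IsPrimePow q →
      ∀ (F : Type) [Field F] [Fintype F], Fintype.card F = q →
        ∀ g : Matrix.symplecticGroup (Fin n) F,
          ∃ a ∈ wordImage w1 (Matrix.symplecticGroup (Fin n) F),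
            ∃ b ∈ wordImage w2 (Matrix.symplecticGroup (Fin n) F), g = a * b := by
  open SymplecticWord in
  obtain ⟨v, k, hk, H⟩ := exists_odd_exponents hw1
  obtain ⟨v', k', hk', H'⟩ := exists_odd_exponents hw2
  obtain ⟨I, _, r, u, hI, hu, hB⟩ := H 3
  obtain ⟨I', _, r', u', hI', hu', hB'⟩ := H' 3
  obtain ⟨B, hEB⟩ : ∃ B : ℕ, ∀ x : I × I', |u x.1 * u' x.2| ≤ (B : ℤ) :=
    ⟨∑ x : I × I', (u x.1 * u' x.2).natAbs, fun x => by
      rw [Int.abs_eq_natAbs, Nat.cast_le]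
      exact Finset.single_le_sum (f := fun x : I × I' => (u x.1 * u' x.2).natAbs)
        (fun _ _ => Nat.zero_le _) (Finset.mem_univ x)⟩
  let s := B + 3
  obtain ⟨J, _, t, z, hJ, hz, hC⟩ := H s
  obtain ⟨J', _, t', z', hJ', hz', hC'⟩ := H' s
  let η := 3 * (2 ^ (v + v') * B) + 1 + (v + v') + s
  have hη : 3 * (2 ^ (v + v') * (B : ℤ)) + 1 < 2 ^ 2 ^ η := by
    have h1 : η < 2 ^ 2 ^ η := Nat.lt_two_pow_self.trans Nat.lt_two_pow_self
    have h2 : 3 * (2 ^ (v + v') * B) + 1 < 2 ^ 2 ^ η := by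
      refine lt_of_le_of_lt ?_ h1
      simp only [η]
      omega
    exact_mod_cast h2
  refine ⟨(1 + r + r' + (η + 1)) + (1 + t + t' + (η + 1)), fun n hn q hq F _ _ hF g => ?_⟩
  subst hF
  have hq2 : (2 : ℤ) ≤ Fintype.card F := by exact_mod_cast Fintype.one_lt_card
  by_cases hcase : Odd (Fintype.card F : ℤ) → (B : ℤ) < Fintype.card F
  · obtain ⟨κ, hκ⟩ := not_dvd_of_even_or_large (ι := I × I') (E := fun x => u x.1 * u' x.2)
      (v := v + v') (k := k * k') (η := η) hq2 hcase (hk.mul hk')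
      (fun x => mul_sub_mul_dvd (hu x.1) (hu' x.2)) hEB hη (by simp only [η]; omega)
    exact exists_mul_eq_fin hI hI' ((pow_dvd_pow 2 (by omega)).trans hn) hB hB'
      (fun j => odd_of_dvd_sub hk' (by norm_num) (hu' j)) (δ := η + 1) (by simp only [η]; omega)
      (fun c c' hc i j i' j' => hκ c c' hc (i, j) (i', j')) g
  · rw [Classical.not_imp, not_lt] at hcase
    have hqs : (Fintype.card F : ℤ) + 1 < 2 ^ s := by
      have h1 : s < 2 ^ s := Nat.lt_two_pow_self
      have h2 : ((s : ℕ) : ℤ) < 2 ^ s := by exact_mod_cast h1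
      have h3 : ((s : ℕ) : ℤ) = B + 3 := by simp [s]
      linarith [hcase.2]
    have hκ := not_dvd_of_odd_of_small (ι := J × J') (E := fun x => z x.1 * z' x.2)
      (v := v + v') (k := k * k') (η := η) hq2 hcase.1 (s := s) (by simp only [s]; omega) hqs
      (hk.mul hk') (fun x => mul_sub_mul_dvd (hz x.1) (hz' x.2)) (by simp only [η]; omega)
    exact exists_mul_eq_fin hJ hJ' ((pow_dvd_pow 2 (by omega)).trans hn) hC hC'
      (fun j => odd_of_dvd_sub hk' (by simp only [s]; omega) (hz' j)) (δ := η + 1)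
      (by simp only [η]; omega)
      (fun c c' hc i j i' j' => hκ c c' hc (i, j) (i', j')) g
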